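/- Let a C¹-spacetime on ℝⁿ be globally hyperbolic, causally non-branching, and non-intertwining. Then the following are equivalent: (1) the spacetime is finitely compact; (2) the spacetime is timelike Cauchy complete; (3) the spacetime satisfies Condition A. -/

import Mathlib

open Set Filter Topology MeasureTheory
open scoped ENNReal NNReal

noncomputable section

/-- Points of ℝⁿ. -/
abbrev SpacetimePt (n : ℕ) := Fin n → ℝ

/-- Evaluation of a bilinear form given by a coefficient matrix. -/
def bilForm {n : ℕ} (g : Fin n → Fin n → ℝ) (u v : Fin n → ℝ) : ℝ :=
  ∑ i, ∑ j, g i j * u i * v j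

/-- The Minkowski matrix diag(−1,1,…,1). -/
def minkowskiMatrix (n : ℕ) : Fin n → Fin n → ℝ := fun i j =>
  if i = j then (if (i : ℕ) = 0 then -1 else 1) else 0

/-- A time-oriented C¹-spacetime on ℝⁿ: a C¹ family of symmetric bilinear forms of
Lorentzian signature (−,+,…,+), together with a continuous timelike vector field. -/
structure C1Spacetime (n : ℕ) where
  g : SpacetimePt n → Fin n → Fin n → ℝ
  g_contDiff : ContDiff ℝ 1 g
  g_symm : ∀ p i j, g p i j = g p j i
  g_lorentz : ∀ p : SpacetimePt n, ∃ L : (Fin n → ℝ) ≃ₗ[ℝ] (Fin n → ℝ),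
    ∀ i j, bilForm (g p) (L (Pi.single i 1)) (L (Pi.single j 1)) = minkowskiMatrix n i j
  X0 : SpacetimePt n → Fin n → ℝ
  X0_cont : Continuous X0
  X0_timelike : ∀ p, bilForm (g p) (X0 p) (X0 p) < 0

namespace C1Spacetime

variable {n : ℕ} (M : C1Spacetime n)

/-- The inverse metric. -/
def ginv (p : SpacetimePt n) : Matrix (Fin n) (Fin n) ℝ :=
  (Matrix.of (M.g p))⁻¹

/-- Christoffel symbols Γᵏᵢⱼ = ½ Σ_l gᵏˡ(∂ᵢ g_{jl} + ∂ⱼ g_{il} − ∂_l g_{ij}). -/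
def christoffel (k i j : Fin n) (p : SpacetimePt n) : ℝ :=
  (1 / 2) * ∑ l, M.ginv p k l *
    (fderiv ℝ (fun q => M.g q j l) p (Pi.single i 1)
      + fderiv ℝ (fun q => M.g q i l) p (Pi.single j 1)
      - fderiv ℝ (fun q => M.g q i j) p (Pi.single l 1))

/-- A geodesic on the interval `I` : a C² curve satisfying the geodesic equation. -/
def IsGeodesicOn (γ : ℝ → SpacetimePt n) (I : Set ℝ) : Prop :=
  ContDiffOn ℝ 2 γ I ∧ ∀ t ∈ I, ∀ k,
    derivWithin (fun s => derivWithin γ I s k) I t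
      + ∑ i, ∑ j, M.christoffel k i j (γ t) *
          derivWithin γ I t i * derivWithin γ I t j = 0

/-- `v` is a causal vector at `p`. -/
def CausalVec (p v : SpacetimePt n) : Prop := v ≠ 0 ∧ bilForm (M.g p) v v ≤ 0

/-- `v` is a timelike vector at `p`. -/
def TimelikeVec (p v : SpacetimePt n) : Prop := bilForm (M.g p) v v < 0

/-- A causal vector `v` at `p` is future-directed. -/
def FdVec (p v : SpacetimePt n) : Prop := bilForm (M.g p) v (M.X0 p) < 0

/-- A causal vector `v` at `p` is past-directed. -/
def PdVec (p v : SpacetimePt n) : Prop := 0 < bilForm (M.g p) v (M.X0 p)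

/-- A causal geodesic on `I`: the velocity is everywhere causal. -/
def IsCausalGeodesicOn (γ : ℝ → SpacetimePt n) (I : Set ℝ) : Prop :=
  M.IsGeodesicOn γ I ∧ ∀ t ∈ I, M.CausalVec (γ t) (derivWithin γ I t)

/-- A future-directed causal geodesic on `I`. -/
def IsFdCausalGeodesicOn (γ : ℝ → SpacetimePt n) (I : Set ℝ) : Prop :=
  M.IsGeodesicOn γ I ∧ ∀ t ∈ I,
    M.CausalVec (γ t) (derivWithin γ I t) ∧ M.FdVec (γ t) (derivWithin γ I t)

/-- A past-directed causal geodesic on `I`. -/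
def IsPdCausalGeodesicOn (γ : ℝ → SpacetimePt n) (I : Set ℝ) : Prop :=
  M.IsGeodesicOn γ I ∧ ∀ t ∈ I,
    M.CausalVec (γ t) (derivWithin γ I t) ∧ M.PdVec (γ t) (derivWithin γ I t)

/-- A geodesic `γ : [a,b] → ℝⁿ` branches at `t₀ ∈ (a,b)`. -/
def BranchesAt (γ : ℝ → SpacetimePt n) (a b t₀ : ℝ) : Prop :=
  ∃ ε > 0, a ≤ t₀ - ε ∧ t₀ + ε ≤ b ∧
    ∃ σ : ℝ → SpacetimePt n, M.IsGeodesicOn σ (Ioo (t₀ - ε) (t₀ + ε)) ∧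
      (∀ t ∈ Ioc (t₀ - ε) t₀, γ t = σ t) ∧
      (γ '' Ioo t₀ (t₀ + ε)) ∩ (σ '' Ioo t₀ (t₀ + ε)) = ∅

/-- No causal geodesic branches. -/
def CausallyNonBranching : Prop :=
  ∀ (γ : ℝ → SpacetimePt n) (a b : ℝ), a < b → M.IsCausalGeodesicOn γ (Icc a b) →
    ∀ t₀ ∈ Ioo a b, ¬ M.BranchesAt γ a b t₀

/-- Non-intertwining. -/
def NonIntertwining : Prop :=
  ∀ p : SpacetimePt n, ∃ U ∈ 𝓝 p, ∀ ε : ℝ, 0 < ε → ∀ γ₁ γ₂ : ℝ → SpacetimePt n,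
    M.IsCausalGeodesicOn γ₁ (Icc 0 ε) → M.IsCausalGeodesicOn γ₂ (Icc 0 ε) →
    (∀ t ∈ Icc (0:ℝ) ε, γ₁ t ∈ U) → (∀ t ∈ Icc (0:ℝ) ε, γ₂ t ∈ U) →
    γ₁ 0 = p → γ₂ 0 = p →
    derivWithin γ₁ (Icc 0 ε) 0 = derivWithin γ₂ (Icc 0 ε) 0 →
    (∀ t ∈ Icc (0:ℝ) ε, γ₁ t = γ₂ t) ∨
      ¬ ∃ z : SpacetimePt n, AccPt z (𝓟 ((γ₁ '' Ioc 0 ε) ∩ (γ₂ '' Ioc 0 ε)))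

/-- Domain of the causal exponential map at `p`. -/
def ExpDomain (p : SpacetimePt n) : Set (SpacetimePt n) :=
  {v | bilForm (M.g p) v v ≤ 0 ∧
    ∃ γ : ℝ → SpacetimePt n, M.IsCausalGeodesicOn γ (Icc 0 1) ∧ γ 0 = p ∧
      derivWithin γ (Icc 0 1) 0 = v}

/-- A future-directed causal path on the interval `I`: locally Lipschitz with almost
everywhere future-directed causal derivative. -/
def IsFdCausalPathOn (γ : ℝ → SpacetimePt n) (I : Set ℝ) : Prop :=
  I.OrdConnected ∧ I.Nonempty ∧
    (∀ t ∈ I, ∃ K : ℝ≥0, ∃ U ∈ 𝓝[I] t, LipschitzOnWith K γ U) ∧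
    ∀ᵐ t ∂(volume.restrict I), DifferentiableAt ℝ γ t ∧
      M.CausalVec (γ t) (deriv γ t) ∧ M.FdVec (γ t) (deriv γ t)

/-- A future-directed timelike path on the interval `I`. -/
def IsFdTimelikePathOn (γ : ℝ → SpacetimePt n) (I : Set ℝ) : Prop :=
  I.OrdConnected ∧ I.Nonempty ∧
    (∀ t ∈ I, ∃ K : ℝ≥0, ∃ U ∈ 𝓝[I] t, LipschitzOnWith K γ U) ∧
    ∀ᵐ t ∂(volume.restrict I), DifferentiableAt ℝ γ t ∧
      M.TimelikeVec (γ t) (deriv γ t) ∧ M.FdVec (γ t) (deriv γ t)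

/-- Chronological relation `p ≪ q`. -/
def chron (p q : SpacetimePt n) : Prop :=
  ∃ (γ : ℝ → SpacetimePt n) (a b : ℝ), a < b ∧ M.IsFdTimelikePathOn γ (Icc a b) ∧
    γ a = p ∧ γ b = q

/-- Causal relation `p ≤ q`. -/
def causalLe (p q : SpacetimePt n) : Prop :=
  p = q ∨ ∃ (γ : ℝ → SpacetimePt n) (a b : ℝ), a < b ∧ M.IsFdCausalPathOn γ (Icc a b) ∧
    γ a = p ∧ γ b = q

/-- g-length of a causal path on `[a,b]`. -/
def gLength (γ : ℝ → SpacetimePt n) (a b : ℝ) : ℝ :=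
  ∫ t in a..b, Real.sqrt (- bilForm (M.g (γ t)) (deriv γ t) (deriv γ t))

/-- Lorentzian distance. -/
def ldist (p q : SpacetimePt n) : ℝ≥0∞ :=
  ⨆ (γ : ℝ → SpacetimePt n) (a : ℝ) (b : ℝ) (_ : a < b)
    (_ : M.IsFdCausalPathOn γ (Icc a b)) (_ : γ a = p) (_ : γ b = q),
    ENNReal.ofReal (M.gLength γ a b)

/-- Non-total imprisonment: no future or past inextendible causal curve is contained
in a compact set (inextendible = no limit at the open end). -/
def NonImprisoning : Prop :=
  ∀ K : Set (SpacetimePt n), IsCompact K →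
    (∀ (a b : ℝ) (γ : ℝ → SpacetimePt n), M.IsFdCausalPathOn γ (Ico a b) →
      (¬ ∃ q, Tendsto γ (𝓝[<] b) (𝓝 q)) → ¬ ∀ t ∈ Ico a b, γ t ∈ K) ∧
    (∀ (a : ℝ) (γ : ℝ → SpacetimePt n), M.IsFdCausalPathOn γ (Ici a) →
      (¬ ∃ q, Tendsto γ atTop (𝓝 q)) → ¬ ∀ t ∈ Ici a, γ t ∈ K) ∧
    (∀ (a b : ℝ) (γ : ℝ → SpacetimePt n), M.IsFdCausalPathOn γ (Ioc a b) →
      (¬ ∃ q, Tendsto γ (𝓝[>] a) (𝓝 q)) → ¬ ∀ t ∈ Ioc a b, γ t ∈ K) ∧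
    (∀ (b : ℝ) (γ : ℝ → SpacetimePt n), M.IsFdCausalPathOn γ (Iic b) →
      (¬ ∃ q, Tendsto γ atBot (𝓝 q)) → ¬ ∀ t ∈ Iic b, γ t ∈ K)

/-- Global hyperbolicity. -/
def GloballyHyperbolic : Prop :=
  M.NonImprisoning ∧
    ∀ p q : SpacetimePt n, IsCompact {z : SpacetimePt n | M.causalLe p z ∧ M.causalLe z q}

/-- Finite compactness. -/
def FinitelyCompact : Prop :=
  ∀ B : ℝ, 0 < B → ∀ p q : SpacetimePt n, ∀ x : ℕ → SpacetimePt n,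
    ((∀ m, M.chron p q ∧ M.causalLe q (x m) ∧ M.ldist p (x m) ≤ ENNReal.ofReal B) →
      ∃ z : SpacetimePt n, MapClusterPt z atTop x) ∧
    ((∀ m, M.causalLe (x m) q ∧ M.chron q p ∧ M.ldist (x m) p ≤ ENNReal.ofReal B) →
      ∃ z : SpacetimePt n, MapClusterPt z atTop x)

/-- Timelike Cauchy completeness. -/
def TimelikeCauchyComplete : Prop :=
  ∀ (x : ℕ → SpacetimePt n) (B : ℕ → ℝ), (∀ m, 0 ≤ B m) → Tendsto B atTop (𝓝 0) →
    (((∀ m, M.chron (x m) (x (m + 1))) ∧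
        ∀ k m : ℕ, 0 < m → M.ldist (x k) (x (k + m)) ≤ ENNReal.ofReal (B k)) ∨
      ((∀ m, M.chron (x (m + 1)) (x m)) ∧
        ∀ k m : ℕ, 0 < m → M.ldist (x (k + m)) (x k) ≤ ENNReal.ofReal (B k))) →
    ∃ l : SpacetimePt n, Tendsto x atTop (𝓝 l)

/-- Condition A for C¹-spacetimes: for `x ≪ y` and every future inextendible
future-directed causal geodesic starting at `y` defined on `[0,c)` (`c ∈ (0,∞]`),
the Lorentzian distance `T(x, γ(t))` tends to infinity as `t → c`; dually for the past. -/
def ConditionA : Prop :=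
  (∀ x y : SpacetimePt n, M.chron x y →
    (∀ c : ℝ, 0 < c → ∀ γ : ℝ → SpacetimePt n, M.IsFdCausalGeodesicOn γ (Ico 0 c) →
      γ 0 = y → (¬ ∃ z, Tendsto γ (𝓝[<] c) (𝓝 z)) →
      Tendsto (fun t => M.ldist x (γ t)) (𝓝[<] c) (𝓝 ⊤)) ∧
    (∀ γ : ℝ → SpacetimePt n, M.IsFdCausalGeodesicOn γ (Ici 0) →
      γ 0 = y → (¬ ∃ z, Tendsto γ atTop (𝓝 z)) →
      Tendsto (fun t => M.ldist x (γ t)) atTop (𝓝 ⊤))) ∧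
  (∀ x y : SpacetimePt n, M.chron y x →
    (∀ c : ℝ, 0 < c → ∀ γ : ℝ → SpacetimePt n, M.IsPdCausalGeodesicOn γ (Ico 0 c) →
      γ 0 = y → (¬ ∃ z, Tendsto γ (𝓝[<] c) (𝓝 z)) →
      Tendsto (fun t => M.ldist (γ t) x) (𝓝[<] c) (𝓝 ⊤)) ∧
    (∀ γ : ℝ → SpacetimePt n, M.IsPdCausalGeodesicOn γ (Ici 0) →
      γ 0 = y → (¬ ∃ z, Tendsto γ atTop (𝓝 z)) →
      Tendsto (fun t => M.ldist (γ t) x) atTop (𝓝 ⊤)))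

end C1Spacetime

/-! ### Locally bounded measurable functions and their primitives -/

section Primitives

variable {E F : Type*} [NormedAddCommGroup E] [NormedAddCommGroup F]

/-- A measurable function on the line that is bounded on bounded sets. -/
def LocBdd (U : ℝ → E) : Prop :=
  AEStronglyMeasurable U volume ∧ ∀ T : ℝ, ∃ K : ℝ, ∀ t, |t| ≤ T → ‖U t‖ ≤ K

theorem LocBdd.intervalIntegrable {U : ℝ → E} (hU : LocBdd U) (a b : ℝ) :
    IntervalIntegrable U volume a b := by
  obtain ⟨K, hK⟩ := hU.2 (max |a| |b|)
  rw [intervalIntegrable_iff]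
  refine Measure.integrableOn_of_bounded (M := K) (by simp) hU.1 ?_
  filter_upwards [ae_restrict_mem measurableSet_uIoc] with t ht
  refine hK t ?_
  rcases mem_uIoc.1 ht with h | h
  · exact abs_le_max_abs_abs h.1.le h.2
  · rw [max_comm]; exact abs_le_max_abs_abs h.1.le h.2

theorem LocBdd.locallyIntegrable {U : ℝ → E} (hU : LocBdd U) : LocallyIntegrable U volume := by
  rw [locallyIntegrable_iff]
  intro k hk
  obtain ⟨R, hR⟩ := hk.isBounded.subset_closedBall 0
  obtain ⟨K, hK⟩ := hU.2 R
  refine Measure.integrableOn_of_bounded (M := K) hk.measure_lt_top.ne hU.1 ?_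
  rw [ae_restrict_iff₀ (nullMeasurableSet_le hU.1.restrict.norm.aemeasurable aemeasurable_const)]
  exact Eventually.of_forall fun t ht => hK t (by simpa using hR ht)

theorem Continuous.locBdd {U : ℝ → E} (hU : Continuous U) : LocBdd U := by
  refine ⟨hU.aestronglyMeasurable, fun T => ?_⟩
  obtain ⟨K', hK'⟩ := (isCompact_closedBall (0 : ℝ) T).exists_bound_of_continuousOn
    hU.continuousOn
  exact ⟨K', fun t ht => hK' t (by simpa using ht)⟩

theorem LocBdd.norm {A : ℝ → E} (hA : LocBdd A) : LocBdd fun t => ‖A t‖ :=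
  ⟨hA.1.norm, fun T => by simpa using hA.2 T⟩

variable [NormedSpace ℝ E] [NormedSpace ℝ F]

theorem LocBdd.locallyLipschitz_primitive {U : ℝ → E} (hU : LocBdd U) (x₀ : E) :
    LocallyLipschitz fun t => x₀ + ∫ s in (0 : ℝ)..t, U s := by
  intro t
  obtain ⟨K, hK⟩ := hU.2 (|t| + 1)
  refine ⟨K.toNNReal, Metric.ball t 1, Metric.ball_mem_nhds _ one_pos, ?_⟩
  refine LipschitzOnWith.of_dist_le_mul fun a ha b hb => ?_
  rw [dist_add_left, dist_eq_norm,
    intervalIntegral.integral_interval_sub_left (hU.intervalIntegrable _ _)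
      (hU.intervalIntegrable _ _)]
  rw [Real.dist_eq]
  refine intervalIntegral.norm_integral_le_of_norm_le_const fun s hs => ?_
  refine (hK s ?_).trans (Real.le_coe_toNNReal K)
  rw [Metric.mem_ball, Real.dist_eq] at ha hb
  have h1 := abs_sub_abs_le_abs_sub a t
  have h2 := abs_sub_abs_le_abs_sub b t
  rcases mem_uIoc.1 hs with h | h
  · exact (abs_le_max_abs_abs h.1.le h.2).trans (max_le (by linarith) (by linarith))
  · exact (abs_le_max_abs_abs h.1.le h.2).trans (max_le (by linarith) (by linarith))

theorem LocBdd.ae_hasDerivAt [CompleteSpace E] {U : ℝ → E} (hU : LocBdd U) (x₀ : E) :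
    ∀ᵐ t, HasDerivAt (fun t => x₀ + ∫ s in (0 : ℝ)..t, U s) (U t) t := by
  filter_upwards [_root_.LocallyIntegrable.ae_hasDerivAt_integral hU.locallyIntegrable] with t ht
  exact (ht 0).const_add x₀

theorem LocBdd.clm_apply {f : ℝ → E →L[ℝ] F} {U : ℝ → E} (hf : Continuous f) (hU : LocBdd U) :
    LocBdd fun t => f t (U t) := by
  refine ⟨?_, fun T => ?_⟩
  · exact isBoundedBilinearMap_apply.continuous.comp_aestronglyMeasurable
      (hf.aestronglyMeasurable.prodMk hU.1)
  · obtain ⟨K, hK⟩ := hU.2 T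
    obtain ⟨K', hK'⟩ := (isCompact_closedBall (0 : ℝ) T).exists_bound_of_continuousOn
      hf.continuousOn
    refine ⟨K' * K, fun t ht => ?_⟩
    have h1 := hK' t (by simpa using ht)
    exact ((f t).le_opNorm _).trans (mul_le_mul h1 (hK t ht) (norm_nonneg _)
      ((norm_nonneg _).trans h1))

theorem LocallyLipschitz.eq_of_ae_hasDerivAt_zero {f : ℝ → E} (hf : LocallyLipschitz f)
    {a b : ℝ} (hab : a ≤ b) (h : ∀ᵐ t, t ∈ Ioo a b → HasDerivAt f 0 t) : f a = f b := by
  obtain ⟨K, hK⟩ := (hf.locallyLipschitzOn (s := uIcc a b)).exists_lipschitzOnWith_of_compact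
    isCompact_uIcc
  obtain ⟨C, hC⟩ := hK.absolutelyContinuousOnInterval.const_of_ae_hasDerivAt_zero (by
    filter_upwards [h, Measure.ae_ne volume a, Measure.ae_ne volume b] with t ht ha hb hmem
    rw [uIcc_of_le hab] at hmem
    exact ht ⟨lt_of_le_of_ne hmem.1 (Ne.symm ha), lt_of_le_of_ne hmem.2 hb⟩)
  rw [hC a left_mem_uIcc, hC b right_mem_uIcc]

theorem LocallyLipschitz.eq_add_integral [CompleteSpace E] {f : ℝ → E} (hf : LocallyLipschitz f)
    {U : ℝ → E} (hU : LocBdd U) {T : ℝ} (hT : 0 ≤ T)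
    (h : ∀ᵐ t, t ∈ Ioo 0 T → HasDerivAt f (U t) t) : f T = f 0 + ∫ s in (0 : ℝ)..T, U s := by
  have h1 : LocallyLipschitz fun t => f t - (0 + ∫ s in (0 : ℝ)..t, U s) :=
    hf.sub (hU.locallyLipschitz_primitive 0)
  have := h1.eq_of_ae_hasDerivAt_zero hT (by
    filter_upwards [h, hU.ae_hasDerivAt 0] with t h1 h2 h3
    have h4 := (h1 h3).fun_sub h2
    rwa [sub_self] at h4)
  simp only [intervalIntegral.integral_same, zero_add, sub_zero] at this
  rw [this]; abel

end Primitives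

/-! ### Linear equations with locally bounded measurable coefficients -/

section LinearODE

variable {𝔸 : Type*} [NormedRing 𝔸]

theorem LocBdd.integral_norm_mul_exp_le {A : ℝ → 𝔸} (hA : LocBdd A) {t : ℝ} (ht : 0 ≤ t) :
    ∫ s in (0 : ℝ)..t, ‖A s‖ * Real.exp (2 * ∫ r in (0 : ℝ)..s, ‖A r‖) ≤
      Real.exp (2 * ∫ r in (0 : ℝ)..t, ‖A r‖) / 2 := by
  have hσ := hA.norm.locallyLipschitz_primitive 0
  simp only [zero_add] at hσ
  have hexp : ContDiff ℝ 1 fun x : ℝ => Real.exp (2 * x) / 2 := by fun_prop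
  have h1 := hexp.locallyLipschitz.comp hσ
  have hb : LocBdd fun s => ‖A s‖ * Real.exp (2 * ∫ r in (0 : ℝ)..s, ‖A r‖) := by
    have hc : Continuous fun s =>
        Real.exp (2 * ∫ r in (0 : ℝ)..s, ‖A r‖) • ContinuousLinearMap.id ℝ ℝ := by
      have := hσ.continuous
      fun_prop
    have := LocBdd.clm_apply hc hA.norm
    simpa [mul_comm] using this
  have h2 := h1.eq_add_integral hb ht (by
    filter_upwards [hA.norm.ae_hasDerivAt 0] with s hs _
    simp only [zero_add] at hs
    have := ((hs.const_mul 2).exp).div_const 2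
    refine this.congr_deriv ?_
    ring)
  simp only [Function.comp, intervalIntegral.integral_same] at h2
  rw [h2]
  simp only [mul_zero, Real.exp_zero]
  linarith

variable [NormedAlgebra ℝ 𝔸] [CompleteSpace 𝔸]

theorem exists_fundamental_solution {A : ℝ → 𝔸} (hA : LocBdd A) (hA0 : ∀ t < 0, A t = 0) :
    ∃ Y : ℝ → 𝔸, Continuous Y ∧ ∀ t, Y t = 1 + ∫ s in (0 : ℝ)..t, A s * Y s := by
  set σ : ℝ → ℝ := fun t => ∫ r in (0 : ℝ)..t, ‖A r‖ with hσ
  have hσc : Continuous σ := by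
    have := (hA.norm.locallyLipschitz_primitive 0).continuous
    simpa only [zero_add] using this
  have hzero : ∀ (f : ℝ → 𝔸) (t : ℝ), t ≤ 0 → ∫ s in (0 : ℝ)..t, A s * f s = 0 := by
    intro f t ht
    rw [intervalIntegral.integral_of_ge ht, neg_eq_zero, setIntegral_congr_ae (g := fun _ => 0)
      measurableSet_Ioc, integral_zero]
    filter_upwards [Measure.ae_ne volume (0 : ℝ)] with s hs hmem
    rw [hA0 s (lt_of_le_of_ne hmem.2 hs), zero_mul]
  have hσnn : ∀ t, 0 ≤ σ t := by
    intro t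
    rcases le_total 0 t with ht | ht
    · exact intervalIntegral.integral_nonneg ht fun _ _ => norm_nonneg _
    · have : σ t = 0 := by
        rw [hσ]
        simp only
        rw [intervalIntegral.integral_of_ge ht, neg_eq_zero,
          setIntegral_congr_ae (g := fun _ => 0) measurableSet_Ioc, integral_zero]
        filter_upwards [Measure.ae_ne volume (0 : ℝ)] with s hs hmem
        rw [hA0 s (lt_of_le_of_ne hmem.2 hs), norm_zero]
      exact this.ge
  have hmul : ∀ f : ℝ → 𝔸, Continuous f → LocBdd fun s => A s * f s := by
    intro f hf
    have hc : Continuous fun s => (ContinuousLinearMap.mul ℝ 𝔸).flip (f s) := by fun_prop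
    simpa using LocBdd.clm_apply hc hA
  have hintegral : ∀ (u : BoundedContinuousFunction ℝ 𝔸) (t : ℝ),
      ‖∫ s in (0 : ℝ)..t, A s * (Real.exp (2 * σ s) • u s)‖ ≤
        ‖u‖ * (Real.exp (2 * σ t) / 2) := by
    intro u t
    rcases le_total 0 t with ht | ht
    · refine (intervalIntegral.norm_integral_le_integral_norm ht).trans ?_
      refine le_trans ?_ (mul_le_mul_of_nonneg_left (hA.integral_norm_mul_exp_le ht)
        (norm_nonneg u))
      rw [← intervalIntegral.integral_const_mul]
      refine intervalIntegral.integral_mono_on ht ?_ ?_ ?_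
      · exact ((hmul _ (by fun_prop)).intervalIntegrable _ _).norm
      · have hc : Continuous fun s => (‖u‖ * Real.exp (2 * σ s)) • ContinuousLinearMap.id ℝ ℝ := by
          fun_prop
        have := LocBdd.clm_apply hc hA.norm
        refine LocBdd.intervalIntegrable ?_ _ _
        convert this using 2 with s
        simp [hσ]; ring
      · intro s _
        refine (norm_mul_le _ _).trans ?_
        rw [norm_smul, Real.norm_eq_abs, abs_of_pos (Real.exp_pos _)]
        have := u.norm_coe_le_norm s
        have h3 : Real.exp (2 * σ s) * ‖u s‖ ≤ Real.exp (2 * σ s) * ‖u‖ := by gcongr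
        calc ‖A s‖ * (Real.exp (2 * σ s) * ‖u s‖) ≤ ‖A s‖ * (Real.exp (2 * σ s) * ‖u‖) := by
              gcongr
          _ = _ := by ring
    · rw [hzero _ t ht, norm_zero]; positivity
  have hexp : ∀ t, Real.exp (-(2 * σ t)) * Real.exp (2 * σ t) = 1 := by
    intro t; rw [← Real.exp_add]; simp
  have hexp1 : ∀ t, Real.exp (-(2 * σ t)) ≤ 1 := by
    intro t; rw [Real.exp_le_one_iff]; linarith [hσnn t]
  have hcont : ∀ u : BoundedContinuousFunction ℝ 𝔸, Continuous fun t =>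
      Real.exp (-(2 * σ t)) • (1 + ∫ s in (0 : ℝ)..t, A s * (Real.exp (2 * σ s) • u s)) := by
    intro u
    have := ((hmul (fun s => Real.exp (2 * σ s) • u s)
      (by fun_prop)).locallyLipschitz_primitive 1).continuous
    fun_prop
  let Φ : BoundedContinuousFunction ℝ 𝔸 → BoundedContinuousFunction ℝ 𝔸 := fun u =>
    BoundedContinuousFunction.ofNormedAddCommGroup _ (hcont u) (‖(1 : 𝔸)‖ + ‖u‖ / 2) (by
      intro t
      rw [norm_smul, Real.norm_eq_abs, abs_of_pos (Real.exp_pos _)]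
      calc Real.exp (-(2 * σ t)) * ‖1 + ∫ s in (0 : ℝ)..t, A s * (Real.exp (2 * σ s) • u s)‖
          ≤ Real.exp (-(2 * σ t)) * (‖(1 : 𝔸)‖ + ‖u‖ * (Real.exp (2 * σ t) / 2)) := by
            gcongr; exact (norm_add_le _ _).trans (by gcongr; exact hintegral u t)
        _ = Real.exp (-(2 * σ t)) * ‖(1 : 𝔸)‖ +
            (Real.exp (-(2 * σ t)) * Real.exp (2 * σ t)) * (‖u‖ / 2) := by ring
        _ ≤ 1 * ‖(1 : 𝔸)‖ + 1 * (‖u‖ / 2) := by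
            rw [hexp]; gcongr; exact hexp1 t
        _ = _ := by ring)
  have hΦ : ∀ u t, Φ u t =
      Real.exp (-(2 * σ t)) • (1 + ∫ s in (0 : ℝ)..t, A s * (Real.exp (2 * σ s) • u s)) :=
    fun u t => rfl
  have hcontr : ContractingWith (1 / 2) Φ := by
    refine ⟨by rw [div_lt_one] <;> norm_num, LipschitzWith.of_dist_le_mul fun u v => ?_⟩
    rw [BoundedContinuousFunction.dist_le (by positivity)]
    intro t
    have hsub : (∫ s in (0 : ℝ)..t, A s * (Real.exp (2 * σ s) • u s)) -
        (∫ s in (0 : ℝ)..t, A s * (Real.exp (2 * σ s) • v s)) =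
        ∫ s in (0 : ℝ)..t, A s * (Real.exp (2 * σ s) • (u - v) s) := by
      rw [← intervalIntegral.integral_sub ((hmul _ (by fun_prop)).intervalIntegrable _ _)
        ((hmul _ (by fun_prop)).intervalIntegrable _ _)]
      simp only [BoundedContinuousFunction.sub_apply, smul_sub, mul_sub]
    rw [hΦ, hΦ, dist_eq_norm, ← smul_sub, add_sub_add_left_eq_sub, hsub, norm_smul,
      Real.norm_eq_abs, abs_of_pos (Real.exp_pos _), dist_eq_norm]
    calc Real.exp (-(2 * σ t)) * ‖∫ s in (0 : ℝ)..t, A s * (Real.exp (2 * σ s) • (u - v) s)‖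
        ≤ Real.exp (-(2 * σ t)) * (‖u - v‖ * (Real.exp (2 * σ t) / 2)) := by
          gcongr; exact hintegral _ _
      _ = (Real.exp (-(2 * σ t)) * Real.exp (2 * σ t)) * (‖u - v‖ / 2) := by ring
      _ = _ := by rw [hexp]; push_cast; ring
  obtain ⟨u, hu, -⟩ := hcontr.exists_fixedPoint 0 (edist_ne_top _ _)
  refine ⟨fun t => Real.exp (2 * σ t) • u t, by fun_prop, fun t => ?_⟩
  have h := congrArg (fun w : BoundedContinuousFunction ℝ 𝔸 => w t) hu.eq
  simp only [hΦ] at h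
  have h5 : Real.exp (2 * σ t) • u t = 1 + ∫ s in (0 : ℝ)..t, A s * (Real.exp (2 * σ s) • u s) := by
    conv_lhs => rw [← h]
    rw [smul_smul, mul_comm, hexp, one_smul]
  exact h5

end LinearODE

/-! ### Existence of solutions for bounded continuous vector fields -/

section Peano

variable {E : Type*} [NormedAddCommGroup E] [NormedSpace ℝ E]

/-- The Euler scheme with step `1 / (k + 1)`. -/
def eulerScheme (F : E → E) (y₀ : E) (k : ℕ) : ℕ → E
  | 0 => y₀
  | j + 1 => eulerScheme F y₀ k j + (1 / ((k : ℝ) + 1)) • F (eulerScheme F y₀ k j)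

theorem eulerScheme_dist_le {F : E → E} (hF : ∀ y, ‖F y‖ ≤ 1) (y₀ : E) (k i j : ℕ) :
    ‖eulerScheme F y₀ k (i + j) - eulerScheme F y₀ k i‖ ≤ j / ((k : ℝ) + 1) := by
  induction j with
  | zero => simp
  | succ j ih =>
    have h1 : eulerScheme F y₀ k (i + (j + 1)) - eulerScheme F y₀ k i =
        (eulerScheme F y₀ k (i + j) - eulerScheme F y₀ k i) +
          (1 / ((k : ℝ) + 1)) • F (eulerScheme F y₀ k (i + j)) := by
      rw [← add_assoc, eulerScheme]; abel
    rw [h1]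
    refine (norm_add_le _ _).trans ?_
    rw [norm_smul, Real.norm_eq_abs, abs_of_pos (by positivity)]
    have := mul_le_mul_of_nonneg_left (hF (eulerScheme F y₀ k (i + j)))
      (show 0 ≤ 1 / ((k : ℝ) + 1) by positivity)
    push_cast
    rw [add_div]
    linarith

theorem eulerScheme_sub_smul_le {F : E → E} (y₀ : E) (k i j : ℕ) (w : E) (ω : ℝ)
    (h : ∀ l < j, ‖F (eulerScheme F y₀ k (i + l)) - w‖ ≤ ω) :
    ‖eulerScheme F y₀ k (i + j) - eulerScheme F y₀ k i - ((j : ℝ) / ((k : ℝ) + 1)) • w‖ ≤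
      j / ((k : ℝ) + 1) * ω := by
  induction j with
  | zero => simp
  | succ j ih =>
    have h1 : eulerScheme F y₀ k (i + (j + 1)) - eulerScheme F y₀ k i -
          (((j + 1 : ℕ) : ℝ) / ((k : ℝ) + 1)) • w =
        (eulerScheme F y₀ k (i + j) - eulerScheme F y₀ k i - ((j : ℝ) / ((k : ℝ) + 1)) • w) +
          (1 / ((k : ℝ) + 1)) • (F (eulerScheme F y₀ k (i + j)) - w) := by
      rw [← add_assoc, eulerScheme]
      push_cast
      rw [add_div, add_smul, smul_sub]; abel
    rw [h1]
    refine (norm_add_le _ _).trans ?_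
    rw [norm_smul, Real.norm_eq_abs, abs_of_pos (by positivity)]
    have h2 := ih fun l hl => h l (hl.trans (Nat.lt_succ_self j))
    have h3 := mul_le_mul_of_nonneg_left (h j (Nat.lt_succ_self j))
      (show 0 ≤ 1 / ((k : ℝ) + 1) by positivity)
    push_cast
    rw [add_div, add_mul]
    linarith

theorem exists_forall_eq_add_integral_of_norm_le_one [ProperSpace E] {F : E → E}
    (hFc : Continuous F) (hF : ∀ y, ‖F y‖ ≤ 1) (y₀ : E) :
    ∃ Y : ℝ → E, Continuous Y ∧ ∀ t, 0 ≤ t → Y t = y₀ + ∫ s in (0 : ℝ)..t, F (Y s) := by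
  let Z : ℕ → ℝ → E := fun k t => eulerScheme F y₀ k ⌊((k : ℝ) + 1) * t⌋₊
  have hk : ∀ k : ℕ, (0 : ℝ) < (k : ℝ) + 1 := fun k => by positivity
  have hfl : ∀ (k : ℕ) (s t : ℝ), s ≤ t → ∃ j : ℕ,
      ⌊((k : ℝ) + 1) * t⌋₊ = ⌊((k : ℝ) + 1) * s⌋₊ + j ∧
      (j : ℝ) / ((k : ℝ) + 1) ≤ (t - s) + 1 / ((k : ℝ) + 1) ∧
      (0 ≤ s → (t - s) - 1 / ((k : ℝ) + 1) ≤ (j : ℝ) / ((k : ℝ) + 1)) := by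
    intro k s t hst
    have hle : ((k : ℝ) + 1) * s ≤ ((k : ℝ) + 1) * t := by gcongr
    obtain ⟨j, hj⟩ := Nat.exists_eq_add_of_le (Nat.floor_mono hle)
    have hjr : (⌊((k : ℝ) + 1) * t⌋₊ : ℝ) = (⌊((k : ℝ) + 1) * s⌋₊ : ℝ) + j := by
      exact_mod_cast hj
    have h1 := Nat.lt_floor_add_one (((k : ℝ) + 1) * s)
    have h2 := Nat.lt_floor_add_one (((k : ℝ) + 1) * t)
    refine ⟨j, hj, ?_, fun hs => ?_⟩
    · rw [div_le_iff₀ (hk k), add_mul, div_mul_cancel₀ _ (hk k).ne']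
      rcases le_total 0 t with ht | ht
      · have h3 := Nat.floor_le (mul_nonneg (hk k).le ht)
        nlinarith
      · rw [Nat.floor_of_nonpos (mul_nonpos_of_nonneg_of_nonpos (hk k).le ht)] at hjr
        have : (0 : ℝ) ≤ (⌊((k : ℝ) + 1) * s⌋₊ : ℝ) := Nat.cast_nonneg _
        have : 0 ≤ (t - s) * ((k : ℝ) + 1) := mul_nonneg (by linarith) (hk k).le
        push_cast at hjr
        linarith
    · rw [le_div_iff₀ (hk k), sub_mul, div_mul_cancel₀ _ (hk k).ne']
      have h3 := Nat.floor_le (mul_nonneg (hk k).le hs)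
      nlinarith
  have hZ : ∀ (k : ℕ) (s t : ℝ), s ≤ t → ‖Z k t - Z k s‖ ≤ (t - s) + 1 / ((k : ℝ) + 1) := by
    intro k s t hst
    obtain ⟨j, hj, hj1, -⟩ := hfl k s t hst
    have := eulerScheme_dist_le hF y₀ k ⌊((k : ℝ) + 1) * s⌋₊ j
    rw [← hj] at this
    exact this.trans hj1
  have hZ0 : ∀ k t, t ≤ 0 → Z k t = y₀ := by
    intro k t ht
    simp only [Z, Nat.floor_of_nonpos (mul_nonpos_of_nonneg_of_nonpos (hk k).le ht), eulerScheme]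
  let 𝓤 : Ultrafilter ℕ := hyperfilter ℕ
  have h𝓤 : (𝓤 : Filter ℕ) ≤ atTop := by
    rw [← Nat.cofinite_eq_atTop]; exact hyperfilter_le_cofinite
  have hlim : ∀ t, ∃ y, Tendsto (fun k => Z k t) 𝓤 (𝓝 y) := by
    intro t
    have hmem : ∀ k, Z k t ∈ Metric.closedBall y₀ (|t| + 1) := by
      intro k
      have h1 : 1 / ((k : ℝ) + 1) ≤ 1 := by
        rw [div_le_one (hk k)]; linarith [(Nat.cast_nonneg k : (0 : ℝ) ≤ k)]
      rw [mem_closedBall_iff_norm]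
      rcases le_total 0 t with ht | ht
      · rw [← hZ0 k 0 le_rfl]
        refine (hZ k 0 t ht).trans ?_
        rw [abs_of_nonneg ht]; linarith
      · rw [hZ0 k t ht, sub_self, norm_zero]; positivity
    obtain ⟨y, -, hy⟩ := (isCompact_closedBall y₀ (|t| + 1)).ultrafilter_le_nhds
      (𝓤.map fun k => Z k t) (by
        rw [Ultrafilter.coe_map, le_principal_iff, mem_map]
        exact univ_mem' hmem)
    exact ⟨y, hy⟩
  choose Y hY using hlim
  have hinv : Tendsto (fun k : ℕ => 1 / ((k : ℝ) + 1)) 𝓤 (𝓝 0) :=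
    tendsto_one_div_add_atTop_nhds_zero_nat.mono_left h𝓤
  have hYL : ∀ s t, s ≤ t → ‖Y t - Y s‖ ≤ t - s := by
    intro s t hst
    have h1 : Tendsto (fun k : ℕ => (t - s) + 1 / ((k : ℝ) + 1)) 𝓤 (𝓝 ((t - s) + 0)) :=
      hinv.const_add _
    rw [add_zero] at h1
    exact le_of_tendsto_of_tendsto' ((hY t).sub (hY s)).norm h1 fun k => hZ k s t hst
  have hYc : Continuous Y := by
    refine LipschitzWith.continuous (K := 1) (LipschitzWith.of_dist_le_mul fun a b => ?_)
    rw [NNReal.coe_one, one_mul, dist_eq_norm, Real.dist_eq]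
    rcases le_total a b with h | h
    · rw [norm_sub_rev, abs_sub_comm]; exact (hYL a b h).trans (le_abs_self _)
    · exact (hYL b a h).trans (le_abs_self _)
  have hY0 : Y 0 = y₀ := tendsto_nhds_unique (hY 0) (by simp [hZ0])
  have hder : ∀ s, 0 ≤ s → HasDerivWithinAt Y (F (Y s)) (Ioi s) s := by
    intro s hs
    rw [hasDerivWithinAt_iff_isLittleO, Asymptotics.isLittleO_iff]
    intro ε hε
    obtain ⟨δ, hδ, hball⟩ := Metric.continuousAt_iff.1 (hFc.continuousAt (x := Y s)) ε hε
    filter_upwards [inter_mem_nhdsWithin (Ioi s) (Metric.ball_mem_nhds s (half_pos hδ))] with t ht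
    have hst : s ≤ t := le_of_lt ht.1
    have htδ : t - s < δ / 2 := by
      have := ht.2; rw [Metric.mem_ball, Real.dist_eq] at this
      exact (le_abs_self _).trans_lt this
    choose j hj hj1 hj2 using fun k => hfl k s t hst
    have hjlim : Tendsto (fun k => (j k : ℝ) / ((k : ℝ) + 1)) 𝓤 (𝓝 (t - s)) := by
      refine tendsto_of_tendsto_of_tendsto_of_le_of_le
        (g := fun k : ℕ => (t - s) - 1 / ((k : ℝ) + 1))
        (h := fun k : ℕ => (t - s) + 1 / ((k : ℝ) + 1)) ?_ ?_ (fun k => hj2 k hs) hj1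
      · simpa using hinv.const_sub (t - s)
      · simpa using hinv.const_add (t - s)
    rw [Real.norm_eq_abs, abs_of_nonneg (by linarith : (0 : ℝ) ≤ t - s), mul_comm]
    refine le_of_tendsto_of_tendsto (((hY t).sub (hY s)).sub (hjlim.smul_const (F (Y s)))).norm
      (hjlim.mul_const ε) ?_
    have e1 : ∀ᶠ k in (𝓤 : Filter ℕ), ‖Z k s - Y s‖ < δ / 4 := by
      have := (hY s).eventually (Metric.ball_mem_nhds (Y s) (by positivity : 0 < δ / 4))
      filter_upwards [this] with k hk
      rwa [dist_eq_norm] at hk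
    have e2 : ∀ᶠ k : ℕ in (𝓤 : Filter ℕ), 1 / ((k : ℝ) + 1) < δ / 4 :=
      hinv.eventually_lt_const (by positivity)
    filter_upwards [e1, e2] with k h1 h2
    have := eulerScheme_sub_smul_le (F := F) y₀ k ⌊((k : ℝ) + 1) * s⌋₊ (j k) (F (Y s)) ε (by
      intro l hl
      have h3 := eulerScheme_dist_le hF y₀ k ⌊((k : ℝ) + 1) * s⌋₊ l
      have h4 : (l : ℝ) / ((k : ℝ) + 1) ≤ (j k : ℝ) / ((k : ℝ) + 1) := by
        gcongr
      have h5 := hj1 k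
      have h6 : dist (eulerScheme F y₀ k (⌊((k : ℝ) + 1) * s⌋₊ + l)) (Y s) < δ := by
        rw [dist_eq_norm]
        have := norm_sub_le_norm_sub_add_norm_sub
          (eulerScheme F y₀ k (⌊((k : ℝ) + 1) * s⌋₊ + l)) (Z k s) (Y s)
        have h7 : ‖eulerScheme F y₀ k (⌊((k : ℝ) + 1) * s⌋₊ + l) - Z k s‖ ≤
          (l : ℝ) / ((k : ℝ) + 1) := h3
        linarith
      have := hball h6
      rw [dist_eq_norm] at this
      exact this.le)
    rw [← hj k] at this
    exact this
  refine ⟨Y, hYc, fun t ht => ?_⟩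
  rw [intervalIntegral.integral_eq_sub_of_hasDeriv_right (f := Y) hYc.continuousOn
    (fun s hs => hder s ?_) ((hFc.comp hYc).intervalIntegrable _ _), hY0]
  · abel
  · rw [min_eq_left ht] at hs; exact hs.1.le

end Peano

/-! ### Lorentzian forms -/

section LorentzForm

variable {E : Type*} [NormedAddCommGroup E] [NormedSpace ℝ E]

/-- A symmetric bilinear form that is negative on `N` and positive definite on the
orthogonal complement of `N`. -/
structure IsLorentzForm (b : E →L[ℝ] E →L[ℝ] ℝ) (N : E) : Prop where
  symm : ∀ u v, b u v = b v u
  neg : b N N < 0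
  pos : ∀ u, b u N = 0 → u ≠ 0 → 0 < b u u

/-- The closed future cone of a Lorentzian form. -/
def futureCone (b : E →L[ℝ] E →L[ℝ] ℝ) (N : E) : Set E := {w | b w w ≤ 0 ∧ b w N ≤ 0}

namespace IsLorentzForm

variable {b : E →L[ℝ] E →L[ℝ] ℝ} {N : E}

theorem eq_zero (h : IsLorentzForm b N) {u : E} (hu : b u u ≤ 0) (huN : b u N = 0) : u = 0 := by
  by_contra hne
  exact absurd (h.pos u huN hne) (not_lt.2 hu)

theorem ne_zero (h : IsLorentzForm b N) {u : E} (hu : b u u ≤ 0) (hne : u ≠ 0) : b u N ≠ 0 :=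
  fun h0 => hne (h.eq_zero hu h0)

theorem apply_combination (h : IsLorentzForm b N) (u v : E) (r s : ℝ) :
    b (r • u - s • v) (r • u - s • v) = r ^ 2 * b u u - 2 * r * s * b u v + s ^ 2 * b v v := by
  simp only [map_sub, map_smul, sub_apply, smul_apply, smul_eq_mul, h.symm v u]
  ring

theorem combination_apply_eq_zero (u v : E) : b (b v N • u - b u N • v) N = 0 := by
  simp only [map_sub, map_smul, sub_apply, smul_apply, smul_eq_mul]
  ring

theorem nonpos_of_mem (h : IsLorentzForm b N) {u v : E} (hu : u ∈ futureCone b N)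
    (hv : v ∈ futureCone b N) : b u v ≤ 0 := by
  rcases hu.2.eq_or_lt with hu0 | hu0
  · rw [h.eq_zero hu.1 hu0]; simp
  rcases hv.2.eq_or_lt with hv0 | hv0
  · rw [h.eq_zero hv.1 hv0]; simp
  by_contra hpos
  push Not at hpos
  have h1 := h.apply_combination u v (b v N) (b u N)
  have h2 : b (b v N • u - b u N • v) (b v N • u - b u N • v) < 0 := by
    rw [h1]
    have := mul_pos (mul_pos_of_neg_of_neg hv0 hu0) hpos
    nlinarith [hu.1, hv.1, sq_nonneg (b v N), sq_nonneg (b u N),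
      mul_nonneg (sq_nonneg (b v N)) (neg_nonneg.2 hu.1),
      mul_nonneg (sq_nonneg (b u N)) (neg_nonneg.2 hv.1)]
  have h3 := h.eq_zero h2.le (combination_apply_eq_zero u v)
  rw [h3] at h2
  simp at h2

theorem parallel_of_mem (h : IsLorentzForm b N) {u v : E} (hu : u ∈ futureCone b N)
    (hv : v ∈ futureCone b N) (huv : b u v = 0) : b v N • u = b u N • v := by
  have h1 := h.apply_combination u v (b v N) (b u N)
  refine sub_eq_zero.1 (h.eq_zero ?_ (combination_apply_eq_zero u v))
  rw [h1, huv]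
  nlinarith [mul_nonneg (sq_nonneg (b v N)) (neg_nonneg.2 hu.1),
      mul_nonneg (sq_nonneg (b u N)) (neg_nonneg.2 hv.1)]

theorem add_mem (h : IsLorentzForm b N) {u v : E} (hu : u ∈ futureCone b N)
    (hv : v ∈ futureCone b N) : u + v ∈ futureCone b N := by
  have h1 := h.nonpos_of_mem hu hv
  have h2 := h.symm u v
  refine ⟨?_, ?_⟩
  · simp only [map_add, add_apply]
    linarith [hu.1, hv.1]
  · simp only [map_add, add_apply]
    linarith [hu.2, hv.2]

theorem smul_mem {u : E} (hu : u ∈ futureCone b N) {r : ℝ}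
    (hr : 0 ≤ r) : r • u ∈ futureCone b N := by
  refine ⟨?_, ?_⟩
  · simp only [map_smul, smul_apply, smul_eq_mul]
    exact mul_nonpos_of_nonneg_of_nonpos hr (mul_nonpos_of_nonneg_of_nonpos hr hu.1)
  · simp only [map_smul, smul_apply, smul_eq_mul]
    exact mul_nonpos_of_nonneg_of_nonpos hr hu.2

theorem convex_futureCone (h : IsLorentzForm b N) : Convex ℝ (futureCone b N) :=
  fun _ hu _ hv _ _ hr hs _ => h.add_mem (smul_mem hu hr) (smul_mem hv hs)

theorem isClosed_futureCone : IsClosed (futureCone b N) := by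
  have h1 : Continuous fun w => b w w := by fun_prop
  have h2 : Continuous fun w => b w N := by fun_prop
  exact (isClosed_le h1 continuous_const).inter (isClosed_le h2 continuous_const)

theorem riemannian_pos (h : IsLorentzForm b N) {u : E} (hu : u ≠ 0) :
    0 < (-b N N) * b u u + 2 * b u N ^ 2 := by
  have hN := h.neg
  set u' := b N N • u - b u N • N with hu'
  have h1 : b u' u' = b N N * (b N N * b u u - b u N ^ 2) := by
    rw [hu', h.apply_combination]; ring
  have h2 : b u' N = 0 := combination_apply_eq_zero u N
  rcases eq_or_ne u' 0 with h0 | h0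
  · rw [h0] at h1
    simp only [map_zero] at h1
    have h3 : b N N * b u u - b u N ^ 2 = 0 := by
      rcases mul_eq_zero.1 h1.symm with h | h
      · exact absurd h hN.ne
      · exact h
    have h4 : b u N ≠ 0 := by
      intro h5
      rw [h5, zero_smul, sub_zero] at hu'
      rw [h0] at hu'
      exact (smul_ne_zero hN.ne hu) hu'.symm
    have := pow_pos (abs_pos.2 h4) 2
    rw [sq_abs] at this
    nlinarith
  · have h3 := h.pos u' h2 h0
    rw [h1] at h3
    have h4 : b N N * b u u - b u N ^ 2 < 0 := by
      by_contra h5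
      push Not at h5
      nlinarith
    nlinarith [sq_nonneg (b u N)]

theorem isCompact_slice [ProperSpace E] (h : IsLorentzForm b N) :
    IsCompact {c : E | b c c ≤ 0 ∧ b c N = -1} := by
  have h1 : Continuous fun w => b w w := by fun_prop
  have h2 : Continuous fun w => b w N := by fun_prop
  refine Metric.isCompact_of_isClosed_isBounded
    ((isClosed_le h1 continuous_const).inter (isClosed_eq h2 continuous_const)) ?_
  have h3 : Continuous fun w => (-b N N) * b w w + 2 * b w N ^ 2 := by fun_prop
  rcases (Metric.sphere (0 : E) 1).eq_empty_or_nonempty with he | hne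
  · refine (Metric.isBounded_closedBall (x := (0 : E)) (r := 0)).subset fun c hc => ?_
    by_contra hc0
    have hc0 : c ≠ 0 := by simpa using hc0
    have : (‖c‖⁻¹ • c) ∈ Metric.sphere (0 : E) 1 := by
      rw [mem_sphere_zero_iff_norm, norm_smul, norm_inv, norm_norm,
        inv_mul_cancel₀ (norm_ne_zero_iff.2 hc0)]
    rw [he] at this
    exact this
  obtain ⟨w, hw, hmin⟩ := (isCompact_sphere (0 : E) 1).exists_isMinOn hne h3.continuousOn
  set κ := (-b N N) * b w w + 2 * b w N ^ 2 with hκ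
  have hκpos : 0 < κ := h.riemannian_pos (by
    intro h0
    rw [h0, mem_sphere_zero_iff_norm, norm_zero] at hw
    exact zero_ne_one hw)
  refine (Metric.isBounded_closedBall (x := (0 : E)) (r := 2 / κ + 1)).subset fun c hc => ?_
  rw [mem_closedBall_zero_iff]
  rcases eq_or_ne c 0 with hc0 | hc0
  · rw [hc0, norm_zero]; positivity
  have hpos : 0 < ‖c‖ := norm_pos_iff.2 hc0
  have h4 : κ ≤ (-b N N) * b (‖c‖⁻¹ • c) (‖c‖⁻¹ • c) + 2 * b (‖c‖⁻¹ • c) N ^ 2 := by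
    refine hmin ?_
    rw [mem_sphere_zero_iff_norm, norm_smul, norm_inv, norm_norm, inv_mul_cancel₀ hpos.ne']
  simp only [map_smul, smul_apply, smul_eq_mul, hc.2] at h4
  have h5 : ‖c‖ ^ 2 * κ ≤ (-b N N) * b c c + 2 := by
    calc ‖c‖ ^ 2 * κ ≤ ‖c‖ ^ 2 * ((-b N N) * (‖c‖⁻¹ * (‖c‖⁻¹ * b c c)) +
          2 * (‖c‖⁻¹ * -1) ^ 2) := by gcongr
      _ = _ := by field_simp
  have h6 : ‖c‖ ^ 2 * κ ≤ 2 := by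
    have := mul_nonpos_of_nonneg_of_nonpos (neg_nonneg.2 h.neg.le) hc.1
    linarith
  have h7 : ‖c‖ ^ 2 ≤ 2 / κ := by rw [le_div_iff₀ hκpos]; exact h6
  nlinarith [sq_nonneg (‖c‖ - 1), norm_nonneg c]

end IsLorentzForm

end LorentzForm

/-! ### The metric and its Christoffel symbols as continuous multilinear objects -/

namespace C1Spacetime

set_option maxSynthPendingDepth 5

variable {n : ℕ} (M : C1Spacetime n)

/-- The metric at a point as a continuous bilinear form. -/
def metric (p : SpacetimePt n) : SpacetimePt n →L[ℝ] SpacetimePt n →L[ℝ] ℝ :=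
  ∑ i, ∑ j, M.g p i j •
    (ContinuousLinearMap.proj (R := ℝ) (φ := fun _ : Fin n => ℝ) i).smulRight
      (ContinuousLinearMap.proj (R := ℝ) (φ := fun _ : Fin n => ℝ) j)

theorem metric_apply (p u v : SpacetimePt n) : M.metric p u v = bilForm (M.g p) u v := by
  simp only [metric, bilForm, sum_apply, smul_apply, ContinuousLinearMap.smulRight_apply,
    ContinuousLinearMap.proj_apply, smul_eq_mul, mul_assoc]

theorem contDiff_g (i j : Fin n) : ContDiff ℝ 1 fun p => M.g p i j :=
  contDiff_pi.1 (contDiff_pi.1 M.g_contDiff i) j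

theorem contDiff_metric : ContDiff ℝ 1 M.metric := by
  unfold metric
  refine ContDiff.sum fun i _ => ContDiff.sum fun j _ => ?_
  exact (M.contDiff_g i j).smul contDiff_const

theorem metric_symm (p u v : SpacetimePt n) : M.metric p u v = M.metric p v u := by
  rw [metric_apply, metric_apply, bilForm, bilForm, Finset.sum_comm]
  refine Finset.sum_congr rfl fun i _ => Finset.sum_congr rfl fun j _ => ?_
  rw [M.g_symm p j i]; ring

theorem bilForm_minkowski {m : ℕ} (x y : Fin (m + 1) → ℝ) :
    bilForm (minkowskiMatrix (m + 1)) x y = -(x 0 * y 0) + ∑ i : Fin m, x i.succ * y i.succ := by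
  have h : bilForm (minkowskiMatrix (m + 1)) x y =
      ∑ i : Fin (m + 1), (if (i : ℕ) = 0 then -1 else 1) * (x i * y i) := by
    unfold bilForm minkowskiMatrix
    refine Finset.sum_congr rfl fun i _ => ?_
    simp
  rw [h, Fin.sum_univ_succ]
  simp

theorem isLorentzForm_metric (p : SpacetimePt n) : IsLorentzForm (M.metric p) (M.X0 p) := by
  refine ⟨M.metric_symm p, by rw [metric_apply]; exact M.X0_timelike p, fun u hu hne => ?_⟩
  obtain ⟨L, hL⟩ := M.g_lorentz p
  obtain ⟨a, ha⟩ := L.surjective (M.X0 p)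
  obtain ⟨c, rfl⟩ := L.surjective u
  have key : ∀ x y : Fin n → ℝ, M.metric p (L x) (L y) = bilForm (minkowskiMatrix n) x y := by
    intro x y
    have hexp : ∀ z : Fin n → ℝ, L z = ∑ i, z i • L (Pi.single i 1) := by
      intro z
      conv_lhs => rw [pi_eq_sum_univ' z]
      simp only [map_sum, map_smul]
    rw [hexp x, hexp y]
    simp only [map_sum, map_smul, sum_apply, smul_apply, smul_eq_mul]
    simp only [M.metric_apply, hL]
    simp only [bilForm]
    rw [Finset.sum_comm]
    refine Finset.sum_congr rfl fun i _ => ?_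
    rw [Finset.mul_sum]
    exact Finset.sum_congr rfl fun j _ => by ring
  have hN := M.X0_timelike p
  rw [← metric_apply] at hN
  rw [← ha, key] at hu hN
  rw [key]
  have hc : c ≠ 0 := fun h => hne (by rw [h, map_zero])
  cases n with
  | zero => exact absurd (Subsingleton.elim c 0) hc
  | succ m =>
    rw [bilForm_minkowski] at hu hN ⊢
    have cs := Finset.sum_mul_sq_le_sq_mul_sq Finset.univ (fun i : Fin m => c i.succ)
      (fun i : Fin m => a i.succ)
    simp only [← sq] at hN ⊢
    set A := ∑ i : Fin m, a i.succ ^ 2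
    set C := ∑ i : Fin m, c i.succ ^ 2 with hC
    have hS : ∑ i : Fin m, c i.succ * a i.succ = c 0 * a 0 := by linarith
    rw [hS] at cs
    have hA : 0 ≤ A := Finset.sum_nonneg fun _ _ => sq_nonneg _
    by_contra hle
    push Not at hle
    have h1 : c 0 ^ 2 * a 0 ^ 2 ≤ c 0 ^ 2 * A := by
      calc c 0 ^ 2 * a 0 ^ 2 = (c 0 * a 0) ^ 2 := by ring
        _ ≤ C * A := cs
        _ ≤ c 0 ^ 2 * A := by gcongr; linarith
    have h2 : c 0 = 0 := by
      by_contra h3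
      have : 0 < c 0 ^ 2 := by positivity
      nlinarith
    rw [h2] at hle
    have h4 : C = 0 := le_antisymm (by linarith) (Finset.sum_nonneg fun _ _ => sq_nonneg _)
    rw [hC, Finset.sum_eq_zero_iff_of_nonneg fun _ _ => sq_nonneg _] at h4
    refine hc (funext fun i => ?_)
    refine Fin.cases h2 (fun j => ?_) i
    simpa using h4 j (Finset.mem_univ _)

theorem metric_nondegenerate {p u : SpacetimePt n} (h : ∀ v, M.metric p u v = 0) : u = 0 :=
  (M.isLorentzForm_metric p).eq_zero (h u).le (h _)

theorem det_g_ne_zero (p : SpacetimePt n) : (Matrix.of (M.g p)).det ≠ 0 := by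
  intro h
  obtain ⟨v, hv, h0⟩ := Matrix.exists_mulVec_eq_zero_iff.2 h
  refine hv (M.metric_nondegenerate (p := p) fun u => ?_)
  rw [M.metric_symm, metric_apply, bilForm]
  refine Finset.sum_eq_zero fun i _ => ?_
  have := congrFun h0 i
  simp only [Matrix.mulVec, dotProduct, Matrix.of_apply, Pi.zero_apply] at this
  calc ∑ j, M.g p i j * u i * v j = u i * ∑ j, M.g p i j * v j := by
        rw [Finset.mul_sum]; exact Finset.sum_congr rfl fun j _ => by ring
    _ = 0 := by rw [this, mul_zero]

theorem continuous_ginv (k l : Fin n) : Continuous fun p => M.ginv p k l := by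
  have hc : Continuous fun p => (Matrix.of (M.g p) : Matrix (Fin n) (Fin n) ℝ) :=
    M.g_contDiff.continuous
  have h : ∀ p, M.ginv p k l =
      ((Matrix.of (M.g p)).det)⁻¹ * (Matrix.of (M.g p)).adjugate k l := by
    intro p
    rw [ginv, Matrix.inv_def, Matrix.smul_apply, smul_eq_mul, Ring.inverse_eq_inv']
  simp only [h]
  refine (hc.matrix_det.inv₀ M.det_g_ne_zero).mul ?_
  exact (hc.matrix_adjugate).matrix_elem k l

theorem continuous_christoffel (k i j : Fin n) : Continuous (M.christoffel k i j) := by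
  have h : ∀ i j l : Fin n, Continuous fun p =>
      fderiv ℝ (fun q => M.g q i j) p (Pi.single l 1) := fun i j l =>
    ((M.contDiff_g i j).continuous_fderiv one_ne_zero).clm_apply continuous_const
  unfold christoffel
  refine continuous_const.mul (continuous_finsetSum _ fun l _ => ?_)
  exact (M.continuous_ginv k l).mul (((h j l i).add (h i l j)).sub (h i j l))

/-- The Christoffel symbols at a point as a continuous bilinear map. -/
def chris (p : SpacetimePt n) : SpacetimePt n →L[ℝ] SpacetimePt n →L[ℝ] SpacetimePt n :=
  ∑ k, ∑ i, ∑ j, M.christoffel k i j p •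
    (ContinuousLinearMap.proj (R := ℝ) (φ := fun _ : Fin n => ℝ) i).smulRight
      ((ContinuousLinearMap.proj (R := ℝ) (φ := fun _ : Fin n => ℝ) j).smulRight
        (Pi.single k (1 : ℝ) : SpacetimePt n))

theorem continuous_chris : Continuous M.chris := by
  unfold chris
  refine continuous_finsetSum _ fun k _ => continuous_finsetSum _ fun i _ =>
    continuous_finsetSum _ fun j _ => ?_
  exact (M.continuous_christoffel k i j).smul continuous_const

theorem chris_apply (p u v : SpacetimePt n) (k : Fin n) :
    M.chris p u v k = ∑ i, ∑ j, M.christoffel k i j p * u i * v j := by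
  simp only [chris, sum_apply, smul_apply, ContinuousLinearMap.smulRight_apply,
    ContinuousLinearMap.proj_apply, Finset.sum_apply, Pi.smul_apply, smul_eq_mul]
  rw [Finset.sum_eq_single k]
  · simp [mul_assoc]
  · intro l _ hl
    simp [Pi.single_eq_of_ne (Ne.symm hl)]
  · simp

theorem sum_g_mul_christoffel (p : SpacetimePt n) (m i j : Fin n) :
    ∑ k, M.g p m k * M.christoffel k i j p = (1 / 2) *
      (fderiv ℝ (fun q => M.g q j m) p (Pi.single i 1)
      + fderiv ℝ (fun q => M.g q i m) p (Pi.single j 1)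
      - fderiv ℝ (fun q => M.g q i j) p (Pi.single m 1)) := by
  set D : Fin n → ℝ := fun l => fderiv ℝ (fun q => M.g q j l) p (Pi.single i 1)
      + fderiv ℝ (fun q => M.g q i l) p (Pi.single j 1)
      - fderiv ℝ (fun q => M.g q i j) p (Pi.single l 1) with hD
  have h1 : ∀ k, M.christoffel k i j p = (1 / 2) * (M.ginv p).mulVec D k := fun k => rfl
  have h2 : (Matrix.of (M.g p)).mulVec ((M.ginv p).mulVec D) = D := by
    rw [Matrix.mulVec_mulVec, ginv, Matrix.mul_nonsing_inv _
      (isUnit_iff_ne_zero.2 (M.det_g_ne_zero p)), Matrix.one_mulVec]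
  have h3 := congrFun h2 m
  simp only [h1]
  calc ∑ k, M.g p m k * (1 / 2 * (M.ginv p).mulVec D k)
      = (1 / 2) * ∑ k, M.g p m k * (M.ginv p).mulVec D k := by
        rw [Finset.mul_sum]; exact Finset.sum_congr rfl fun k _ => by ring
    _ = (1 / 2) * D m := by rw [← h3]; rfl

theorem fderiv_metric_apply (p w u v : SpacetimePt n) :
    fderiv ℝ M.metric p w u v =
      ∑ i, ∑ j, ∑ k, fderiv ℝ (fun q => M.g q i j) p (Pi.single k 1) * w k * u i * v j := by
  have hd : DifferentiableAt ℝ M.metric p := M.contDiff_metric.differentiable one_ne_zero p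
  have h1 : HasFDerivAt (fun q => M.metric q u v)
      (((fderiv ℝ M.metric p).flip u).flip v) p := by
    have := (hd.hasFDerivAt.clm_apply (hasFDerivAt_const u p)).clm_apply (hasFDerivAt_const v p)
    refine this.congr_fderiv ?_
    ext; simp
  have h2 : HasFDerivAt (fun q => M.metric q u v)
      (∑ i, ∑ j, (u i * v j) • fderiv ℝ (fun q => M.g q i j) p) p := by
    have : (fun q => M.metric q u v) = fun q => ∑ i, ∑ j, (u i * v j) * M.g q i j := by
      funext q
      rw [metric_apply, bilForm]
      exact Finset.sum_congr rfl fun i _ => Finset.sum_congr rfl fun j _ => by ring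
    rw [this]
    refine HasFDerivAt.fun_sum fun i _ => HasFDerivAt.fun_sum fun j _ => ?_
    exact ((M.contDiff_g i j).differentiable one_ne_zero p).hasFDerivAt.const_mul _
  have h3 := congrArg (fun f : SpacetimePt n →L[ℝ] ℝ => f w) (h1.unique h2)
  simp only [ContinuousLinearMap.flip_apply, sum_apply, smul_apply, smul_eq_mul] at h3
  rw [h3]
  refine Finset.sum_congr rfl fun i _ => Finset.sum_congr rfl fun j _ => ?_
  conv_lhs => rw [pi_eq_sum_univ' w]
  simp only [map_sum, map_smul, smul_eq_mul, Finset.mul_sum]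
  exact Finset.sum_congr rfl fun k _ => by ring

theorem metric_chris (p w u v : SpacetimePt n) :
    M.metric p v (M.chris p w u) = (1 / 2) * (fderiv ℝ M.metric p w u v +
      fderiv ℝ M.metric p u w v - fderiv ℝ M.metric p v w u) := by
  have e0 : M.metric p v (M.chris p w u) =
      ∑ m, ∑ i, ∑ j, (∑ k, M.g p m k * M.christoffel k i j p) * (w i * u j * v m) := by
    rw [metric_apply, bilForm]
    refine Finset.sum_congr rfl fun m _ => ?_
    simp only [chris_apply, Finset.mul_sum, Finset.sum_mul]
    rw [Finset.sum_comm]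
    refine Finset.sum_congr rfl fun i _ => ?_
    rw [Finset.sum_comm]
    refine Finset.sum_congr rfl fun j _ => Finset.sum_congr rfl fun k _ => ?_
    ring
  have e1 : fderiv ℝ M.metric p w u v = ∑ m, ∑ i, ∑ j,
      fderiv ℝ (fun q => M.g q j m) p (Pi.single i 1) * (w i * u j * v m) := by
    rw [fderiv_metric_apply, Finset.sum_comm]
    refine Finset.sum_congr rfl fun m _ => ?_
    rw [Finset.sum_comm]
    exact Finset.sum_congr rfl fun i _ => Finset.sum_congr rfl fun j _ => by ring
  have e2 : fderiv ℝ M.metric p u w v = ∑ m, ∑ i, ∑ j,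
      fderiv ℝ (fun q => M.g q i m) p (Pi.single j 1) * (w i * u j * v m) := by
    rw [fderiv_metric_apply, Finset.sum_comm]
    exact Finset.sum_congr rfl fun m _ => Finset.sum_congr rfl fun i _ =>
      Finset.sum_congr rfl fun j _ => by ring
  have e3 : fderiv ℝ M.metric p v w u = ∑ m, ∑ i, ∑ j,
      fderiv ℝ (fun q => M.g q i j) p (Pi.single m 1) * (w i * u j * v m) := by
    rw [fderiv_metric_apply]
    have : ∀ i, (∑ j, ∑ k, fderiv ℝ (fun q => M.g q i j) p (Pi.single k 1) * v k * w i * u j) =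
        ∑ k, ∑ j, fderiv ℝ (fun q => M.g q i j) p (Pi.single k 1) * v k * w i * u j :=
      fun i => Finset.sum_comm
    simp only [this]
    rw [Finset.sum_comm]
    exact Finset.sum_congr rfl fun m _ => Finset.sum_congr rfl fun i _ =>
      Finset.sum_congr rfl fun j _ => by ring
  rw [e0, e1, e2, e3, ← Finset.sum_add_distrib, ← Finset.sum_sub_distrib, Finset.mul_sum]
  refine Finset.sum_congr rfl fun m _ => ?_
  rw [← Finset.sum_add_distrib, ← Finset.sum_sub_distrib, Finset.mul_sum]
  refine Finset.sum_congr rfl fun i _ => ?_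
  rw [← Finset.sum_add_distrib, ← Finset.sum_sub_distrib, Finset.mul_sum]
  refine Finset.sum_congr rfl fun j _ => ?_
  rw [sum_g_mul_christoffel]
  ring

theorem fderiv_metric_symm (p w u v : SpacetimePt n) :
    fderiv ℝ M.metric p w u v = fderiv ℝ M.metric p w v u := by
  rw [fderiv_metric_apply, fderiv_metric_apply, Finset.sum_comm]
  refine Finset.sum_congr rfl fun i _ => Finset.sum_congr rfl fun j _ =>
    Finset.sum_congr rfl fun k _ => ?_
  have : (fun q => M.g q j i) = fun q => M.g q i j := funext fun q => M.g_symm q j i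
  rw [this]; ring

theorem fderiv_metric_eq (p w u v : SpacetimePt n) :
    fderiv ℝ M.metric p w u v =
      M.metric p (M.chris p w u) v + M.metric p u (M.chris p w v) := by
  rw [M.metric_symm p (M.chris p w u) v, metric_chris, metric_chris,
    M.fderiv_metric_symm p w v u, M.fderiv_metric_symm p u w v]
  ring

theorem chris_symm (p u v : SpacetimePt n) : M.chris p u v = M.chris p v u := by
  refine sub_eq_zero.1 (M.metric_nondegenerate (p := p) fun w => ?_)
  rw [M.metric_symm, map_sub, metric_chris, metric_chris, M.fderiv_metric_symm p w v u]
  ring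

end C1Spacetime

/-! ### Parallel transport along Lipschitz curves -/

theorem IsLorentzForm.integral_mem {E : Type*} [NormedAddCommGroup E] [NormedSpace ℝ E]
    [CompleteSpace E] {b : E →L[ℝ] E →L[ℝ] ℝ} {N : E} (h : IsLorentzForm b N) {c : ℝ → E}
    {r s : ℝ} (hrs : r ≤ s) (hc : IntervalIntegrable c volume r s)
    (hmem : ∀ᵐ t, t ∈ Ioc r s → c t ∈ futureCone b N) :
    ∫ t in r..s, c t ∈ futureCone b N := by
  rcases hrs.eq_or_lt with rfl | hlt
  · rw [intervalIntegral.integral_same]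
    simp [futureCone]
  rw [intervalIntegral.integral_of_le hrs]
  have h1 : volume (Ioc r s) = ENNReal.ofReal (s - r) := Real.volume_Ioc
  have h2 := h.convex_futureCone.set_average_mem IsLorentzForm.isClosed_futureCone
    (by rw [h1]; simpa using hlt) (by rw [h1]; exact ENNReal.ofReal_ne_top)
    ((ae_restrict_iff' measurableSet_Ioc).2 hmem)
    ((intervalIntegrable_iff_integrableOn_Ioc_of_le hrs).1 hc)
  have h3 := IsLorentzForm.smul_mem h2 (sub_pos.2 hlt).le
  rw [setAverage_eq, smul_smul, measureReal_def, h1, ENNReal.toReal_ofReal (sub_pos.2 hlt).le,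
    mul_inv_cancel₀ (sub_pos.2 hlt).ne', one_smul] at h3
  exact h3

/-- The curve starting at `x₀` with velocity `U`. -/
def curveOf {E : Type*} [NormedAddCommGroup E] [NormedSpace ℝ E] (x₀ : E) (U : ℝ → E) (t : ℝ) :
    E := x₀ + ∫ s in (0 : ℝ)..t, U s

section CurveOf

variable {E : Type*} [NormedAddCommGroup E] [NormedSpace ℝ E] {x₀ : E} {U : ℝ → E}

theorem curveOf_zero : curveOf x₀ U 0 = x₀ := by simp [curveOf]

theorem LocBdd.locallyLipschitz_curveOf (hU : LocBdd U) : LocallyLipschitz (curveOf x₀ U) :=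
  hU.locallyLipschitz_primitive x₀

theorem LocBdd.continuous_curveOf (hU : LocBdd U) : Continuous (curveOf x₀ U) :=
  (hU.locallyLipschitz_primitive x₀).continuous

theorem LocBdd.ae_hasDerivAt_curveOf [CompleteSpace E] (hU : LocBdd U) :
    ∀ᵐ t, HasDerivAt (curveOf x₀ U) (U t) t := hU.ae_hasDerivAt x₀

end CurveOf

/-- A continuously differentiable Lorentzian metric on a normed space, together with a continuous
timelike vector field and a symmetric connection that is compatible with the metric. -/
structure LorentzData (E : Type*) [NormedAddCommGroup E] [NormedSpace ℝ E] where
  metric : E → E →L[ℝ] E →L[ℝ] ℝ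
  contDiff_metric : ContDiff ℝ 1 metric
  chris : E → E →L[ℝ] E →L[ℝ] E
  continuous_chris : Continuous chris
  chris_symm : ∀ p u v, chris p u v = chris p v u
  fderiv_metric_eq : ∀ p w u v,
    fderiv ℝ metric p w u v = metric p (chris p w u) v + metric p u (chris p w v)
  X0 : E → E
  X0_cont : Continuous X0
  isLorentzForm_metric : ∀ p, IsLorentzForm (metric p) (X0 p)

theorem LocBdd.locallyLipschitz_primitive_apply {E F : Type*} [NormedAddCommGroup E]
    [NormedSpace ℝ E] [NormedAddCommGroup F] [NormedSpace ℝ F] {A : ℝ → E →L[ℝ] F}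
    (hA : LocBdd A) (P₀ : E →L[ℝ] F) {a : ℝ → E} (ha : LocallyLipschitz a) :
    LocallyLipschitz fun t => (P₀ + ∫ s in (0 : ℝ)..t, A s) (a t) := by
  have h1 := hA.locallyLipschitz_primitive P₀
  have h2 : ContDiff ℝ 1 fun z : (E →L[ℝ] F) × E => z.1 z.2 := by fun_prop
  exact h2.locallyLipschitz.comp (h1.prodMk ha)

theorem ContDiff.locallyLipschitz_comp_prodMk {E F G : Type*} [NormedAddCommGroup E]
    [NormedSpace ℝ E] [NormedAddCommGroup F] [NormedSpace ℝ F] [NormedAddCommGroup G]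
    [NormedSpace ℝ G] {Φ : E × F → G} (hΦ : ContDiff ℝ 1 Φ) {f : ℝ → E} {g : ℝ → F}
    (hf : LocallyLipschitz f) (hg : LocallyLipschitz g) :
    LocallyLipschitz fun t => Φ (f t, g t) :=
  hΦ.locallyLipschitz.comp (hf.prodMk hg)

namespace LorentzData

variable {E : Type*} [NormedAddCommGroup E] [NormedSpace ℝ E] (M : LorentzData E)

theorem continuous_metric : Continuous M.metric := M.contDiff_metric.continuous

theorem metric_nondegenerate {p u : E} (h : ∀ v, M.metric p u v = 0) : u = 0 :=
  (M.isLorentzForm_metric p).eq_zero (h u).le (h _)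

/-- `P` is the parallel transport along the curve starting at `x₀` with velocity `U`, and `Q` is
its inverse. -/
structure IsTransport (x₀ : E) (U : ℝ → E)
    (P Q : ℝ → E →L[ℝ] E) : Prop where
  locBdd : LocBdd U
  locBdd_coeff : LocBdd fun t => (-M.chris (curveOf x₀ U t) (U t)) * P t
  eq_add_integral : ∀ t, P t = 1 + ∫ s in (0 : ℝ)..t, (-M.chris (curveOf x₀ U s) (U s)) * P s
  continuous : Continuous P
  continuous_inv : Continuous Q
  apply_inv : ∀ t v, P t (Q t v) = v
  inv_apply : ∀ t v, Q t (P t v) = v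
  metric_eq : ∀ t u v, M.metric (curveOf x₀ U t) (P t u) (P t v) = M.metric x₀ u v

theorem locallyLipschitz_metric_apply {γ u v : ℝ → E} (hγ : LocallyLipschitz γ)
    (hu : LocallyLipschitz u) (hv : LocallyLipschitz v) :
    LocallyLipschitz fun t => M.metric (γ t) (u t) (v t) := by
  have hΦ : ContDiff ℝ 1 fun z : E × E × E => M.metric z.1 z.2.1 z.2.2 := by
    have h1 : ContDiff ℝ 1 fun z : E × E × E => M.metric z.1 :=
      M.contDiff_metric.comp contDiff_fst
    have h2 : ContDiff ℝ 1 fun z : E × E × E => z.2.1 := contDiff_fst.comp contDiff_snd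
    have h3 : ContDiff ℝ 1 fun z : E × E × E => z.2.2 := contDiff_snd.comp contDiff_snd
    exact (h1.clm_apply h2).clm_apply h3
  exact hΦ.locallyLipschitz_comp_prodMk hγ (hu.prodMk hv)

theorem exists_isTransport [FiniteDimensional ℝ E] (x₀ : E) {U : ℝ → E} (hU : LocBdd U)
    (hU0 : ∀ t < 0, U t = 0) : ∃ P Q, M.IsTransport x₀ U P Q := by
  have : CompleteSpace E := FiniteDimensional.complete ℝ E
  set γ := curveOf x₀ U with hγ
  have hγc : Continuous γ := hU.continuous_curveOf
  have hA : LocBdd fun t => -M.chris (γ t) (U t) := by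
    have hc : Continuous fun t => -M.chris (γ t) := (M.continuous_chris.comp hγc).neg
    exact LocBdd.clm_apply hc hU
  obtain ⟨P, hPc, hP⟩ := exists_fundamental_solution hA fun t ht => by
    rw [hU0 t ht, map_zero, neg_zero]
  have hAP : LocBdd fun t => (-M.chris (γ t) (U t)) * P t := by
    have hc : Continuous fun t =>
        (ContinuousLinearMap.mul ℝ (E →L[ℝ] E)).flip (P t) := by
      fun_prop
    exact LocBdd.clm_apply hc hA
  have hPL : ∀ u, LocallyLipschitz fun t => P t u := by
    intro u
    have := hAP.locallyLipschitz_primitive_apply 1 (LocallyLipschitz.const u)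
    simpa only [← hP] using this
  have hPd : ∀ᵐ t, HasDerivAt P ((-M.chris (γ t) (U t)) * P t) t := by
    have := hAP.ae_hasDerivAt 1
    rwa [← funext hP] at this
  have hP0 : P 0 = 1 := by rw [hP 0, intervalIntegral.integral_same, add_zero]
  have hiso : ∀ t u v, M.metric (γ t) (P t u) (P t v) = M.metric x₀ u v := by
    intro t u v
    have hL : LocallyLipschitz fun t => M.metric (γ t) (P t u) (P t v) :=
      M.locallyLipschitz_metric_apply hU.locallyLipschitz_curveOf (hPL u) (hPL v)
    have hd : ∀ᵐ t, HasDerivAt (fun t => M.metric (γ t) (P t u) (P t v)) 0 t := by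
      filter_upwards [hPd, hU.ae_hasDerivAt_curveOf (x₀ := x₀)] with t h1 h2
      have h3 : HasDerivAt (fun t => M.metric (γ t)) (fderiv ℝ M.metric (γ t) (U t)) t :=
        (M.contDiff_metric.differentiable one_ne_zero (γ t)).hasFDerivAt.comp_hasDerivAt t h2
      have h4 : ∀ w, HasDerivAt (fun t => P t w) (((-M.chris (γ t) (U t)) * P t) w) t := by
        intro w
        simpa using h1.clm_apply (hasDerivAt_const t w)
      refine ((h3.clm_apply (h4 u)).clm_apply (h4 v)).congr_deriv ?_
      rw [add_apply, M.fderiv_metric_eq]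
      simp
    have h0 : M.metric (γ 0) (P 0 u) (P 0 v) = M.metric x₀ u v := by
      rw [hP0, hγ, curveOf_zero]; rfl
    rw [← h0]
    rcases le_total 0 t with ht | ht
    · exact (hL.eq_of_ae_hasDerivAt_zero ht (by
        filter_upwards [hd] with t h _ using h)).symm
    · exact hL.eq_of_ae_hasDerivAt_zero ht (by filter_upwards [hd] with t h _ using h)
  have hunit : ∀ t, IsUnit (P t) := by
    intro t
    have hinj : Function.Injective (P t : E →ₗ[ℝ] E) := by
      rw [← LinearMap.ker_eq_bot, LinearMap.ker_eq_bot']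
      intro u hu
      refine M.metric_nondegenerate (p := x₀) fun v => ?_
      rw [← hiso t u v]
      have : P t u = 0 := hu
      rw [this]; simp
    let e := (LinearEquiv.ofInjectiveEndo _ hinj).toContinuousLinearEquiv
    refine ⟨⟨P t, (e.symm : E →L[ℝ] E), ?_, ?_⟩, rfl⟩
    · ext1 v; exact e.apply_symm_apply v
    · ext1 v; exact e.symm_apply_apply v
  refine ⟨P, fun t => Ring.inverse (P t), hU, hAP, hP, hPc, ?_, ?_, ?_, hiso⟩
  · rw [continuous_iff_continuousAt]
    intro t
    obtain ⟨u, hu⟩ := hunit t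
    have h1 := NormedRing.inverse_continuousAt u
    rw [hu] at h1
    exact ContinuousAt.comp (f := P) h1 hPc.continuousAt
  · intro t v
    have := congrArg (fun f : E →L[ℝ] E => f v)
      (Ring.mul_inverse_cancel _ (hunit t))
    exact this
  · intro t v
    have := congrArg (fun f : E →L[ℝ] E => f v)
      (Ring.inverse_mul_cancel _ (hunit t))
    exact this

namespace IsTransport

variable {M} {x₀ : E} {U : ℝ → E}
  {P Q : ℝ → E →L[ℝ] E}

theorem apply_zero (h : M.IsTransport x₀ U P Q) : P 0 = 1 := by
  rw [h.eq_add_integral 0, intervalIntegral.integral_same, add_zero]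

theorem continuous_curve (h : M.IsTransport x₀ U P Q) : Continuous (curveOf x₀ U) :=
  h.locBdd.continuous_curveOf

theorem locallyLipschitz_apply (h : M.IsTransport x₀ U P Q) {a : ℝ → E}
    (ha : LocallyLipschitz a) : LocallyLipschitz fun t => P t (a t) := by
  have := h.locBdd_coeff.locallyLipschitz_primitive_apply 1 ha
  simpa only [← h.eq_add_integral] using this

theorem ae_hasDerivAt [CompleteSpace E] (h : M.IsTransport x₀ U P Q) :
    ∀ᵐ t, HasDerivAt P ((-M.chris (curveOf x₀ U t) (U t)) * P t) t := by
  have := h.locBdd_coeff.ae_hasDerivAt 1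
  rwa [← funext h.eq_add_integral] at this

theorem apply_ne_zero (h : M.IsTransport x₀ U P Q) {c : E} (hc : c ≠ 0) (t : ℝ) :
    P t c ≠ 0 := by
  intro h0
  have := h.inv_apply t c
  rw [h0, map_zero] at this
  exact hc this.symm

theorem future_of_future (h : M.IsTransport x₀ U P Q) {c : E}
    (hc : M.metric x₀ c c ≤ 0) (hcN : M.metric x₀ c (M.X0 x₀) < 0) (t : ℝ) :
    M.metric (curveOf x₀ U t) (P t c) (M.X0 (curveOf x₀ U t)) < 0 := by
  have hne : c ≠ 0 := by rintro rfl; simp at hcN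
  have hcont : Continuous fun t =>
      M.metric (curveOf x₀ U t) (P t c) (M.X0 (curveOf x₀ U t)) := by
    have h1 := M.continuous_metric.comp h.continuous_curve
    have h2 := M.X0_cont.comp h.continuous_curve
    exact (h1.clm_apply (h.continuous.clm_apply continuous_const)).clm_apply h2
  have hnz : ∀ t, M.metric (curveOf x₀ U t) (P t c) (M.X0 (curveOf x₀ U t)) ≠ 0 := fun t =>
    (M.isLorentzForm_metric _).ne_zero (by rw [h.metric_eq]; exact hc) (h.apply_ne_zero hne t)
  by_contra hge
  push Not at hge
  have h0 : M.metric (curveOf x₀ U 0) (P 0 c) (M.X0 (curveOf x₀ U 0)) < 0 := by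
    rw [h.apply_zero, curveOf_zero]; exact hcN
  obtain ⟨s, hs⟩ := mem_range_of_exists_le_of_exists_ge hcont ⟨0, h0.le⟩ ⟨t, hge⟩
  exact hnz s hs

theorem future_iff (h : M.IsTransport x₀ U P Q) {c : E}
    (hc : M.metric x₀ c c ≤ 0) (t : ℝ) :
    M.metric (curveOf x₀ U t) (P t c) (M.X0 (curveOf x₀ U t)) < 0 ↔
      M.metric x₀ c (M.X0 x₀) < 0 := by
  refine ⟨fun h1 => ?_, fun h1 => h.future_of_future hc h1 t⟩
  by_contra hge
  push Not at hge
  rcases hge.eq_or_lt with h0 | h0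
  · rw [(M.isLorentzForm_metric x₀).eq_zero hc h0.symm] at h1
    simp at h1
  · have h2 := h.future_of_future (c := -c) (by simpa using hc) (by simpa using h0) t
    simp only [map_neg, neg_apply] at h2
    linarith

end IsTransport

end LorentzData

/-! ### Deforming causal curves into timelike curves -/

theorem IsCompact.eventually_forall_neg {A B : Type*} [TopologicalSpace A] [TopologicalSpace B]
    {K : Set B} (hK : IsCompact K) {f : A → B → ℝ} (hf : Continuous fun z : A × B => f z.1 z.2)
    {a : A} (h : ∀ z ∈ K, f a z < 0) : ∀ᶠ a' in 𝓝 a, ∀ z ∈ K, f a' z < 0 := by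
  refine hK.eventually_forall_of_forall_eventually fun z hz => ?_
  exact hf.continuousAt.eventually_lt continuousAt_const (h z hz)

namespace LorentzData

variable {E : Type*} [NormedAddCommGroup E] [NormedSpace ℝ E] (M : LorentzData E)

/-- A future-directed causal vector. -/
def IsFutureCausal (p u : E) : Prop := M.metric p u u ≤ 0 ∧ M.metric p u (M.X0 p) < 0

/-- A future-directed timelike vector. -/
def IsFutureTimelike (p u : E) : Prop := M.metric p u u < 0 ∧ M.metric p u (M.X0 p) < 0

theorem IsFutureCausal.smul {M : LorentzData E} {p u : E} (h : M.IsFutureCausal p u) {r : ℝ}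
    (hr : 0 < r) : M.IsFutureCausal p (r • u) := by
  obtain ⟨h1, h2⟩ := h
  simp only [IsFutureCausal, map_smul, smul_apply, smul_eq_mul]
  exact ⟨mul_nonpos_of_nonneg_of_nonpos hr.le (mul_nonpos_of_nonneg_of_nonpos hr.le h1),
    mul_neg_of_pos_of_neg hr h2⟩

theorem IsFutureTimelike.smul {M : LorentzData E} {p u : E} (h : M.IsFutureTimelike p u) {r : ℝ}
    (hr : 0 < r) : M.IsFutureTimelike p (r • u) := by
  obtain ⟨h1, h2⟩ := h
  simp only [IsFutureTimelike, map_smul, smul_apply, smul_eq_mul]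
  exact ⟨mul_neg_of_pos_of_neg hr (mul_neg_of_pos_of_neg hr h1), mul_neg_of_pos_of_neg hr h2⟩

theorem IsFutureCausal.mem_futureCone {M : LorentzData E} {p u : E} (h : M.IsFutureCausal p u) :
    u ∈ futureCone (M.metric p) (M.X0 p) := ⟨h.1, h.2.le⟩

theorem continuous_metric_apply {A : Type*} [TopologicalSpace A] {x u v : A → E}
    (hx : Continuous x) (hu : Continuous u) (hv : Continuous v) :
    Continuous fun a => M.metric (x a) (u a) (v a) :=
  ((M.continuous_metric.comp hx).clm_apply hu).clm_apply hv

theorem continuous_chris_apply {A : Type*} [TopologicalSpace A] {x u v : A → E}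
    (hx : Continuous x) (hu : Continuous u) (hv : Continuous v) :
    Continuous fun a => M.chris (x a) (u a) (v a) :=
  ((M.continuous_chris.comp hx).clm_apply hu).clm_apply hv

theorem continuous_fderiv_metric_apply {A : Type*} [TopologicalSpace A] {x w u v : A → E}
    (hx : Continuous x) (hw : Continuous w) (hu : Continuous u) (hv : Continuous v) :
    Continuous fun a => fderiv ℝ M.metric (x a) (w a) (u a) (v a) :=
  ((((M.contDiff_metric.continuous_fderiv one_ne_zero).comp hx).clm_apply hw).clm_apply
    hu).clm_apply hv

theorem hasDerivAt_metric_line (x w z y : E) (ε : ℝ) :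
    HasDerivAt (fun ε : ℝ => M.metric (x + ε • w) (z + ε • y) (z + ε • y))
      (fderiv ℝ M.metric (x + ε • w) w (z + ε • y) (z + ε • y)
        + M.metric (x + ε • w) y (z + ε • y) + M.metric (x + ε • w) (z + ε • y) y) ε := by
  have hline : ∀ x w : E, HasDerivAt (fun ε : ℝ => x + ε • w) w ε := by
    intro x w
    simpa using ((hasDerivAt_id ε).smul_const w).const_add x
  have h0 := (M.contDiff_metric.differentiable one_ne_zero (x + ε • w)).hasFDerivAt
  have h1 : HasDerivAt (fun ε : ℝ => M.metric (x + ε • w))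
      (fderiv ℝ M.metric (x + ε • w) w) ε :=
    h0.comp_hasDerivAt (f := fun ε : ℝ => x + ε • w) ε (hline x w)
  refine ((h1.clm_apply (hline z y)).clm_apply (hline z y)).congr_deriv ?_
  rw [add_apply]

/-- If `φ' + 2 φ < 0` and `φ 0 ≤ 0` then `φ` becomes negative. -/
theorem neg_of_deriv_add_two_mul_neg {φ φ' : ℝ → ℝ} (hφ : ∀ ε, HasDerivAt φ (φ' ε) ε)
    {ε₀ : ℝ} (hε : 0 < ε₀) (h0 : φ 0 ≤ 0) (h : ∀ ε ∈ Icc 0 ε₀, φ' ε + 2 * φ ε < 0) :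
    φ ε₀ < 0 := by
  have hd : ∀ ε, HasDerivAt (fun ε => Real.exp (2 * ε) * φ ε)
      (Real.exp (2 * ε) * (φ' ε + 2 * φ ε)) ε := by
    intro ε
    have h1 : HasDerivAt (fun ε : ℝ => Real.exp (2 * ε)) (Real.exp (2 * ε) * 2) ε := by
      simpa using ((hasDerivAt_id ε).const_mul 2).exp
    refine (h1.mul (hφ ε)).congr_deriv ?_
    ring
  have hanti : StrictAntiOn (fun ε => Real.exp (2 * ε) * φ ε) (Icc 0 ε₀) := by
    refine strictAntiOn_of_deriv_neg (convex_Icc _ _)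
      (fun ε _ => (hd ε).continuousAt.continuousWithinAt) fun ε hε' => ?_
    rw [(hd ε).deriv]
    rw [interior_Icc] at hε'
    exact mul_neg_of_pos_of_neg (Real.exp_pos _) (h ε (Ioo_subset_Icc_self hε'))
  have h2 := hanti (left_mem_Icc.2 hε.le) (right_mem_Icc.2 hε.le) hε
  simp only [mul_zero, Real.exp_zero, one_mul] at h2
  have h3 : Real.exp (2 * ε₀) * φ ε₀ < 0 := h2.trans_le h0
  nlinarith [Real.exp_pos (2 * ε₀)]

namespace IsTransport

variable {M} {x₀ : E} {U : ℝ → E} {P Q : ℝ → E →L[ℝ] E}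

theorem locBdd_inv (h : M.IsTransport x₀ U P Q) : LocBdd fun t => Q t (U t) :=
  LocBdd.clm_apply h.continuous_inv h.locBdd

theorem isFutureCausal_apply (h : M.IsTransport x₀ U P Q) {c : E} (hc : M.IsFutureCausal x₀ c)
    (t : ℝ) : M.IsFutureCausal (curveOf x₀ U t) (P t c) :=
  ⟨by rw [h.metric_eq]; exact hc.1, h.future_of_future hc.1 hc.2 t⟩

theorem isFutureCausal_inv (h : M.IsTransport x₀ U P Q) {u : E} {t : ℝ}
    (hu : M.IsFutureCausal (curveOf x₀ U t) u) : M.IsFutureCausal x₀ (Q t u) := by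
  have h1 := h.metric_eq t (Q t u) (Q t u)
  rw [h.apply_inv] at h1
  have h2 : M.metric x₀ (Q t u) (Q t u) ≤ 0 := h1 ▸ hu.1
  refine ⟨h2, (h.future_iff h2 t).1 ?_⟩
  rw [h.apply_inv]
  exact hu.2

set_option maxHeartbeats 1000000 in
/-- Given the total transported displacement `D` is timelike, there is a small uniform
deformation making the velocity timelike. -/
theorem exists_uniform_deformation [ProperSpace E] (h : M.IsTransport x₀ U P Q) {T : ℝ}
    {s : ℝ → ℝ} {C : ℝ → E} (hs : Continuous s) (hC : Continuous C) {m : E}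
    (hm : M.metric x₀ m m < 0) (hmN : M.metric x₀ m (M.X0 x₀) = -1) :
    ∃ ε : ℝ, 0 < ε ∧ ∀ᶠ v in 𝓝 (0 : E), ∀ t ∈ Icc 0 T, ∀ c, M.metric x₀ c c ≤ 0 →
      M.metric x₀ c (M.X0 x₀) = -1 →
      M.IsFutureTimelike (curveOf x₀ U t + ε • P t (s t • (m + v) - C t))
        (P t c + ε • (-M.chris (curveOf x₀ U t) (P t c) (P t (s t • (m + v) - C t))
          + P t (m + v - c))) := by
  have hγ := h.continuous_curve
  have hP := h.continuous
  set γ := curveOf x₀ U with hγdef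
  have hL := M.isLorentzForm_metric x₀
  set K : Set (ℝ × E) := Icc 0 T ×ˢ {c : E | M.metric x₀ c c ≤ 0 ∧ M.metric x₀ c (M.X0 x₀) = -1}
    with hKdef
  have hK : IsCompact K := isCompact_Icc.prod hL.isCompact_slice
  let w : E → ℝ × E → E := fun v z => P z.1 (s z.1 • (m + v) - C z.1)
  let Y : E → ℝ × E → E := fun v z =>
    -M.chris (γ z.1) (P z.1 z.2) (w v z) + P z.1 (m + v - z.2)
  have hPz : ∀ {A : Type _} [TopologicalSpace A] {τ : A → ℝ} {u : A → E}, Continuous τ →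
      Continuous u → Continuous fun a => P (τ a) (u a) := fun hτ hu =>
    (hP.comp hτ).clm_apply hu
  have hw : Continuous fun a : E × ℝ × E => w a.1 a.2 :=
    hPz (by fun_prop) (by fun_prop)
  have hY : Continuous fun a : E × ℝ × E => Y a.1 a.2 :=
    (M.continuous_chris_apply (by fun_prop) (hPz (by fun_prop) (by fun_prop)) hw).neg.add
      (hPz (by fun_prop) (by fun_prop))
  have hZ : Continuous fun z : ℝ × E => P z.1 z.2 := hPz (by fun_prop) (by fun_prop)
  have hB : Continuous fun a : (ℝ × E) × ℝ × E => γ a.2.1 + a.1.1 • w a.1.2 a.2 := by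
    have : Continuous fun a : (ℝ × E) × ℝ × E => w a.1.2 a.2 := hw.comp
      (g := fun a : E × ℝ × E => w a.1 a.2) (f := fun a : (ℝ × E) × ℝ × E => (a.1.2, a.2))
      (by fun_prop)
    fun_prop
  have hX : Continuous fun a : (ℝ × E) × ℝ × E => P a.2.1 a.2.2 + a.1.1 • Y a.1.2 a.2 := by
    have h1 : Continuous fun a : (ℝ × E) × ℝ × E => Y a.1.2 a.2 := hY.comp
      (g := fun a : E × ℝ × E => Y a.1 a.2) (f := fun a : (ℝ × E) × ℝ × E => (a.1.2, a.2))
      (by fun_prop)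
    have h2 : Continuous fun a : (ℝ × E) × ℝ × E => P a.2.1 a.2.2 := hZ.comp continuous_snd
    fun_prop
  have hq : Continuous fun a : (ℝ × E) × ℝ × E =>
      M.metric (γ a.2.1 + a.1.1 • w a.1.2 a.2) (P a.2.1 a.2.2 + a.1.1 • Y a.1.2 a.2)
        (P a.2.1 a.2.2 + a.1.1 • Y a.1.2 a.2) := M.continuous_metric_apply hB hX hX
  have hG : Continuous fun a : (ℝ × E) × ℝ × E =>
      M.metric (γ a.2.1 + a.1.1 • w a.1.2 a.2) (P a.2.1 a.2.2 + a.1.1 • Y a.1.2 a.2)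
        (M.X0 (γ a.2.1 + a.1.1 • w a.1.2 a.2)) :=
    M.continuous_metric_apply hB hX (M.X0_cont.comp hB)
  have hR : Continuous fun a : (ℝ × E) × ℝ × E =>
      (fderiv ℝ M.metric (γ a.2.1 + a.1.1 • w a.1.2 a.2) (w a.1.2 a.2)
        (P a.2.1 a.2.2 + a.1.1 • Y a.1.2 a.2) (P a.2.1 a.2.2 + a.1.1 • Y a.1.2 a.2)
        + M.metric (γ a.2.1 + a.1.1 • w a.1.2 a.2) (Y a.1.2 a.2)
          (P a.2.1 a.2.2 + a.1.1 • Y a.1.2 a.2)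
        + M.metric (γ a.2.1 + a.1.1 • w a.1.2 a.2) (P a.2.1 a.2.2 + a.1.1 • Y a.1.2 a.2)
          (Y a.1.2 a.2))
      + 2 * M.metric (γ a.2.1 + a.1.1 • w a.1.2 a.2) (P a.2.1 a.2.2 + a.1.1 • Y a.1.2 a.2)
        (P a.2.1 a.2.2 + a.1.1 • Y a.1.2 a.2) := by
    have hw' : Continuous fun a : (ℝ × E) × ℝ × E => w a.1.2 a.2 := hw.comp
      (g := fun a : E × ℝ × E => w a.1 a.2) (f := fun a : (ℝ × E) × ℝ × E => (a.1.2, a.2))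
      (by fun_prop)
    have hY' : Continuous fun a : (ℝ × E) × ℝ × E => Y a.1.2 a.2 := hY.comp
      (g := fun a : E × ℝ × E => Y a.1 a.2) (f := fun a : (ℝ × E) × ℝ × E => (a.1.2, a.2))
      (by fun_prop)
    exact (((M.continuous_fderiv_metric_apply hB hw' hX hX).add
      (M.continuous_metric_apply hB hY' hX)).add (M.continuous_metric_apply hB hX hY')).add
      (continuous_const.mul hq)
  have hslice : ∀ z : ℝ × E, z ∈ K → M.IsFutureCausal x₀ z.2 := fun z hz =>
    ⟨hz.2.1, by rw [hz.2.2]; norm_num⟩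
  have hmc : M.IsFutureCausal x₀ m := ⟨hm.le, by rw [hmN]; norm_num⟩
  -- the derivative at the undeformed curve
  have hR0 := hK.eventually_forall_neg
    (f := fun (p : ℝ × E) (z : ℝ × E) =>
      (fderiv ℝ M.metric (γ z.1 + p.1 • w p.2 z) (w p.2 z)
        (P z.1 z.2 + p.1 • Y p.2 z) (P z.1 z.2 + p.1 • Y p.2 z)
        + M.metric (γ z.1 + p.1 • w p.2 z) (Y p.2 z) (P z.1 z.2 + p.1 • Y p.2 z)
        + M.metric (γ z.1 + p.1 • w p.2 z) (P z.1 z.2 + p.1 • Y p.2 z) (Y p.2 z))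
      + 2 * M.metric (γ z.1 + p.1 • w p.2 z) (P z.1 z.2 + p.1 • Y p.2 z)
        (P z.1 z.2 + p.1 • Y p.2 z)) hR (a := (0, 0)) (by
    intro z hz
    have hsy := (M.isLorentzForm_metric (γ z.1)).symm
    simp only [zero_smul, add_zero]
    rw [M.fderiv_metric_eq, hsy (P z.1 z.2) (Y 0 z), hsy (P z.1 z.2) (M.chris _ _ _)]
    have hYz : Y 0 z = -M.chris (γ z.1) (w 0 z) (P z.1 z.2) + P z.1 (m - z.2) := by
      simp only [Y, add_zero]
      rw [M.chris_symm]
    rw [hYz]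
    simp only [map_add, map_neg, add_apply, neg_apply]
    rw [h.metric_eq, h.metric_eq]
    have h1 : M.metric x₀ m z.2 < 0 := by
      refine lt_of_le_of_ne (hL.nonpos_of_mem hmc.mem_futureCone
        (hslice z hz).mem_futureCone) fun h0 => ?_
      have h2 := hL.parallel_of_mem hmc.mem_futureCone (hslice z hz).mem_futureCone h0
      rw [hz.2.2, hmN] at h2
      have h3 : m = z.2 := by simpa using h2
      rw [← h3] at h0
      exact hm.ne h0
    rw [map_sub, sub_apply]
    linarith)
  have hG0 := hK.eventually_forall_neg
    (f := fun (p : ℝ × E) (z : ℝ × E) =>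
      M.metric (γ z.1 + p.1 • w p.2 z) (P z.1 z.2 + p.1 • Y p.2 z)
        (M.X0 (γ z.1 + p.1 • w p.2 z))) hG (a := (0, 0)) (by
    intro z hz
    simp only [zero_smul, add_zero]
    exact (h.isFutureCausal_apply (hslice z hz) z.1).2)
  have hline : Tendsto (fun ε : ℝ => (ε, (0 : E))) (𝓝 0) (𝓝 (0, 0)) :=
    Continuous.tendsto' (by fun_prop) _ _ rfl
  obtain ⟨δ, hδ, hball⟩ := Metric.eventually_nhds_iff.1 (hline.eventually (hR0.and hG0))
  have hε : 0 < δ / 2 := half_pos hδ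
  have hsmall : ∀ ε ∈ Icc 0 (δ / 2), dist ε 0 < δ := by
    intro ε hε'
    rw [Real.dist_0_eq_abs, abs_of_nonneg hε'.1]
    linarith [hε'.2]
  refine ⟨δ / 2, hε, ?_⟩
  have hq1 : ∀ z ∈ K, M.metric (γ z.1 + (δ / 2) • w 0 z) (P z.1 z.2 + (δ / 2) • Y 0 z)
      (P z.1 z.2 + (δ / 2) • Y 0 z) < 0 := by
    intro z hz
    refine neg_of_deriv_add_two_mul_neg
      (fun ε => M.hasDerivAt_metric_line (γ z.1) (w 0 z) (P z.1 z.2) (Y 0 z) ε) hε ?_ ?_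
    · simp only [zero_smul, add_zero]
      exact (h.isFutureCausal_apply (hslice z hz) z.1).1
    · intro ε hε'
      exact (hball (hsmall ε hε')).1 z hz
  have hG1 := (hball (hsmall (δ / 2) (right_mem_Icc.2 hε.le))).2
  have hslide : Continuous fun a : E × ℝ × E => (((δ / 2, a.1), a.2) : (ℝ × E) × ℝ × E) := by
    fun_prop
  have hq2 := hK.eventually_forall_neg (f := fun (v : E) (z : ℝ × E) =>
      M.metric (γ z.1 + (δ / 2) • w v z) (P z.1 z.2 + (δ / 2) • Y v z)
        (P z.1 z.2 + (δ / 2) • Y v z)) (hq.comp hslide) hq1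
  have hG2 := hK.eventually_forall_neg (f := fun (v : E) (z : ℝ × E) =>
      M.metric (γ z.1 + (δ / 2) • w v z) (P z.1 z.2 + (δ / 2) • Y v z)
        (M.X0 (γ z.1 + (δ / 2) • w v z))) (hG.comp hslide) hG1
  filter_upwards [hq2, hG2] with v h1 h2 t ht c hc hcN
  exact ⟨h1 (t, c) ⟨ht, hc, hcN⟩, h2 (t, c) ⟨ht, hc, hcN⟩⟩

end IsTransport
end LorentzData

namespace LorentzData

variable {E : Type*} [NormedAddCommGroup E] [NormedSpace ℝ E] {M : LorentzData E}

theorem IsFutureCausal.ne_zero {p u : E} (h : M.IsFutureCausal p u) : u ≠ 0 := by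
  rintro rfl
  simpa using h.2

theorem IsFutureTimelike.isFutureCausal {p u : E} (h : M.IsFutureTimelike p u) :
    M.IsFutureCausal p u := ⟨h.1.le, h.2⟩

namespace IsTransport

variable {x₀ : E} {U : ℝ → E} {P Q : ℝ → E →L[ℝ] E}

theorem integral_inv_mem [CompleteSpace E] (h : M.IsTransport x₀ U P Q) {T : ℝ}
    (hc : ∀ᵐ t, t ∈ Ioc 0 T → M.IsFutureCausal (curveOf x₀ U t) (U t)) {r s : ℝ}
    (hr : 0 ≤ r) (hrs : r ≤ s) (hs : s ≤ T) :
    ∫ t in r..s, Q t (U t) ∈ futureCone (M.metric x₀) (M.X0 x₀) := by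
  refine (M.isLorentzForm_metric x₀).integral_mem hrs (h.locBdd_inv.intervalIntegrable _ _) ?_
  filter_upwards [hc] with t ht hmem
  exact (h.isFutureCausal_inv (ht ⟨hr.trans_lt hmem.1, hmem.2.trans hs⟩)).mem_futureCone

theorem integral_inv_apply [CompleteSpace E] (h : M.IsTransport x₀ U P Q) (a b : ℝ) (u : E) :
    M.metric x₀ (∫ t in a..b, Q t (U t)) u = ∫ t in a..b, M.metric x₀ (Q t (U t)) u := by
  have h1 := ((M.metric x₀).flip u).intervalIntegral_comp_comm
    (h.locBdd_inv.intervalIntegrable a b)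
  exact h1.symm

theorem locBdd_inv_apply (h : M.IsTransport x₀ U P Q) (u : E) :
    LocBdd fun t => M.metric x₀ (Q t (U t)) u := by
  have hc : Continuous fun _ : ℝ => (M.metric x₀).flip u := continuous_const
  have := LocBdd.clm_apply hc h.locBdd_inv
  exact this

theorem integral_inv_apply_neg [CompleteSpace E] (h : M.IsTransport x₀ U P Q) {T : ℝ} (hT : 0 < T)
    (hc : ∀ᵐ t, t ∈ Ioc 0 T → M.IsFutureCausal (curveOf x₀ U t) (U t)) :
    M.metric x₀ (∫ t in (0 : ℝ)..T, Q t (U t)) (M.X0 x₀) < 0 := by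
  rw [h.integral_inv_apply, ← neg_pos, ← intervalIntegral.integral_neg]
  have hintegral := (h.locBdd_inv_apply (M.X0 x₀)).intervalIntegrable 0 T
  have hpos : ∀ᵐ t ∂(volume.restrict (Ioc 0 T)), 0 < -M.metric x₀ (Q t (U t)) (M.X0 x₀) := by
    rw [ae_restrict_iff' measurableSet_Ioc]
    filter_upwards [hc] with t ht hmem
    exact neg_pos.2 (h.isFutureCausal_inv (ht hmem)).2
  rw [intervalIntegral.integral_pos_iff_support_of_nonneg_ae']
  · refine ⟨hT, ?_⟩
    rw [pos_iff_ne_zero]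
    intro h0
    have h1 : ∀ᵐ t ∂(volume.restrict (Ioc 0 T)), False := by
      have h2 : ∀ᵐ t ∂volume, t ∉ Function.support
        (fun t => -M.metric x₀ (Q t (U t)) (M.X0 x₀)) ∩ Ioc 0 T :=
      measure_eq_zero_iff_ae_notMem.1 h0
      filter_upwards [hpos, ae_restrict_of_ae h2, ae_restrict_mem measurableSet_Ioc] with t h3 h4 h5
      exact h4 ⟨h3.ne', h5⟩
    rw [ae_iff] at h1
    simp at h1
    linarith
  · rw [uIoc_of_le hT.le]
    filter_upwards [hpos] with t ht using ht.le
  · exact hintegral.neg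

/-- A causal curve whose transported displacement is timelike can be deformed into timelike curves
with the same starting point, reaching every point near its endpoint. -/
theorem eventually_exists_timelike [FiniteDimensional ℝ E] (h : M.IsTransport x₀ U P Q) {T : ℝ}
    (hT : 0 < T) (hc : ∀ᵐ t, t ∈ Ioc 0 T → M.IsFutureCausal (curveOf x₀ U t) (U t))
    (hD : M.metric x₀ (∫ t in (0 : ℝ)..T, Q t (U t)) (∫ t in (0 : ℝ)..T, Q t (U t)) < 0) :
    ∀ᶠ y in 𝓝 (curveOf x₀ U T), ∃ β : ℝ → E, LocallyLipschitz β ∧ β 0 = x₀ ∧ β T = y ∧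
      ∀ᵐ t, t ∈ Ioc 0 T → ∃ u, HasDerivAt β u t ∧ M.IsFutureTimelike (β t) u := by
  have : CompleteSpace E := FiniteDimensional.complete ℝ E
  have : ProperSpace E := FiniteDimensional.proper ℝ E
  have hDN := h.integral_inv_apply_neg hT hc
  set C : ℝ → E := curveOf 0 fun t => Q t (U t) with hCdef
  have hCT : ∫ t in (0 : ℝ)..T, Q t (U t) = C T := by simp [hCdef, curveOf]
  rw [hCT] at hDN hD
  have hCl : LocallyLipschitz C := h.locBdd_inv.locallyLipschitz_curveOf
  have hCd : ∀ᵐ t, HasDerivAt C (Q t (U t)) t := h.locBdd_inv.ae_hasDerivAt_curveOf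
  let s : ℝ → ℝ := fun t => -M.metric x₀ (C t) (M.X0 x₀)
  have hsT : 0 < s T := neg_pos.2 hDN
  have hsl : LocallyLipschitz s := by
    have h1 : ContDiff ℝ 1 fun x : E => -(M.metric x₀).flip (M.X0 x₀) x := by fun_prop
    exact h1.locallyLipschitz.comp hCl
  have hsd : ∀ᵐ t, HasDerivAt s (-M.metric x₀ (Q t (U t)) (M.X0 x₀)) t := by
    filter_upwards [hCd] with t ht
    exact (((M.metric x₀).flip (M.X0 x₀)).hasFDerivAt.comp_hasDerivAt t ht).neg
  let m : E := (s T)⁻¹ • C T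
  have hmm : M.metric x₀ m m < 0 := by
    simp only [m, map_smul, smul_apply, smul_eq_mul]
    exact mul_neg_of_pos_of_neg (inv_pos.2 hsT) (mul_neg_of_pos_of_neg (inv_pos.2 hsT) hD)
  have hmN : M.metric x₀ m (M.X0 x₀) = -1 := by
    simp only [m, map_smul, smul_apply, smul_eq_mul]
    have h1 : M.metric x₀ (C T) (M.X0 x₀) = -s T := by simp [s]
    rw [h1, mul_neg, inv_mul_cancel₀ hsT.ne']
  have hsm : s T • m = C T := by
    simp only [m]
    rw [smul_smul, mul_inv_cancel₀ hsT.ne', one_smul]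
  obtain ⟨ε, hε, hv⟩ := h.exists_uniform_deformation (T := T) hsl.continuous hCl.continuous hmm hmN
  have hy : Tendsto (fun y => (ε * s T)⁻¹ • Q T (y - curveOf x₀ U T)) (𝓝 (curveOf x₀ U T))
      (𝓝 0) := Continuous.tendsto' (by fun_prop) _ _ (by simp)
  filter_upwards [hy.eventually hv] with y hy'
  set v := (ε * s T)⁻¹ • Q T (y - curveOf x₀ U T) with hvdef
  let a : ℝ → E := fun t => s t • (m + v) - C t
  have hal : LocallyLipschitz a := by
    have h1 : ContDiff ℝ 1 fun z : ℝ × E => z.1 • (m + v) - z.2 := by fun_prop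
    exact h1.locallyLipschitz.comp (hsl.prodMk hCl)
  have hPa := h.locallyLipschitz_apply hal
  have hγl : LocallyLipschitz (curveOf x₀ U) := h.locBdd.locallyLipschitz_curveOf
  refine ⟨fun t => curveOf x₀ U t + ε • P t (a t), ?_, ?_, ?_, ?_⟩
  · have h1 : ContDiff ℝ 1 fun z : E × E => z.1 + ε • z.2 := by fun_prop
    exact h1.locallyLipschitz.comp (hγl.prodMk hPa)
  · have ha0 : a 0 = 0 := by simp [a, s, hCdef, curveOf]
    simp [ha0, curveOf_zero]
  · have haT : a T = s T • v := by
      simp only [a]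
      rw [smul_add, hsm]
      abel
    simp only [haT]
    rw [map_smul, smul_smul, hvdef, map_smul, h.apply_inv, smul_smul, mul_inv_cancel₀
      (mul_pos hε hsT).ne', one_smul]
    abel
  · filter_upwards [hc, hCd, hsd, h.ae_hasDerivAt, h.locBdd.ae_hasDerivAt_curveOf (x₀ := x₀)]
      with t h1 h2 h3 h4 h5 ht
    have hfc := h.isFutureCausal_inv (h1 ht)
    set c₀ := -M.metric x₀ (Q t (U t)) (M.X0 x₀) with hc₀
    have hc₀pos : 0 < c₀ := neg_pos.2 hfc.2
    set c := c₀⁻¹ • Q t (U t) with hcdef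
    have hcQ : Q t (U t) = c₀ • c := by
      rw [hcdef, smul_smul, mul_inv_cancel₀ hc₀pos.ne', one_smul]
    have hUc : U t = c₀ • P t c := by
      rw [← map_smul, ← hcQ, h.apply_inv]
    have hcN : M.metric x₀ c (M.X0 x₀) = -1 := by
      have h6 : M.metric x₀ (Q t (U t)) (M.X0 x₀) = -c₀ := by rw [hc₀, neg_neg]
      rw [hcdef, map_smul, smul_apply, h6, smul_eq_mul, mul_neg, inv_mul_cancel₀ hc₀pos.ne']
    have hcc := (hfc.smul (inv_pos.2 hc₀pos)).1
    have htl := (hy' t ⟨ht.1.le, ht.2⟩ c hcc hcN).smul hc₀pos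
    refine ⟨_, ?_, htl⟩
    have had : HasDerivAt a (c₀ • (m + v) - c₀ • c) t := by
      refine ((h3.smul_const (m + v)).sub h2).congr_deriv ?_
      rw [hcQ]
    refine (h5.add ((h4.clm_apply had).const_smul ε)).congr_deriv ?_
    have h7 : (-M.chris (curveOf x₀ U t) (U t) * P t) (a t) =
        -(c₀ • M.chris (curveOf x₀ U t) (P t c) (P t (a t))) := by
      rw [hUc, map_smul]
      rfl
    rw [h7, hUc]
    simp only [a, map_sub, map_smul, map_add, smul_add, smul_sub, smul_neg]
    simp only [smul_comm ε c₀]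

/-- A causal curve whose transported displacement is null has a constant transported
direction. -/
theorem exists_null_direction [FiniteDimensional ℝ E] (h : M.IsTransport x₀ U P Q) {T : ℝ}
    (hT : 0 < T) (hc : ∀ᵐ t, t ∈ Ioc 0 T → M.IsFutureCausal (curveOf x₀ U t) (U t))
    (hD : ¬ M.metric x₀ (∫ t in (0 : ℝ)..T, Q t (U t)) (∫ t in (0 : ℝ)..T, Q t (U t)) < 0) :
    ∃ m, M.metric x₀ m m = 0 ∧ M.metric x₀ m (M.X0 x₀) = -1 ∧
      ∀ᵐ t, t ∈ Ioo 0 T → Q t (U t) = (-M.metric x₀ (Q t (U t)) (M.X0 x₀)) • m := by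
  have : CompleteSpace E := FiniteDimensional.complete ℝ E
  have hL := M.isLorentzForm_metric x₀
  have hDN := h.integral_inv_apply_neg hT hc
  have hDm := h.integral_inv_mem hc le_rfl hT.le le_rfl
  set C : ℝ → E := curveOf 0 fun t => Q t (U t) with hCdef
  have hCt : ∀ t, ∫ t in (0 : ℝ)..t, Q t (U t) = C t := by intro t; simp [hCdef, curveOf]
  have hCd : ∀ᵐ t, HasDerivAt C (Q t (U t)) t := h.locBdd_inv.ae_hasDerivAt_curveOf
  rw [hCt] at hDN hD hDm
  have hD0 : M.metric x₀ (C T) (C T) = 0 := le_antisymm hDm.1 (not_lt.1 hD)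
  set r := -M.metric x₀ (C T) (M.X0 x₀) with hr
  have hrpos : 0 < r := neg_pos.2 hDN
  have hDr : M.metric x₀ (C T) (M.X0 x₀) = -r := by rw [hr, neg_neg]
  have hCm : ∀ t ∈ Ioo 0 T, C t = (-M.metric x₀ (C t) (M.X0 x₀)) • r⁻¹ • C T := by
    intro t ht
    have h1 := h.integral_inv_mem hc le_rfl ht.1.le ht.2.le
    have h2 := h.integral_inv_mem hc ht.1.le ht.2.le le_rfl
    have h3 : C T = C t + ∫ s in t..T, Q s (U s) := by
      rw [← hCt, ← hCt, intervalIntegral.integral_add_adjacent_intervals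
        (h.locBdd_inv.intervalIntegrable _ _) (h.locBdd_inv.intervalIntegrable _ _)]
    rw [hCt] at h1
    have h4 := hL.nonpos_of_mem h1 hDm
    have h5 := hL.nonpos_of_mem h2 hDm
    have h6 : M.metric x₀ (C T) (C T) =
        M.metric x₀ (C t) (C T) + M.metric x₀ (∫ s in t..T, Q s (U s)) (C T) := by
      rw [← add_apply, ← map_add, ← h3]
    have h7 : M.metric x₀ (C t) (C T) = 0 := by linarith
    have h8 := hL.parallel_of_mem h1 hDm h7
    rw [hDr] at h8
    rw [smul_comm, neg_smul, ← h8, neg_smul, neg_neg, smul_smul, inv_mul_cancel₀ hrpos.ne',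
      one_smul]
  refine ⟨r⁻¹ • C T, ?_, ?_, ?_⟩
  · simp [hD0]
  · rw [map_smul, smul_apply, hDr, smul_eq_mul, mul_neg, inv_mul_cancel₀ hrpos.ne']
  · filter_upwards [hCd] with t ht hmem
    have h1 : HasDerivAt (fun t => (-M.metric x₀ (C t) (M.X0 x₀)) • r⁻¹ • C T)
        ((-M.metric x₀ (Q t (U t)) (M.X0 x₀)) • r⁻¹ • C T) t :=
      (((M.metric x₀).flip (M.X0 x₀)).hasFDerivAt.comp_hasDerivAt t ht).neg.smul_const _
    have h2 : C =ᶠ[𝓝 t] fun t => (-M.metric x₀ (C t) (M.X0 x₀)) • r⁻¹ • C T := by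
      filter_upwards [Ioo_mem_nhds hmem.1 hmem.2] with t' ht' using hCm t' ht'
    exact ht.unique (h1.congr_of_eventuallyEq h2)

end IsTransport
end LorentzData

/-! ### Causal curves and their velocities -/

section Velocity

variable {E : Type*} [NormedAddCommGroup E] [NormedSpace ℝ E]

/-- A locally Lipschitz curve on `I` whose velocity satisfies `R` almost everywhere. -/
def IsPathOn (R : E → E → Prop) (γ : ℝ → E) (I : Set ℝ) : Prop :=
  LocallyLipschitzOn I γ ∧
    ∀ᵐ t ∂(volume.restrict I), DifferentiableAt ℝ γ t ∧ R (γ t) (deriv γ t)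

/-- `U` is the velocity of a curve from `x` to `y` on the unit interval. -/
structure IsVelocity [MeasurableSpace E] (R : E → E → Prop) (x y : E) (U : ℝ → E) : Prop where
  measurable : Measurable U
  bounded : ∃ K : ℝ, ∀ t, ‖U t‖ ≤ K
  zero : ∀ t < 0, U t = 0
  endpoint : curveOf x U 1 = y
  ae_mem : ∀ᵐ t, t ∈ Ioc 0 1 → R (curveOf x U t) (U t)

theorem IsPathOn.mono {R : E → E → Prop} {γ : ℝ → E} {I J : Set ℝ} (h : IsPathOn R γ I)
    (hJ : J ⊆ I) : IsPathOn R γ J :=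
  ⟨h.1.mono hJ, ae_restrict_of_ae_restrict_of_subset hJ h.2⟩

theorem IsVelocity.imp [MeasurableSpace E] {R S : E → E → Prop} {x y : E} {U : ℝ → E}
    (h : IsVelocity R x y U)
    (hRS : ∀ x u, R x u → S x u) : IsVelocity S x y U :=
  ⟨h.measurable, h.bounded, h.zero, h.endpoint, by
    filter_upwards [h.ae_mem] with t ht hmem using hRS _ _ (ht hmem)⟩

variable [FiniteDimensional ℝ E]

theorem LocBdd.isPathOn_curveOf {R : E → E → Prop} {x : E} {U : ℝ → E} (hU : LocBdd U) {I : Set ℝ}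
    (hI : MeasurableSet I) (h : ∀ᵐ t, t ∈ I → R (curveOf x U t) (U t)) :
    IsPathOn R (curveOf x U) I := by
  have : CompleteSpace E := FiniteDimensional.complete ℝ E
  refine ⟨hU.locallyLipschitz_curveOf.locallyLipschitzOn, ?_⟩
  rw [ae_restrict_iff' hI]
  filter_upwards [h, hU.ae_hasDerivAt_curveOf (x₀ := x)] with t h1 h2 ht
  exact ⟨h2.differentiableAt, by rw [h2.deriv]; exact h1 ht⟩

theorem LipschitzWith.curveOf_deriv {f : ℝ → E} {K : ℝ≥0} (hf : LipschitzWith K f) {t : ℝ}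
    (ht : 0 ≤ t) : curveOf (f 0) (deriv f) t = f t := by
  have : CompleteSpace E := FiniteDimensional.complete ℝ E
  have hU : LocBdd (deriv f) := ⟨(stronglyMeasurable_deriv f).aestronglyMeasurable, fun _ =>
    ⟨K, fun _ _ => norm_deriv_le_of_lipschitz hf⟩⟩
  refine (hf.locallyLipschitz.eq_add_integral hU ht ?_).symm
  filter_upwards [hf.ae_differentiableAt_real] with s hs _ using hs.hasDerivAt

variable [MeasurableSpace E] [BorelSpace E]

theorem IsVelocity.locBdd {R : E → E → Prop} {x y : E} {U : ℝ → E} (h : IsVelocity R x y U) :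
    LocBdd U :=
  ⟨h.measurable.stronglyMeasurable.aestronglyMeasurable, fun _ =>
    h.bounded.imp fun _ hK t _ => hK t⟩

theorem IsVelocity.isPathOn {R : E → E → Prop} {x y : E} {U : ℝ → E} (h : IsVelocity R x y U) :
    IsPathOn R (curveOf x U) (Icc 0 1) := by
  refine h.locBdd.isPathOn_curveOf measurableSet_Icc ?_
  filter_upwards [h.ae_mem, Measure.ae_ne volume (0 : ℝ)] with t h1 h2 ht
  exact h1 ⟨lt_of_le_of_ne ht.1 h2.symm, ht.2⟩

theorem IsPathOn.exists_isVelocity {R : E → E → Prop}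
    (hR : ∀ x u (r : ℝ), 0 < r → R x u → R x (r • u)) {γ : ℝ → E} {a b : ℝ} (hab : a < b)
    (h : IsPathOn R γ (Icc a b)) : ∃ U, IsVelocity R (γ a) (γ b) U ∧
      (∀ t ∈ Icc (0 : ℝ) 1, curveOf (γ a) U t = γ ((b - a) * t + a)) ∧
      ∀ t ∈ Ioo (0 : ℝ) 1, U t = (b - a) • deriv γ ((b - a) * t + a) := by
  obtain ⟨K, hK⟩ := h.1.exists_lipschitzOnWith_of_compact isCompact_Icc
  have hba : 0 < b - a := sub_pos.2 hab
  let p : ℝ → ℝ := fun t => (b - a) * max 0 (min 1 t) + a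
  have hp : ∀ t, p t ∈ Icc a b := by
    intro t
    have h1 : 0 ≤ max 0 (min 1 t) := le_max_left _ _
    have h2 : max 0 (min 1 t) ≤ 1 := max_le zero_le_one (min_le_left _ _)
    constructor <;> simp only [p] <;> nlinarith
  have hpl : LipschitzWith (Real.toNNReal (b - a)) p := by
    refine LipschitzWith.of_dist_le_mul fun s t => ?_
    rw [Real.coe_toNNReal _ hba.le, Real.dist_eq, Real.dist_eq]
    simp only [p]
    rw [add_sub_add_right_eq_sub, ← mul_sub, abs_mul, abs_of_pos hba]
    refine mul_le_mul_of_nonneg_left ?_ hba.le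
    exact (abs_max_sub_max_le_max _ _ _ _).trans (by
      simp only [sub_self, abs_zero]
      refine max_le (abs_nonneg _) ((abs_min_sub_min_le_max _ _ _ _).trans ?_)
      simp)
  have hf : LipschitzWith (K * Real.toNNReal (b - a)) (γ ∘ p) := by
    rw [← lipschitzOnWith_univ]
    exact hK.comp hpl.lipschitzOnWith fun t _ => hp t
  have hp0 : p 0 = a := by simp [p]
  have hpt : ∀ t ∈ Icc (0 : ℝ) 1, p t = (b - a) * t + a := by
    intro t ht
    simp [p, ht.1, ht.2]
  have hf0 : (γ ∘ p) 0 = γ a := by simp [hp0]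
  have hcurve : ∀ t ∈ Icc (0 : ℝ) 1, curveOf (γ a) (deriv (γ ∘ p)) t = γ ((b - a) * t + a) := by
    intro t ht
    have h1 := hf.curveOf_deriv ht.1
    rw [hf0] at h1
    rw [h1, Function.comp_apply, hpt t ht]
  have hderiv : ∀ t ∈ Ioo (0 : ℝ) 1,
      deriv (γ ∘ p) t = (b - a) • deriv γ ((b - a) * t + a) := by
    intro t ht
    have h1 : γ ∘ p =ᶠ[𝓝 t] fun t => γ ((b - a) * t + a) := by
      filter_upwards [Ioo_mem_nhds ht.1 ht.2] with s hs
      rw [Function.comp_apply, hpt s ⟨hs.1.le, hs.2.le⟩]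
    rw [h1.deriv_eq, deriv_comp_mul_left (b - a) (fun s => γ (s + a)) t, deriv_comp_add_const]
  refine ⟨deriv (γ ∘ p), ⟨measurable_deriv _, ⟨_, fun t => norm_deriv_le_of_lipschitz hf⟩, ?_,
    ?_, ?_⟩, hcurve, hderiv⟩
  · intro t ht
    have h1 : γ ∘ p =ᶠ[𝓝 t] fun _ => γ a := by
      filter_upwards [Iio_mem_nhds ht] with s hs
      have h2 : min 1 s ≤ 0 := (min_le_right _ _).trans (le_of_lt hs)
      simp [p, h2]
    rw [h1.deriv_eq, deriv_const]
  · rw [hcurve 1 (by simp)]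
    congr 1
    ring
  · have h1 := h.2
    rw [ae_restrict_iff' measurableSet_Icc] at h1
    have h2 : ∀ᵐ t : ℝ, (b - a) * t + a ∈ Icc a b →
        DifferentiableAt ℝ γ ((b - a) * t + a) ∧
          R (γ ((b - a) * t + a)) (deriv γ ((b - a) * t + a)) := by
      have hq : Measure.QuasiMeasurePreserving (fun t : ℝ => (b - a) * t + a) volume volume :=
        (measurePreserving_add_right volume a).quasiMeasurePreserving.comp
          (Measure.quasiMeasurePreserving_smul volume hba.ne')
      exact hq.ae h1
    filter_upwards [h2, Measure.ae_ne volume (1 : ℝ)] with t h3 h4 ht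
    have ht' : t ∈ Ioo (0 : ℝ) 1 := ⟨ht.1, lt_of_le_of_ne ht.2 h4⟩
    rw [hderiv t ht', hcurve t ⟨ht.1.le, ht.2⟩]
    refine hR _ _ _ hba (h3 ⟨?_, ?_⟩).2
    · nlinarith [ht.1]
    · nlinarith [ht.2]

/-- Concatenation of a sequence of curves. -/
theorem exists_concat {x : ℕ → E} {W : ℕ → ℝ → E} (hm : ∀ k, Measurable (W k))
    (hb : ∀ k, ∃ K : ℝ, ∀ t, ‖W k t‖ ≤ K) (hx : ∀ k, curveOf (x k) (W k) 1 = x (k + 1)) :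
    ∃ U : ℝ → E, LocBdd U ∧ (∀ t < 0, U t = 0) ∧
      (∀ (k : ℕ), ∀ t ∈ Ico (0 : ℝ) 1, U (k + t) = W k t) ∧
      ∀ (k : ℕ), ∀ t ∈ Icc (0 : ℝ) 1, curveOf (x 0) U (k + t) = curveOf (x k) (W k) t := by
  have : CompleteSpace E := FiniteDimensional.complete ℝ E
  let U : ℝ → E := fun t => if t < 0 then 0 else W ⌊t⌋₊ (t - ⌊t⌋₊)
  have hUk : ∀ (k : ℕ), ∀ t ∈ Ico (0 : ℝ) 1, U (k + t) = W k t := by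
    intro k t ht
    have h1 : ⌊(k : ℝ) + t⌋₊ = k := by
      rw [Nat.floor_eq_iff (by have := ht.1; positivity)]
      exact ⟨by linarith [ht.1], by linarith [ht.2]⟩
    have h2 : ¬ ((k : ℝ) + t < 0) := by
      have := ht.1
      push Not
      positivity
    simp only [U, h1, h2, if_false]
    congr 1
    ring
  have hU : LocBdd U := by
    constructor
    · have h1 : Measurable fun z : ℕ × ℝ => W z.1 z.2 :=
        measurable_from_prod_countable_right fun k => hm k
      have h2 : Measurable fun t : ℝ => ((⌊t⌋₊, t - ⌊t⌋₊) : ℕ × ℝ) :=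
        Nat.measurable_floor.prodMk
          (measurable_id.sub (measurable_from_nat.comp Nat.measurable_floor))
      exact (Measurable.ite measurableSet_Iio measurable_const
        (h1.comp h2)).stronglyMeasurable.aestronglyMeasurable
    · intro T
      choose K hK using hb
      refine ⟨∑ k ∈ Finset.range (⌊T⌋₊ + 1), |K k|, fun t ht => ?_⟩
      have hsum : 0 ≤ ∑ k ∈ Finset.range (⌊T⌋₊ + 1), |K k| :=
        Finset.sum_nonneg fun _ _ => abs_nonneg _
      simp only [U]
      split_ifs with h0
      · simpa using hsum
      · refine (hK _ _).trans ((le_abs_self _).trans ?_)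
        refine Finset.single_le_sum (f := fun k => |K k|) (fun _ _ => abs_nonneg _) ?_
        rw [Finset.mem_range, Nat.lt_succ_iff]
        exact Nat.floor_le_floor ((le_abs_self t).trans ht)
  have hintegral : ∀ (k : ℕ), ∀ t ∈ Icc (0 : ℝ) 1,
      ∫ s in (k : ℝ)..(k + t), U s = ∫ s in (0 : ℝ)..t, W k s := by
    intro k t ht
    have h1 : ∫ s in (0 : ℝ)..t, U (k + s) = ∫ s in (k : ℝ)..(k + t), U s := by
      rw [intervalIntegral.integral_comp_add_left]
      simp
    rw [← h1]
    refine intervalIntegral.integral_congr_ae ?_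
    filter_upwards [Measure.ae_ne volume (1 : ℝ)] with s hs hmem
    rw [uIoc_of_le ht.1] at hmem
    exact hUk k s ⟨hmem.1.le, lt_of_le_of_ne (hmem.2.trans ht.2) hs⟩
  have hstep : ∀ (k : ℕ) (t : ℝ), curveOf (x 0) U (k + t) =
      curveOf (x 0) U k + ∫ s in (k : ℝ)..(k + t), U s := by
    intro k t
    simp only [curveOf]
    rw [add_assoc, intervalIntegral.integral_add_adjacent_intervals
      (hU.intervalIntegrable _ _) (hU.intervalIntegrable _ _)]
  have hk : ∀ k : ℕ, curveOf (x 0) U k = x k := by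
    intro k
    induction k with
    | zero => simp [curveOf]
    | succ k ih =>
      push_cast
      rw [hstep, ih, hintegral k 1 (by simp), ← hx k, curveOf]
  refine ⟨U, hU, fun t ht => by simp [U, ht], hUk, fun k t ht => ?_⟩
  rw [hstep, hk, hintegral k t ht, curveOf]

end Velocity

/-! ### Causality relations -/

namespace C1Spacetime

variable {n : ℕ} (M : C1Spacetime n)

/-- The metric of a spacetime with its Levi-Civita connection, in coordinate-free form. -/
def lor : LorentzData (SpacetimePt n) where
  metric := M.metric
  contDiff_metric := M.contDiff_metric
  chris := M.chris
  continuous_chris := M.continuous_chris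
  chris_symm := M.chris_symm
  fderiv_metric_eq := M.fderiv_metric_eq
  X0 := M.X0
  X0_cont := M.X0_cont
  isLorentzForm_metric := M.isLorentzForm_metric

theorem lor_metric_apply (p u v : SpacetimePt n) :
    M.lor.metric p u v = bilForm (M.g p) u v := M.metric_apply p u v

theorem isFutureCausal_iff {p u : SpacetimePt n} :
    M.lor.IsFutureCausal p u ↔ M.CausalVec p u ∧ M.FdVec p u := by
  refine ⟨fun h => ⟨⟨h.ne_zero, ?_⟩, ?_⟩, fun h => ⟨?_, ?_⟩⟩
  · rw [← lor_metric_apply]; exact h.1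
  · rw [FdVec, ← lor_metric_apply]; exact h.2
  · rw [lor_metric_apply]; exact h.1.2
  · rw [lor_metric_apply]; exact h.2

theorem isFutureTimelike_iff {p u : SpacetimePt n} :
    M.lor.IsFutureTimelike p u ↔ M.TimelikeVec p u ∧ M.FdVec p u := by
  simp only [LorentzData.IsFutureTimelike, lor_metric_apply]
  rfl

theorem isFdCausalPathOn_iff {γ : ℝ → SpacetimePt n} {I : Set ℝ} :
    M.IsFdCausalPathOn γ I ↔
      I.OrdConnected ∧ I.Nonempty ∧ IsPathOn M.lor.IsFutureCausal γ I := by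
  simp only [IsPathOn, isFutureCausal_iff]
  rfl

theorem isFdTimelikePathOn_iff {γ : ℝ → SpacetimePt n} {I : Set ℝ} :
    M.IsFdTimelikePathOn γ I ↔
      I.OrdConnected ∧ I.Nonempty ∧ IsPathOn M.lor.IsFutureTimelike γ I := by
  simp only [IsPathOn, isFutureTimelike_iff]
  rfl

/-- Length of the curve on the unit interval with starting point `x` and velocity `U`. -/
def velLength (x : SpacetimePt n) (U : ℝ → SpacetimePt n) (a b : ℝ) : ℝ :=
  ∫ t in a..b, Real.sqrt (-M.lor.metric (curveOf x U t) (U t) (U t))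

variable {M}

theorem chron_of_isPathOn {γ : ℝ → SpacetimePt n} {a b : ℝ} (hab : a < b)
    (h : IsPathOn M.lor.IsFutureTimelike γ (Icc a b)) : M.chron (γ a) (γ b) :=
  ⟨γ, a, b, hab, M.isFdTimelikePathOn_iff.2 ⟨ordConnected_Icc, nonempty_Icc.2 hab.le, h⟩,
    rfl, rfl⟩

theorem causalLe_of_isPathOn {γ : ℝ → SpacetimePt n} {a b : ℝ} (hab : a ≤ b)
    (h : IsPathOn M.lor.IsFutureCausal γ (Icc a b)) : M.causalLe (γ a) (γ b) := by
  rcases hab.eq_or_lt with rfl | hab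
  · exact Or.inl rfl
  · exact Or.inr ⟨γ, a, b, hab,
      M.isFdCausalPathOn_iff.2 ⟨ordConnected_Icc, nonempty_Icc.2 hab.le, h⟩, rfl, rfl⟩

theorem chron_iff {x y : SpacetimePt n} :
    M.chron x y ↔ ∃ U, IsVelocity M.lor.IsFutureTimelike x y U := by
  constructor
  · rintro ⟨γ, a, b, hab, h, rfl, rfl⟩
    obtain ⟨U, hU, -⟩ := (M.isFdTimelikePathOn_iff.1 h).2.2.exists_isVelocity
      (fun _ _ _ hr h => h.smul hr) hab
    exact ⟨U, hU⟩
  · rintro ⟨U, hU⟩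
    have h := chron_of_isPathOn zero_lt_one hU.isPathOn
    rwa [curveOf_zero, hU.endpoint] at h

theorem causalLe_iff {x y : SpacetimePt n} :
    M.causalLe x y ↔ x = y ∨ ∃ U, IsVelocity M.lor.IsFutureCausal x y U := by
  refine or_congr_right ?_
  constructor
  · rintro ⟨γ, a, b, hab, h, rfl, rfl⟩
    obtain ⟨U, hU, -⟩ := (M.isFdCausalPathOn_iff.1 h).2.2.exists_isVelocity
      (fun _ _ _ hr h => h.smul hr) hab
    exact ⟨U, hU⟩
  · rintro ⟨U, hU⟩
    exact ⟨curveOf x U, 0, 1, zero_lt_one, M.isFdCausalPathOn_iff.2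
      ⟨ordConnected_Icc, nonempty_Icc.2 zero_le_one, hU.isPathOn⟩, curveOf_zero, hU.endpoint⟩

theorem chron.causalLe {x y : SpacetimePt n} (h : M.chron x y) : M.causalLe x y := by
  obtain ⟨U, hU⟩ := chron_iff.1 h
  exact causalLe_iff.2 (Or.inr ⟨U, hU.imp fun _ _ h => h.isFutureCausal⟩)

theorem gLength_curveOf {x : SpacetimePt n} {U : ℝ → SpacetimePt n} (hU : LocBdd U) (a b : ℝ) :
    M.gLength (curveOf x U) a b = M.velLength x U a b := by
  refine intervalIntegral.integral_congr_ae ?_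
  filter_upwards [hU.ae_hasDerivAt_curveOf (x₀ := x)] with t ht _
  rw [ht.deriv, lor_metric_apply]

theorem le_ldist {γ : ℝ → SpacetimePt n} {a b : ℝ} (hab : a < b)
    (h : IsPathOn M.lor.IsFutureCausal γ (Icc a b)) :
    ENNReal.ofReal (M.gLength γ a b) ≤ M.ldist (γ a) (γ b) := by
  refine le_iSup_of_le γ (le_iSup_of_le a (le_iSup_of_le b (le_iSup_of_le hab
    (le_iSup_of_le ?_ (le_iSup_of_le rfl (le_iSup_of_le rfl le_rfl))))))
  exact M.isFdCausalPathOn_iff.2 ⟨ordConnected_Icc, nonempty_Icc.2 hab.le, h⟩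

theorem velLength_of_rescale {γ U : ℝ → SpacetimePt n} {a b : ℝ} (hab : a < b)
    (hc : ∀ t ∈ Icc (0 : ℝ) 1, curveOf (γ a) U t = γ ((b - a) * t + a))
    (hd : ∀ t ∈ Ioo (0 : ℝ) 1, U t = (b - a) • deriv γ ((b - a) * t + a)) :
    M.gLength γ a b = M.velLength (γ a) U 0 1 := by
  have hba : 0 < b - a := sub_pos.2 hab
  have h1 := intervalIntegral.mul_integral_comp_mul_add (a := 0) (b := 1)
    (f := fun t => Real.sqrt (-bilForm (M.g (γ t)) (deriv γ t) (deriv γ t))) (b - a) a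
  simp only [mul_zero, zero_add, mul_one, sub_add_cancel] at h1
  rw [gLength, ← h1, ← intervalIntegral.integral_const_mul, velLength]
  refine intervalIntegral.integral_congr_ae ?_
  filter_upwards [Measure.ae_ne volume (1 : ℝ)] with t ht hmem
  rw [uIoc_of_le zero_le_one] at hmem
  rw [hc t ⟨hmem.1.le, hmem.2⟩, hd t ⟨hmem.1, lt_of_le_of_ne hmem.2 ht⟩]
  simp only [map_smul, smul_apply, smul_eq_mul]
  rw [← lor_metric_apply, ← mul_assoc, ← mul_neg, Real.sqrt_mul (mul_self_nonneg _),
    Real.sqrt_mul_self hba.le]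

theorem ldist_eq (x y : SpacetimePt n) : M.ldist x y =
    ⨆ (U : ℝ → SpacetimePt n) (_ : IsVelocity M.lor.IsFutureCausal x y U),
      ENNReal.ofReal (M.velLength x U 0 1) := by
  refine le_antisymm ?_ ?_
  · refine iSup_le fun γ => iSup_le fun a => iSup_le fun b => iSup_le fun hab => iSup_le fun h =>
      iSup_le fun ha => iSup_le fun hb => ?_
    subst ha hb
    obtain ⟨U, hU, hc, hd⟩ := (M.isFdCausalPathOn_iff.1 h).2.2.exists_isVelocity
      (fun _ _ _ hr h => h.smul hr) hab
    refine le_iSup₂_of_le U hU (le_of_eq ?_)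
    rw [velLength_of_rescale hab hc hd]
  · refine iSup₂_le fun U hU => ?_
    have h := le_ldist zero_lt_one hU.isPathOn
    rwa [curveOf_zero, hU.endpoint, gLength_curveOf hU.locBdd] at h

theorem velLength_nonneg (x : SpacetimePt n) (U : ℝ → SpacetimePt n) {a b : ℝ} (hab : a ≤ b) :
    0 ≤ M.velLength x U a b :=
  intervalIntegral.integral_nonneg hab fun _ _ => Real.sqrt_nonneg _

theorem locBdd_speed {x : SpacetimePt n} {U : ℝ → SpacetimePt n} (hU : LocBdd U) :
    LocBdd fun t => Real.sqrt (-M.lor.metric (curveOf x U t) (U t) (U t)) := by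
  have h1 : Continuous fun t => M.lor.metric (curveOf x U t) :=
    M.lor.continuous_metric.comp hU.continuous_curveOf
  constructor
  · have h2 := (LocBdd.clm_apply h1 hU).1
    have h3 : AEStronglyMeasurable
      (fun t => M.lor.metric (curveOf x U t) (U t) (U t)) volume :=
      (continuous_fst.clm_apply continuous_snd).comp_aestronglyMeasurable (h2.prodMk hU.1)
    exact Real.continuous_sqrt.comp_aestronglyMeasurable h3.neg
  · intro T
    obtain ⟨K, hK⟩ := hU.2 T
    obtain ⟨L, hL⟩ := (LocBdd.clm_apply h1 hU).2 T
    refine ⟨Real.sqrt (L * K), fun t ht => ?_⟩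
    rw [Real.norm_eq_abs, abs_of_nonneg (Real.sqrt_nonneg _)]
    refine Real.sqrt_le_sqrt ((neg_le_abs _).trans ?_)
    rw [← Real.norm_eq_abs]
    refine (ContinuousLinearMap.le_opNorm _ _).trans ?_
    exact mul_le_mul (hL t ht) (hK t ht) (norm_nonneg _) ((norm_nonneg _).trans (hL t ht))

theorem velLength_add {x : SpacetimePt n} {U : ℝ → SpacetimePt n} (hU : LocBdd U) (a b c : ℝ) :
    M.velLength x U a b + M.velLength x U b c = M.velLength x U a c :=
  intervalIntegral.integral_add_adjacent_intervals ((locBdd_speed hU).intervalIntegrable _ _)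
    ((locBdd_speed hU).intervalIntegrable _ _)

theorem eventually_chron_of_isTransport {x : SpacetimePt n} {U : ℝ → SpacetimePt n}
    {P Q : ℝ → SpacetimePt n →L[ℝ] SpacetimePt n} (h : M.lor.IsTransport x U P Q) {T : ℝ}
    (hT : 0 < T) (hc : ∀ᵐ t, t ∈ Ioc 0 T → M.lor.IsFutureCausal (curveOf x U t) (U t))
    (hD : M.lor.metric x (∫ t in (0 : ℝ)..T, Q t (U t)) (∫ t in (0 : ℝ)..T, Q t (U t)) < 0) :
    ∀ᶠ y in 𝓝 (curveOf x U T), M.chron x y := by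
  filter_upwards [h.eventually_exists_timelike hT hc hD] with y hy
  obtain ⟨β, hβ, h0, hβT, hd⟩ := hy
  rw [← h0, ← hβT]
  refine chron_of_isPathOn hT ⟨hβ.locallyLipschitzOn, ?_⟩
  rw [ae_restrict_iff' measurableSet_Icc]
  filter_upwards [hd, Measure.ae_ne volume (0 : ℝ)] with t h1 h2 h3
  obtain ⟨u, hu, htl⟩ := h1 ⟨lt_of_le_of_ne h3.1 h2.symm, h3.2⟩
  exact ⟨hu.differentiableAt, by rw [hu.deriv]; exact htl⟩

/-- The causal dichotomy: either every point near the endpoint of a causal curve can be reached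
by a timelike curve, or the causal curve is null almost everywhere. -/
theorem eventually_chron_or_null {x : SpacetimePt n} {U : ℝ → SpacetimePt n} (hU : LocBdd U)
    (hU0 : ∀ t < 0, U t = 0) {T : ℝ} (hT : 0 < T)
    (hc : ∀ᵐ t, t ∈ Ioc 0 T → M.lor.IsFutureCausal (curveOf x U t) (U t)) :
    (∀ᶠ y in 𝓝 (curveOf x U T), M.chron x y) ∨
      ∀ᵐ t, t ∈ Ioo 0 T → M.lor.metric (curveOf x U t) (U t) (U t) = 0 := by
  obtain ⟨P, Q, h⟩ := M.lor.exists_isTransport x hU hU0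
  by_cases hD : M.lor.metric x (∫ t in (0 : ℝ)..T, Q t (U t)) (∫ t in (0 : ℝ)..T, Q t (U t)) < 0
  · exact Or.inl (eventually_chron_of_isTransport h hT hc hD)
  · right
    obtain ⟨m, hm, -, hdir⟩ := h.exists_null_direction hT hc hD
    filter_upwards [hdir] with t h1 ht
    have h2 := h.metric_eq t (Q t (U t)) (Q t (U t))
    rw [h.apply_inv] at h2
    rw [h2, h1 ht]
    simp [hm]

theorem false_of_ae_Ioo {a b : ℝ} (hab : a < b) (h : ∀ᵐ t : ℝ, t ∈ Ioo a b → False) : False := by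
  have h1 : volume (Ioo a b) = 0 := measure_eq_zero_iff_ae_notMem.2 h
  rw [Real.volume_Ioo] at h1
  simp at h1
  linarith

theorem chron.eventually {x y : SpacetimePt n} (h : M.chron x y) : ∀ᶠ y' in 𝓝 y, M.chron x y' := by
  obtain ⟨U, hU⟩ := chron_iff.1 h
  rcases eventually_chron_or_null hU.locBdd hU.zero zero_lt_one
    (hU.imp fun _ _ h => h.isFutureCausal).ae_mem with h1 | h1
  · rwa [hU.endpoint] at h1
  · refine (false_of_ae_Ioo zero_lt_one ?_).elim
    filter_upwards [h1, hU.ae_mem] with t h2 h3 ht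
    exact (h3 ⟨ht.1, ht.2.le⟩).1.ne (h2 ht)

theorem exists_concat_two {R : SpacetimePt n → SpacetimePt n → Prop} {x y z : SpacetimePt n}
    {U V : ℝ → SpacetimePt n} (hU : IsVelocity R x y U) (hV : IsVelocity R y z V) :
    ∃ W : ℝ → SpacetimePt n, LocBdd W ∧ (∀ t < 0, W t = 0) ∧
      (∀ t ∈ Ico (0 : ℝ) 1, W t = U t) ∧ (∀ t ∈ Ico (0 : ℝ) 1, W (1 + t) = V t) ∧
      (∀ t ∈ Icc (0 : ℝ) 1, curveOf x W t = curveOf x U t) ∧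
      (∀ t ∈ Icc (0 : ℝ) 1, curveOf x W (1 + t) = curveOf y V t) ∧
      ∀ᵐ t, t ∈ Ioc 0 2 → R (curveOf x W t) (W t) := by
  let p : ℕ → SpacetimePt n := fun k => if k = 0 then x else if k = 1 then y else z
  let S : ℕ → ℝ → SpacetimePt n := fun k => if k = 0 then U else if k = 1 then V else 0
  obtain ⟨W, hW, hW0, hW1, hW2⟩ := exists_concat (x := p) (W := S)
    (by
      intro k
      by_cases h0 : k = 0
      · simpa [S, h0] using hU.measurable
      by_cases h1 : k = 1
      · simpa [S, h1] using hV.measurable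
      · simp only [S, h0, h1, if_false]
        exact measurable_zero)
    (by
      intro k
      by_cases h0 : k = 0
      · simpa [S, h0] using hU.bounded
      by_cases h1 : k = 1
      · simpa [S, h1] using hV.bounded
      · exact ⟨0, by simp [S, h0, h1]⟩)
    (by
      intro k
      by_cases h0 : k = 0
      · simpa [S, p, h0] using hU.endpoint
      by_cases h1 : k = 1
      · simpa [S, p, h1] using hV.endpoint
      · simp [S, p, h0, h1, curveOf])
  have a1 : ∀ t ∈ Ico (0 : ℝ) 1, W t = U t := by simpa [S] using hW1 0
  have a2 : ∀ t ∈ Ico (0 : ℝ) 1, W (1 + t) = V t := by simpa [S] using hW1 1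
  have a3 : ∀ t ∈ Icc (0 : ℝ) 1, curveOf x W t = curveOf x U t := by simpa [S, p] using hW2 0
  have a4 : ∀ t ∈ Icc (0 : ℝ) 1, curveOf x W (1 + t) = curveOf y V t := by
    simpa [S, p] using hW2 1
  refine ⟨W, hW, hW0, a1, a2, a3, a4, ?_⟩
  have h1 : ∀ᵐ t : ℝ, t - 1 ∈ Ioc (0 : ℝ) 1 → R (curveOf y V (t - 1)) (V (t - 1)) :=
    (measurePreserving_sub_right volume (1 : ℝ)).quasiMeasurePreserving.ae hV.ae_mem
  filter_upwards [hU.ae_mem, h1, Measure.ae_ne volume (1 : ℝ), Measure.ae_ne volume (2 : ℝ)]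
    with t h2 h3 h4 h5 ht
  rcases lt_or_gt_of_ne h4 with h6 | h6
  · rw [a1 t ⟨ht.1.le, h6⟩, a3 t ⟨ht.1.le, h6.le⟩]
    exact h2 ⟨ht.1, h6.le⟩
  · have h7 : t < 2 := lt_of_le_of_ne ht.2 h5
    have b2 := a2 (t - 1) ⟨by linarith, by linarith⟩
    have b4 := a4 (t - 1) ⟨by linarith, by linarith⟩
    rw [add_sub_cancel] at b2 b4
    rw [b2, b4]
    exact h3 ⟨by linarith, by linarith⟩

theorem causalLe.trans {x y z : SpacetimePt n} (hxy : M.causalLe x y) (hyz : M.causalLe y z) :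
    M.causalLe x z := by
  rcases causalLe_iff.1 hxy with rfl | ⟨U, hU⟩
  · exact hyz
  rcases causalLe_iff.1 hyz with rfl | ⟨V, hV⟩
  · exact hxy
  obtain ⟨W, hW, -, -, -, -, h5, h6⟩ := exists_concat_two hU hV
  have h := causalLe_of_isPathOn (zero_le_two (α := ℝ)) (hW.isPathOn_curveOf (x := x)
    (R := M.lor.IsFutureCausal) measurableSet_Icc (by
      filter_upwards [h6, Measure.ae_ne volume (0 : ℝ)] with t h1 h2 h3
      exact h1 ⟨lt_of_le_of_ne h3.1 h2.symm, h3.2⟩))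
  have h7 := h5 1 (by simp)
  rw [hV.endpoint, one_add_one_eq_two] at h7
  rwa [curveOf_zero, h7] at h

theorem chron_of_concat {x y z : SpacetimePt n} {U V : ℝ → SpacetimePt n}
    (hU : IsVelocity M.lor.IsFutureCausal x y U) (hV : IsVelocity M.lor.IsFutureCausal y z V)
    (h : IsVelocity M.lor.IsFutureTimelike x y U ∨ IsVelocity M.lor.IsFutureTimelike y z V) :
    M.chron x z := by
  obtain ⟨W, hW, h0, h1, h2, h3, h4, h5⟩ := exists_concat_two hU hV
  have h7 := h4 1 (by simp)
  rw [hV.endpoint, one_add_one_eq_two] at h7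
  rcases eventually_chron_or_null hW h0 two_pos h5 with h6 | h6
  · rw [h7] at h6
    exact h6.self_of_nhds
  · rcases h with h | h
    · refine (false_of_ae_Ioo zero_lt_one ?_).elim
      filter_upwards [h6, h.ae_mem] with t h8 h9 ht
      have h10 := h8 ⟨ht.1, by linarith [ht.2]⟩
      rw [h1 t ⟨ht.1.le, ht.2⟩, h3 t ⟨ht.1.le, ht.2.le⟩] at h10
      exact (h9 ⟨ht.1, ht.2.le⟩).1.ne h10
    · refine (false_of_ae_Ioo zero_lt_one ?_).elim
      have h6' : ∀ᵐ t : ℝ, 1 + t ∈ Ioo (0 : ℝ) 2 →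
          M.lor.metric (curveOf x W (1 + t)) (W (1 + t)) (W (1 + t)) = 0 :=
        (measurePreserving_add_left volume (1 : ℝ)).quasiMeasurePreserving.ae h6
      filter_upwards [h6', h.ae_mem] with t h8 h9 ht
      have h10 := h8 ⟨by linarith [ht.1], by linarith [ht.2]⟩
      rw [h2 t ⟨ht.1.le, ht.2⟩, h4 t ⟨ht.1.le, ht.2.le⟩] at h10
      exact (h9 ⟨ht.1, ht.2.le⟩).1.ne h10

theorem chron.trans_causalLe {x y z : SpacetimePt n} (hxy : M.chron x y) (hyz : M.causalLe y z) :
    M.chron x z := by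
  obtain ⟨U, hU⟩ := chron_iff.1 hxy
  rcases causalLe_iff.1 hyz with rfl | ⟨V, hV⟩
  · exact hxy
  · exact chron_of_concat (hU.imp fun _ _ h => h.isFutureCausal) hV (Or.inl hU)

theorem velLength_eq_zero_or_chron {x : SpacetimePt n} {U : ℝ → SpacetimePt n} (hU : LocBdd U)
    (hU0 : ∀ t < 0, U t = 0) {T : ℝ} (hT : 0 < T)
    (hc : ∀ᵐ t, t ∈ Ioc 0 T → M.lor.IsFutureCausal (curveOf x U t) (U t)) :
    M.velLength x U 0 T = 0 ∨ M.chron x (curveOf x U T) := by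
  rcases eventually_chron_or_null hU hU0 hT hc with h | h
  · exact Or.inr h.self_of_nhds
  · left
    rw [velLength]
    refine (intervalIntegral.integral_congr_ae (g := fun _ => 0) ?_).trans (by simp)
    filter_upwards [h, Measure.ae_ne volume T] with t h1 h2 ht
    rw [uIoc_of_le hT.le] at ht
    rw [h1 ⟨ht.1, lt_of_le_of_ne ht.2 h2⟩]
    simp

theorem ldist_add_le {x y z : SpacetimePt n} (hxy : M.causalLe x y) (hyz : M.causalLe y z) :
    M.ldist x y + M.ldist y z ≤ M.ldist x z := by
  have hempty : ∀ a b : SpacetimePt n,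
      (¬ ∃ U, IsVelocity M.lor.IsFutureCausal a b U) → M.ldist a b = 0 := by
    intro a b h
    rw [ldist_eq]
    simp only [not_exists] at h
    simp [h]
  by_cases h1 : ∃ U, IsVelocity M.lor.IsFutureCausal x y U
  · by_cases h2 : ∃ U, IsVelocity M.lor.IsFutureCausal y z U
    · rw [ldist_eq x y, ldist_eq y z]
      refine ENNReal.biSup_add_biSup_le' h1 h2 fun U hU V hV => ?_
      obtain ⟨W, hW, -, a1, a2, a3, a4, h6⟩ := exists_concat_two hU hV
      have h := le_ldist two_pos (hW.isPathOn_curveOf (x := x)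
        (R := M.lor.IsFutureCausal) measurableSet_Icc (by
          filter_upwards [h6, Measure.ae_ne volume (0 : ℝ)] with t h1 h2 h3
          exact h1 ⟨lt_of_le_of_ne h3.1 h2.symm, h3.2⟩))
      have h7 := a4 1 (by simp)
      rw [hV.endpoint, one_add_one_eq_two] at h7
      rw [curveOf_zero, h7, gLength_curveOf hW, ← velLength_add hW 0 1 2,
        ENNReal.ofReal_add (velLength_nonneg _ _ zero_le_one)
          (velLength_nonneg _ _ one_le_two)] at h
      convert h using 3
      · refine intervalIntegral.integral_congr_ae ?_
        filter_upwards [Measure.ae_ne volume (1 : ℝ)] with t ht hmem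
        rw [uIoc_of_le zero_le_one] at hmem
        rw [a1 t ⟨hmem.1.le, lt_of_le_of_ne hmem.2 ht⟩, a3 t ⟨hmem.1.le, hmem.2⟩]
      · have h8 := intervalIntegral.integral_comp_add_left (a := 0) (b := 1)
          (f := fun t => Real.sqrt (-M.lor.metric (curveOf x W t) (W t) (W t))) 1
        rw [add_zero, one_add_one_eq_two] at h8
        rw [velLength, velLength, ← h8]
        refine intervalIntegral.integral_congr_ae ?_
        filter_upwards [Measure.ae_ne volume (1 : ℝ)] with t ht hmem
        rw [uIoc_of_le zero_le_one] at hmem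
        rw [a2 t ⟨hmem.1.le, lt_of_le_of_ne hmem.2 ht⟩, a4 t ⟨hmem.1.le, hmem.2⟩]
    · rcases causalLe_iff.1 hyz with rfl | h3
      · rw [hempty y y h2, add_zero]
      · exact absurd h3 h2
  · rcases causalLe_iff.1 hxy with rfl | h3
    · rw [hempty x x h1, zero_add]
    · exact absurd h3 h1

theorem ldist_mono_right {x y z : SpacetimePt n} (hxy : M.causalLe x y) (hyz : M.causalLe y z) :
    M.ldist x y ≤ M.ldist x z := le_self_add.trans (ldist_add_le hxy hyz)

end C1Spacetime

/-! ### Time reversal -/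

theorem IsPathOn.comp_neg {E : Type*} [NormedAddCommGroup E] [NormedSpace ℝ E]
    {R : E → E → Prop} {γ : ℝ → E} {I : Set ℝ} (h : IsPathOn R γ I) :
    IsPathOn (fun x u => R x (-u)) (fun t => γ (-t)) (Neg.neg ⁻¹' I) := by
  constructor
  · intro t ht
    obtain ⟨K, W, hW, hK⟩ := h.1 (show -t ∈ I from ht)
    refine ⟨K, Neg.neg ⁻¹' W, ?_, fun a ha b hb => ?_⟩
    · have h1 : Tendsto (Neg.neg : ℝ → ℝ) (𝓝[Neg.neg ⁻¹' I] t) (𝓝[I] (-t)) :=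
        tendsto_nhdsWithin_iff.2 ⟨(continuous_neg.tendsto t).mono_left nhdsWithin_le_nhds,
          eventually_mem_nhdsWithin⟩
      exact h1 hW
    · refine (hK ha hb).trans (le_of_eq ?_)
      rw [edist_neg_neg]
  · have h1 : MeasurePreserving (Neg.neg : ℝ → ℝ) (volume.restrict (Neg.neg ⁻¹' I))
        (volume.restrict I) :=
      (Measure.measurePreserving_neg (volume : Measure ℝ)).restrict_preimage_emb
        (MeasurableEquiv.neg ℝ).measurableEmbedding I
    filter_upwards [h1.quasiMeasurePreserving.ae h.2] with t ht
    refine ⟨ht.1.comp t differentiable_neg.differentiableAt, ?_⟩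
    rw [deriv_comp_neg, neg_neg]
    exact ht.2

namespace C1Spacetime

variable {n : ℕ} (M : C1Spacetime n)

/-- The spacetime with the opposite time orientation. -/
def rev : C1Spacetime n where
  g := M.g
  g_contDiff := M.g_contDiff
  g_symm := M.g_symm
  g_lorentz := M.g_lorentz
  X0 p := -M.X0 p
  X0_cont := M.X0_cont.neg
  X0_timelike p := by
    have h : M.lor.metric p (-M.X0 p) (-M.X0 p) < 0 := by
      rw [map_neg, map_neg, neg_apply, neg_neg, lor_metric_apply]
      exact M.X0_timelike p
    rwa [lor_metric_apply] at h

theorem rev_rev : M.rev.rev = M := by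
  simp [rev]

theorem rev_isFutureCausal {p u : SpacetimePt n} :
    M.rev.lor.IsFutureCausal p u ↔ M.lor.IsFutureCausal p (-u) := by
  change M.lor.metric p u u ≤ 0 ∧ M.lor.metric p u (-M.X0 p) < 0 ↔
    M.lor.metric p (-u) (-u) ≤ 0 ∧ M.lor.metric p (-u) (M.X0 p) < 0
  simp only [map_neg, neg_apply, neg_neg]

theorem rev_isFutureTimelike {p u : SpacetimePt n} :
    M.rev.lor.IsFutureTimelike p u ↔ M.lor.IsFutureTimelike p (-u) := by
  change M.lor.metric p u u < 0 ∧ M.lor.metric p u (-M.X0 p) < 0 ↔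
    M.lor.metric p (-u) (-u) < 0 ∧ M.lor.metric p (-u) (M.X0 p) < 0
  simp only [map_neg, neg_apply, neg_neg]

variable {M}

theorem isPathOn_rev_causal {γ : ℝ → SpacetimePt n} {I : Set ℝ}
    (h : IsPathOn M.lor.IsFutureCausal γ I) :
    IsPathOn M.rev.lor.IsFutureCausal (fun t => γ (-t)) (Neg.neg ⁻¹' I) := by
  have h1 := h.comp_neg
  simp only [← rev_isFutureCausal] at h1
  exact h1

theorem isPathOn_rev_timelike {γ : ℝ → SpacetimePt n} {I : Set ℝ}
    (h : IsPathOn M.lor.IsFutureTimelike γ I) :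
    IsPathOn M.rev.lor.IsFutureTimelike (fun t => γ (-t)) (Neg.neg ⁻¹' I) := by
  have h1 := h.comp_neg
  simp only [← rev_isFutureTimelike] at h1
  exact h1

theorem chron.rev {x y : SpacetimePt n} (h : M.chron x y) : M.rev.chron y x := by
  obtain ⟨γ, a, b, hab, h, rfl, rfl⟩ := h
  have h1 := isPathOn_rev_timelike (M.isFdTimelikePathOn_iff.1 h).2.2
  have h2 : Neg.neg ⁻¹' Icc a b = Icc (-b) (-a) := by simp
  rw [h2] at h1
  simpa using chron_of_isPathOn (neg_lt_neg hab) h1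

theorem chron_rev {x y : SpacetimePt n} : M.rev.chron x y ↔ M.chron y x :=
  ⟨fun h => by simpa only [rev_rev] using h.rev, chron.rev⟩

theorem causalLe.rev {x y : SpacetimePt n} (h : M.causalLe x y) : M.rev.causalLe y x := by
  rcases h with rfl | ⟨γ, a, b, hab, h, rfl, rfl⟩
  · exact Or.inl rfl
  have h1 := isPathOn_rev_causal (M.isFdCausalPathOn_iff.1 h).2.2
  have h2 : Neg.neg ⁻¹' Icc a b = Icc (-b) (-a) := by simp
  rw [h2] at h1
  simpa using causalLe_of_isPathOn (neg_lt_neg hab).le h1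

theorem causalLe_rev {x y : SpacetimePt n} : M.rev.causalLe x y ↔ M.causalLe y x :=
  ⟨fun h => by simpa only [rev_rev] using h.rev, causalLe.rev⟩

theorem ldist_le_rev (x y : SpacetimePt n) : M.ldist x y ≤ M.rev.ldist y x := by
  refine iSup_le fun γ => iSup_le fun a => iSup_le fun b => iSup_le fun hab => iSup_le fun h =>
    iSup_le fun ha => iSup_le fun hb => ?_
  subst ha hb
  have h1 := isPathOn_rev_causal (M.isFdCausalPathOn_iff.1 h).2.2
  have h2 : Neg.neg ⁻¹' Icc a b = Icc (-b) (-a) := by simp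
  rw [h2] at h1
  have h3 := le_ldist (neg_lt_neg hab) h1
  simp only [neg_neg] at h3
  refine le_trans (le_of_eq ?_) h3
  congr 1
  have h4 := intervalIntegral.integral_comp_neg (a := -b) (b := -a)
    (fun t => Real.sqrt (-M.lor.metric (γ t) (deriv γ t) (deriv γ t)))
  rw [neg_neg, neg_neg] at h4
  simp only [gLength, ← lor_metric_apply, deriv_comp_neg, map_neg, neg_apply, neg_neg]
  rw [← h4]
  rfl

theorem ldist_rev (x y : SpacetimePt n) : M.rev.ldist x y = M.ldist y x :=
  le_antisymm (by simpa only [rev_rev] using M.rev.ldist_le_rev x y) (M.ldist_le_rev y x)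

theorem isFdCausalPathOn_comp_neg {γ : ℝ → SpacetimePt n} {I J : Set ℝ}
    (h : M.IsFdCausalPathOn γ I) (hJ : Neg.neg ⁻¹' I = J) :
    M.rev.IsFdCausalPathOn (fun t => γ (-t)) J := by
  rw [isFdCausalPathOn_iff] at h ⊢
  obtain ⟨h1, ⟨t, ht⟩, h3⟩ := h
  subst hJ
  exact ⟨h1.preimage_anti fun _ _ h => neg_le_neg h, ⟨-t, by simpa using ht⟩,
    isPathOn_rev_causal h3⟩

theorem NonImprisoning.rev (h : M.NonImprisoning) : M.rev.NonImprisoning := by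
  have key : ∀ {l l' : Filter ℝ} {γ : ℝ → SpacetimePt n}, Tendsto (Neg.neg : ℝ → ℝ) l l' →
      (¬ ∃ q, Tendsto γ l (𝓝 q)) → ¬ ∃ q, Tendsto (fun t => γ (-t)) l' (𝓝 q) := by
    rintro l l' γ hl hq ⟨q, hq'⟩
    refine hq ⟨q, ?_⟩
    simpa [Function.comp_def] using hq'.comp hl
  have back : ∀ {γ : ℝ → SpacetimePt n} {I J : Set ℝ}, M.rev.IsFdCausalPathOn γ I →
      Neg.neg ⁻¹' I = J → M.IsFdCausalPathOn (fun t => γ (-t)) J := fun h1 h2 => by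
    simpa only [rev_rev] using isFdCausalPathOn_comp_neg h1 h2
  intro K hK
  obtain ⟨h1, h2, h3, h4⟩ := h K hK
  refine ⟨fun a b γ hγ hq hm => ?_, fun a γ hγ hq hm => ?_, fun a b γ hγ hq hm => ?_,
    fun b γ hγ hq hm => ?_⟩
  · exact h3 (-b) (-a) _ (back hγ (by simp)) (key (by simpa using tendsto_neg_nhdsLT (a := b)) hq)
      fun t ht => hm _ ⟨by linarith [ht.2], by linarith [ht.1]⟩
  · exact h4 (-a) _ (back hγ (by simp)) (key tendsto_neg_atTop_atBot hq)
      fun t ht => hm _ (by simp only [mem_Iic, mem_Ici] at *; linarith)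
  · exact h1 (-b) (-a) _ (back hγ (by simp)) (key (by simpa using tendsto_neg_nhdsGT (a := a)) hq)
      fun t ht => hm _ ⟨by linarith [ht.2], by linarith [ht.1]⟩
  · exact h2 (-b) _ (back hγ (by simp)) (key tendsto_neg_atBot_atTop hq)
      fun t ht => hm _ (by simp only [mem_Iic, mem_Ici] at *; linarith)

theorem GloballyHyperbolic.rev (h : M.GloballyHyperbolic) : M.rev.GloballyHyperbolic := by
  refine ⟨h.1.rev, fun p q => ?_⟩
  have := h.2 q p
  simp only [causalLe_rev]
  simpa only [and_comm] using this

theorem isPdCausalGeodesicOn_iff {γ : ℝ → SpacetimePt n} {I : Set ℝ} :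
    M.IsPdCausalGeodesicOn γ I ↔ M.rev.IsFdCausalGeodesicOn γ I := by
  have h : ∀ p v, M.PdVec p v ↔ M.rev.FdVec p v := by
    intro p v
    have h1 : M.rev.lor.metric p v (M.rev.X0 p) = -M.lor.metric p v (M.X0 p) := map_neg _ _
    rw [PdVec, FdVec, ← lor_metric_apply, ← lor_metric_apply, h1, neg_lt_zero]
  simp only [IsPdCausalGeodesicOn, IsFdCausalGeodesicOn, h]
  rfl

/-! ### Closedness of the causal relation -/

theorem chron.eventually_left {x y : SpacetimePt n} (h : M.chron x y) :
    ∀ᶠ x' in 𝓝 x, M.chron x' y := by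
  filter_upwards [h.rev.eventually] with x' hx using chron_rev.1 hx

theorem causalLe.refl (x : SpacetimePt n) : M.causalLe x x := Or.inl rfl

theorem eventually_chron_add (z : SpacetimePt n) :
    ∀ᶠ ε in 𝓝[>] (0 : ℝ), M.chron z (z + ε • M.X0 z) := by
  have h0 : M.lor.IsFutureTimelike z (M.X0 z) := by
    constructor <;> rw [lor_metric_apply] <;> exact M.X0_timelike z
  have hc1 : Continuous fun t : ℝ => M.lor.metric (z + t • M.X0 z) (M.X0 z) (M.X0 z) :=
    M.lor.continuous_metric_apply (by fun_prop) continuous_const continuous_const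
  have hc2 : Continuous fun t : ℝ =>
      M.lor.metric (z + t • M.X0 z) (M.X0 z) (M.X0 (z + t • M.X0 z)) :=
    M.lor.continuous_metric_apply (by fun_prop) continuous_const
      (M.X0_cont.comp (by fun_prop))
  have h1 : ∀ᶠ t : ℝ in 𝓝 0, M.lor.IsFutureTimelike (z + t • M.X0 z) (M.X0 z) := by
    refine (hc1.continuousAt.eventually_lt_const ?_).and (hc2.continuousAt.eventually_lt_const ?_)
    · simpa using h0.1
    · simp only [zero_smul, add_zero]
      exact h0.2
  obtain ⟨δ, hδ, h2⟩ := Metric.eventually_nhds_iff.1 h1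
  filter_upwards [Ioo_mem_nhdsGT hδ] with ε hε
  have hd : ∀ t : ℝ, HasDerivAt (fun t : ℝ => z + t • M.X0 z) (M.X0 z) t := fun t => by
    simpa using ((hasDerivAt_id t).smul_const (M.X0 z)).const_add z
  have hL : LocallyLipschitz fun t : ℝ => z + t • M.X0 z := by
    have : ContDiff ℝ 1 fun t : ℝ => z + t • M.X0 z := by fun_prop
    exact this.locallyLipschitz
  have h3 : IsPathOn M.lor.IsFutureTimelike (fun t : ℝ => z + t • M.X0 z) (Icc 0 ε) := by
    refine ⟨hL.locallyLipschitzOn, ?_⟩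
    rw [ae_restrict_iff' measurableSet_Icc]
    refine Eventually.of_forall fun t ht => ⟨(hd t).differentiableAt, ?_⟩
    rw [(hd t).deriv]
    refine h2 ?_
    rw [Real.dist_eq, sub_zero, abs_of_nonneg ht.1]
    exact ht.2.trans_lt hε.2
  simpa using chron_of_isPathOn hε.1 h3

theorem eventually_chron_sub (z : SpacetimePt n) :
    ∀ᶠ ε in 𝓝[>] (0 : ℝ), M.chron (z - ε • M.X0 z) z := by
  filter_upwards [M.rev.eventually_chron_add z] with ε hε
  rw [chron_rev] at hε
  convert hε using 1
  simp [rev, sub_eq_add_neg]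

theorem frequently_chron_right (z : SpacetimePt n) : ∃ᶠ z' in 𝓝 z, M.chron z z' := by
  have h : Tendsto (fun ε : ℝ => z + ε • M.X0 z) (𝓝[>] 0) (𝓝 z) := by
    have : Continuous fun ε : ℝ => z + ε • M.X0 z := by fun_prop
    simpa using (this.tendsto 0).mono_left (nhdsWithin_le_nhds (s := Ioi 0))
  exact h.frequently (M.eventually_chron_add z).frequently

theorem frequently_chron_left (z : SpacetimePt n) : ∃ᶠ z' in 𝓝 z, M.chron z' z := by
  have h : Tendsto (fun ε : ℝ => z - ε • M.X0 z) (𝓝[>] 0) (𝓝 z) := by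
    have : Continuous fun ε : ℝ => z - ε • M.X0 z := by fun_prop
    simpa using (this.tendsto 0).mono_left (nhdsWithin_le_nhds (s := Ioi 0))
  exact h.frequently (M.eventually_chron_sub z).frequently

theorem GloballyHyperbolic.isClosed_future (h : M.GloballyHyperbolic) (p : SpacetimePt n) :
    IsClosed {z | M.causalLe p z} := by
  refine isClosed_iff_frequently.2 fun z hz => ?_
  obtain ⟨z', hz'⟩ := (M.frequently_chron_right z).exists
  refine ((h.2 p z').isClosed.mem_of_frequently_of_tendsto (f := id) (b := 𝓝 z) ?_ tendsto_id).1
  exact (hz.and_eventually hz'.eventually_left).mono fun y hy => ⟨hy.1, hy.2.causalLe⟩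

theorem GloballyHyperbolic.isClosed_past (h : M.GloballyHyperbolic) (p : SpacetimePt n) :
    IsClosed {z | M.causalLe z p} := by
  simpa only [causalLe_rev] using h.rev.isClosed_future p

/-- The causal relation is closed. -/
theorem GloballyHyperbolic.causalLe_of_tendsto (h : M.GloballyHyperbolic)
    {l : Filter ℕ} [l.NeBot] {x y : ℕ → SpacetimePt n} {a b : SpacetimePt n}
    (hx : Tendsto x l (𝓝 a)) (hy : Tendsto y l (𝓝 b)) (hxy : ∀ᶠ m in l, M.causalLe (x m) (y m)) :
    M.causalLe a b := by
  change a ∈ {z | M.causalLe z b}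
  refine (h.isClosed_past b).mem_of_frequently_of_tendsto (f := id) (b := 𝓝 a) ?_ tendsto_id
  refine (M.frequently_chron_left a).mono fun w hw => ?_
  change b ∈ {z | M.causalLe w z}
  refine (h.isClosed_future w).mem_of_tendsto hy ?_
  filter_upwards [hxy, hx.eventually hw.eventually] with m h1 h2
  exact (h2.trans_causalLe h1).causalLe

end C1Spacetime

/-! ### One-sided completeness conditions -/

namespace C1Spacetime

variable {n : ℕ} (M : C1Spacetime n)

/-- The future half of finite compactness. -/
def FutureFinitelyCompact : Prop :=
  ∀ B : ℝ, 0 < B → ∀ p q : SpacetimePt n, ∀ x : ℕ → SpacetimePt n,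
    (∀ m, M.chron p q ∧ M.causalLe q (x m) ∧ M.ldist p (x m) ≤ ENNReal.ofReal B) →
      ∃ z : SpacetimePt n, MapClusterPt z atTop x

/-- The future half of timelike Cauchy completeness. -/
def FutureCauchyComplete : Prop :=
  ∀ (x : ℕ → SpacetimePt n) (B : ℕ → ℝ), (∀ m, 0 ≤ B m) → Tendsto B atTop (𝓝 0) →
    (∀ m, M.chron (x m) (x (m + 1))) →
    (∀ k m : ℕ, 0 < m → M.ldist (x k) (x (k + m)) ≤ ENNReal.ofReal (B k)) →
    ∃ l : SpacetimePt n, Tendsto x atTop (𝓝 l)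

/-- The future half of Condition A. -/
def FutureConditionA : Prop :=
  ∀ x y : SpacetimePt n, M.chron x y →
    (∀ c : ℝ, 0 < c → ∀ γ : ℝ → SpacetimePt n, M.IsFdCausalGeodesicOn γ (Ico 0 c) →
      γ 0 = y → (¬ ∃ z, Tendsto γ (𝓝[<] c) (𝓝 z)) →
      Tendsto (fun t => M.ldist x (γ t)) (𝓝[<] c) (𝓝 ⊤)) ∧
    (∀ γ : ℝ → SpacetimePt n, M.IsFdCausalGeodesicOn γ (Ici 0) →
      γ 0 = y → (¬ ∃ z, Tendsto γ atTop (𝓝 z)) →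
      Tendsto (fun t => M.ldist x (γ t)) atTop (𝓝 ⊤))

variable {M}

theorem finitelyCompact_iff :
    M.FinitelyCompact ↔ M.FutureFinitelyCompact ∧ M.rev.FutureFinitelyCompact := by
  simp only [FutureFinitelyCompact, chron_rev, causalLe_rev, ldist_rev]
  constructor
  · intro h
    refine ⟨fun B hB p q x => (h B hB p q x).1, fun B hB p q x hx => (h B hB p q x).2 fun m => ?_⟩
    exact ⟨(hx m).2.1, (hx m).1, (hx m).2.2⟩
  · rintro ⟨h1, h2⟩ B hB p q x
    exact ⟨h1 B hB p q x, fun hx => h2 B hB p q x fun m => ⟨(hx m).2.1, (hx m).1, (hx m).2.2⟩⟩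

theorem timelikeCauchyComplete_iff :
    M.TimelikeCauchyComplete ↔ M.FutureCauchyComplete ∧ M.rev.FutureCauchyComplete := by
  simp only [FutureCauchyComplete, chron_rev, ldist_rev]
  constructor
  · intro h
    exact ⟨fun x B h1 h2 h3 h4 => h x B h1 h2 (Or.inl ⟨h3, h4⟩),
      fun x B h1 h2 h3 h4 => h x B h1 h2 (Or.inr ⟨h3, h4⟩)⟩
  · rintro ⟨h1, h2⟩ x B h3 h4 (⟨h5, h6⟩ | ⟨h5, h6⟩)
    · exact h1 x B h3 h4 h5 h6
    · exact h2 x B h3 h4 h5 h6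

theorem conditionA_iff : M.ConditionA ↔ M.FutureConditionA ∧ M.rev.FutureConditionA := by
  simp only [FutureConditionA, chron_rev, ldist_rev, ← isPdCausalGeodesicOn_iff]
  rfl

theorem isPathOn_causalLe {γ : ℝ → SpacetimePt n} {I : Set ℝ} (hI : I.OrdConnected)
    (h : IsPathOn M.lor.IsFutureCausal γ I) {s t : ℝ} (hs : s ∈ I) (ht : t ∈ I) (hst : s ≤ t) :
    M.causalLe (γ s) (γ t) :=
  causalLe_of_isPathOn hst (h.mono (hI.out hs ht))

/-- Infinitely many causal curves can be concatenated. -/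
theorem exists_causal_curve_of_chain {x : ℕ → SpacetimePt n}
    (hx : ∀ k, ∃ U, IsVelocity M.lor.IsFutureCausal (x k) (x (k + 1)) U) :
    ∃ U : ℝ → SpacetimePt n, LocBdd U ∧ (∀ t < 0, U t = 0) ∧
      (∀ k : ℕ, curveOf (x 0) U k = x k) ∧
      ∀ᵐ t, t ∈ Ioi 0 → M.lor.IsFutureCausal (curveOf (x 0) U t) (U t) := by
  choose W hW using hx
  obtain ⟨U, hU, hU0, h1, h2⟩ := exists_concat (fun k => (hW k).measurable)
    (fun k => (hW k).bounded) (fun k => (hW k).endpoint)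
  refine ⟨U, hU, hU0, fun k => ?_, ?_⟩
  · have h3 := h2 k 0 (by simp)
    rwa [add_zero, curveOf_zero] at h3
  · have h3 : ∀ᵐ t : ℝ, ∀ k : ℕ, t ≠ k ∧ (t - k ∈ Ioc (0 : ℝ) 1 →
        M.lor.IsFutureCausal (curveOf (x k) (W k) (t - k)) (W k (t - k))) := by
      rw [ae_all_iff]
      exact fun k => (Measure.ae_ne volume (k : ℝ)).and
        ((measurePreserving_sub_right volume (k : ℝ)).quasiMeasurePreserving.ae (hW k).ae_mem)
    filter_upwards [h3] with t h4 ht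
    have h5 : (⌊t⌋₊ : ℝ) ≤ t := Nat.floor_le (le_of_lt ht)
    have h6 : t < ⌊t⌋₊ + 1 := Nat.lt_floor_add_one t
    have h7 : (⌊t⌋₊ : ℝ) < t := lt_of_le_of_ne h5 (h4 _).1.symm
    have h8 := h1 ⌊t⌋₊ (t - ⌊t⌋₊) ⟨by linarith, by linarith⟩
    have h9 := h2 ⌊t⌋₊ (t - ⌊t⌋₊) ⟨by linarith, by linarith⟩
    rw [add_sub_cancel] at h8 h9
    rw [h8, h9]
    exact (h4 _).2 ⟨by linarith, by linarith⟩

theorem LocBdd.isPathOn_Ici {x : SpacetimePt n} {U : ℝ → SpacetimePt n} (hU : LocBdd U)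
    (h : ∀ᵐ t, t ∈ Ioi 0 → M.lor.IsFutureCausal (curveOf x U t) (U t)) :
    IsPathOn M.lor.IsFutureCausal (curveOf x U) (Ici 0) := by
  refine hU.isPathOn_curveOf measurableSet_Ici ?_
  filter_upwards [h, Measure.ae_ne volume (0 : ℝ)] with t h1 h2 h3
  exact h1 (lt_of_le_of_ne h3 h2.symm)

theorem FutureFinitelyCompact.futureCauchyComplete (hGH : M.GloballyHyperbolic)
    (h : M.FutureFinitelyCompact) : M.FutureCauchyComplete := by
  intro x B hB _ hx hd
  have hle : ∀ k m, k ≤ m → M.causalLe (x k) (x m) := by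
    intro k m hkm
    induction m, hkm using Nat.le_induction with
    | base => exact causalLe.refl _
    | succ m _ ih => exact ih.trans (hx m).causalLe
  have hcl : ∃ z, MapClusterPt z atTop fun m => x (1 + m) := by
    refine h (B 0 + 1) (by linarith [hB 0]) (x 0) (x 1) _ fun m => ⟨hx 0, hle _ _ (by lia), ?_⟩
    have h1 := hd 0 (1 + m) (by lia)
    rw [zero_add] at h1
    exact h1.trans (ENNReal.ofReal_le_ofReal (by linarith))
  obtain ⟨z, hz⟩ := hcl
  obtain ⟨z', hz'⟩ := (M.frequently_chron_right z).exists
  have hbd : ∀ m, M.causalLe (x m) z' := by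
    intro m
    have h1 := (mapClusterPt_iff_frequently.1 hz) _ hz'.eventually_left
    obtain ⟨j, h2, h3⟩ := (h1.and_eventually (eventually_ge_atTop m)).exists
    exact (hle m (1 + j) (by lia)).trans (chron.causalLe h2)
  obtain ⟨U, hU, -, hk, hc⟩ := exists_causal_curve_of_chain (M := M) (x := x) fun k =>
    (chron_iff.1 (hx k)).imp fun U hU => hU.imp fun _ _ h => h.isFutureCausal
  have hpath := LocBdd.isPathOn_Ici hU hc
  by_contra hlim
  refine (hGH.1 _ (hGH.2 (x 0) z')).2.1 0 (curveOf (x 0) U)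
    (M.isFdCausalPathOn_iff.2 ⟨ordConnected_Ici, nonempty_Ici, hpath⟩) ?_ fun t ht => ⟨?_, ?_⟩
  · rintro ⟨q, hq⟩
    refine hlim ⟨q, ?_⟩
    have h1 := hq.comp tendsto_natCast_atTop_atTop
    refine h1.congr fun k => ?_
    simp [hk]
  · have h1 := isPathOn_causalLe ordConnected_Ici hpath self_mem_Ici ht ht
    rwa [curveOf_zero] at h1
  · have h1 := isPathOn_causalLe ordConnected_Ici hpath ht
      (mem_Ici.2 (Nat.cast_nonneg ⌈t⌉₊)) (Nat.le_ceil t)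
    rw [hk] at h1
    exact h1.trans (hbd _)

theorem IsFdCausalGeodesicOn.isPathOn {γ : ℝ → SpacetimePt n} {I : Set ℝ} (hI : Convex ℝ I)
    (hI0 : ∀ t ∈ I, t ≠ 0 → I ∈ 𝓝 t) (hm : MeasurableSet I) (h : M.IsFdCausalGeodesicOn γ I) :
    IsPathOn M.lor.IsFutureCausal γ I := by
  constructor
  · intro t ht
    obtain ⟨K, W, hW, hK⟩ := ((h.1.1 t ht).of_le one_le_two).exists_lipschitzOnWith hI
    exact ⟨K, W, hW, hK⟩
  · rw [ae_restrict_iff' hm]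
    filter_upwards [Measure.ae_ne volume (0 : ℝ)] with t h1 ht
    have h2 := hI0 t ht h1
    have h3 := h.2 t ht
    rw [← isFutureCausal_iff, derivWithin_of_mem_nhds h2] at h3
    exact ⟨((h.1.1 t ht).contDiffAt h2).differentiableAt two_ne_zero, h3⟩

theorem FutureFinitelyCompact.exists_bound (h : M.FutureFinitelyCompact) {x : SpacetimePt n}
    {γ : ℝ → SpacetimePt n} {I : Set ℝ} {l : Filter ℝ} (hI : I.OrdConnected) (h0 : 0 ∈ I)
    (hIn : ∀ t ∈ I, 0 ≤ t) (hγ : IsPathOn M.lor.IsFutureCausal γ I) (hx : M.chron x (γ 0))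
    (hl : ∀ s ∈ I, ∀ᶠ t in l, t ∈ I ∧ s ≤ t)
    (hT : ¬ Tendsto (fun t => M.ldist x (γ t)) l (𝓝 ⊤)) :
    ∃ R, ∀ t ∈ I, γ t ∈ Metric.closedBall 0 R := by
  rw [ENNReal.tendsto_nhds_top_iff_nnreal] at hT
  push Not at hT
  obtain ⟨B, hB⟩ := hT
  have hbd : ∀ s ∈ I, M.ldist x (γ s) ≤ B := by
    intro s hs
    obtain ⟨t, h1, h2, h3⟩ := (hB.and_eventually (hl s hs)).exists
    refine (ldist_mono_right ?_ (isPathOn_causalLe hI hγ hs h2 h3)).trans h1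
    exact hx.causalLe.trans (isPathOn_causalLe hI hγ h0 hs (hIn s hs))
  by_contra hR
  push Not at hR
  choose t ht hR using fun m : ℕ => hR m
  obtain ⟨z, hz⟩ := h (B + 1) (by positivity) x (γ 0) (fun m => γ (t m)) fun m =>
    ⟨hx, isPathOn_causalLe hI hγ h0 (ht m) (hIn _ (ht m)), (hbd _ (ht m)).trans (by
      rw [← ENNReal.ofReal_coe_nnreal]
      exact ENNReal.ofReal_le_ofReal (by linarith))⟩
  have h1 := (mapClusterPt_iff_frequently.1 hz) _ (Metric.ball_mem_nhds z one_pos)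
  obtain ⟨k, hk⟩ := exists_nat_gt (‖z‖ + 1)
  obtain ⟨m, h2, h3⟩ := (h1.and_eventually (eventually_ge_atTop k)).exists
  have h4 := hR m
  rw [Metric.mem_closedBall, dist_zero_right, not_le] at h4
  rw [Metric.mem_ball, dist_eq_norm] at h2
  have h5 : ‖γ (t m)‖ ≤ ‖γ (t m) - z‖ + ‖z‖ := norm_le_norm_sub_add _ _
  have h6 : (k : ℝ) ≤ m := by exact_mod_cast h3
  linarith

theorem FutureFinitelyCompact.futureConditionA (hGH : M.GloballyHyperbolic)
    (h : M.FutureFinitelyCompact) : M.FutureConditionA := by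
  intro x y hxy
  refine ⟨fun c hc γ hγ hy hz => ?_, fun γ hγ hy hz => ?_⟩
  · by_contra hT
    subst hy
    have hpath := hγ.isPathOn (convex_Ico 0 c)
      (fun t ht h0 => Ico_mem_nhds (lt_of_le_of_ne ht.1 h0.symm) ht.2) measurableSet_Ico
    obtain ⟨R, hR⟩ := h.exists_bound ordConnected_Ico ⟨le_rfl, hc⟩ (fun t ht => ht.1) hpath hxy
      (fun s hs => by
        filter_upwards [Ioo_mem_nhdsLT hs.2] with t ht
        exact ⟨⟨hs.1.trans ht.1.le, ht.2⟩, ht.1.le⟩) hT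
    exact (hGH.1 _ (isCompact_closedBall 0 R)).1 0 c γ
      (M.isFdCausalPathOn_iff.2 ⟨ordConnected_Ico, nonempty_Ico.2 hc, hpath⟩) hz hR
  · by_contra hT
    subst hy
    have hpath := hγ.isPathOn (convex_Ici 0)
      (fun t ht h0 => Ici_mem_nhds (lt_of_le_of_ne ht h0.symm)) measurableSet_Ici
    obtain ⟨R, hR⟩ := h.exists_bound ordConnected_Ici self_mem_Ici (fun t ht => ht) hpath hxy
      (fun s hs => by
        filter_upwards [eventually_ge_atTop s] with t ht
        exact ⟨le_trans hs ht, ht⟩) hT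
    exact (hGH.1 _ (isCompact_closedBall 0 R)).2.1 0 γ
      (M.isFdCausalPathOn_iff.2 ⟨ordConnected_Ici, nonempty_Ici, hpath⟩) hz hR

/-! ### The limit set of past cones of an unbounded sequence -/

/-- Points all of whose chronological predecessors lie in the causal past of infinitely many
members of the sequence. -/
def pastLimit (M : C1Spacetime n) (x : ℕ → SpacetimePt n) : Set (SpacetimePt n) :=
  {u | ∀ w, M.chron w u → ∃ᶠ m in atTop, M.causalLe w (x m)}

variable {x : ℕ → SpacetimePt n}

theorem isClosed_pastLimit : IsClosed (M.pastLimit x) := by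
  refine isClosed_iff_frequently.2 fun u hu w hw => ?_
  obtain ⟨u', h1, h2⟩ := (hu.and_eventually hw.eventually).exists
  exact h1 w h2

theorem causalLe.mem_pastLimit {u v : SpacetimePt n} (huv : M.causalLe u v)
    (hv : v ∈ M.pastLimit x) : u ∈ M.pastLimit x :=
  fun w hw => hv w (hw.trans_causalLe huv)

theorem chron.pastLimit_mem_nhds {u v : SpacetimePt n} (huv : M.chron u v)
    (hv : v ∈ M.pastLimit x) : M.pastLimit x ∈ 𝓝 u := by
  filter_upwards [huv.eventually_left] with w hw using hw.causalLe.mem_pastLimit hv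

theorem mem_pastLimit_of_le {q : SpacetimePt n} (hq : ∀ m, M.causalLe q (x m)) :
    q ∈ M.pastLimit x :=
  fun _ hw => Frequently.of_forall fun m => hw.causalLe.trans (hq m)

theorem chron_or_gLength_eq_zero {γ : ℝ → SpacetimePt n} {a b : ℝ} (hab : a < b)
    (h : IsPathOn M.lor.IsFutureCausal γ (Icc a b)) :
    M.chron (γ a) (γ b) ∨ M.gLength γ a b = 0 := by
  obtain ⟨U, hU, hc, hd⟩ := h.exists_isVelocity (fun _ _ _ hr h => h.smul hr) hab
  rcases velLength_eq_zero_or_chron hU.locBdd hU.zero zero_lt_one hU.ae_mem with h1 | h1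
  · exact Or.inr ((velLength_of_rescale hab hc hd).trans h1)
  · rw [hU.endpoint] at h1
    exact Or.inl h1

theorem ldist_le_of_mem_pastLimit {B : ℝ} (hB : 0 ≤ B) {p u : SpacetimePt n}
    (hx : ∀ m, M.ldist p (x m) ≤ ENNReal.ofReal B) (hu : u ∈ M.pastLimit x) :
    M.ldist p u ≤ ENNReal.ofReal B := by
  rw [ldist_eq]
  refine iSup₂_le fun U hU => ENNReal.ofReal_le_ofReal ?_
  by_contra! hlt
  have hcont : Continuous fun t => M.velLength p U 0 t :=
    intervalIntegral.continuous_primitive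
      (fun a b => (locBdd_speed hU.locBdd).intervalIntegrable a b) 0
  have h0 : M.velLength p U 0 0 = 0 := by simp [velLength]
  obtain ⟨t, ht, hft⟩ : (B + M.velLength p U 0 1) / 2 ∈ (fun t => M.velLength p U 0 t) '' Icc 0 1 :=
    intermediate_value_Icc zero_le_one hcont.continuousOn
      ⟨by simp only [h0]; linarith, by linarith⟩
  simp only at hft
  have ht0 : 0 < t := lt_of_le_of_ne ht.1 (by rintro rfl; linarith)
  have ht1 : t < 1 := lt_of_le_of_ne ht.2 (by rintro rfl; linarith)
  have hpath := hU.isPathOn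
  have hpt := le_ldist ht0 (hpath.mono (Icc_subset_Icc_right ht.2))
  rw [curveOf_zero, gLength_curveOf hU.locBdd] at hpt
  have hple : M.causalLe p (curveOf p U t) := by
    have h1 := causalLe_of_isPathOn ht.1 (hpath.mono (Icc_subset_Icc_right ht.2))
    rwa [curveOf_zero] at h1
  rcases chron_or_gLength_eq_zero ht1 (hpath.mono (Icc_subset_Icc_left ht.1)) with h1 | h1
  · rw [hU.endpoint] at h1
    obtain ⟨m, hm⟩ := (hu _ h1).exists
    have h2 := hpt.trans ((ldist_mono_right hple hm).trans (hx m))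
    rw [ENNReal.ofReal_le_ofReal_iff hB] at h2
    linarith
  · rw [gLength_curveOf hU.locBdd] at h1
    have h2 := velLength_add (M := M) (x := p) hU.locBdd 0 t 1
    linarith

theorem causalLe.exists_norm_eq {a b : SpacetimePt n} (hab : M.causalLe a b) {R : ℝ}
    (ha : ‖a‖ ≤ R) (hb : R ≤ ‖b‖) : ∃ z, M.causalLe a z ∧ M.causalLe z b ∧ ‖z‖ = R := by
  rcases causalLe_iff.1 hab with rfl | ⟨U, hU⟩
  · exact ⟨a, hab, hab, le_antisymm ha hb⟩
  have hcont : Continuous fun t => ‖curveOf a U t‖ := hU.locBdd.continuous_curveOf.norm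
  obtain ⟨t, ht, hR⟩ : R ∈ (fun t => ‖curveOf a U t‖) '' Icc 0 1 :=
    intermediate_value_Icc zero_le_one hcont.continuousOn
      ⟨by simpa only [curveOf_zero] using ha, by simpa only [hU.endpoint] using hb⟩
  refine ⟨curveOf a U t, ?_, ?_, hR⟩
  · have h1 := causalLe_of_isPathOn ht.1 (hU.isPathOn.mono (Icc_subset_Icc_right ht.2))
    rwa [curveOf_zero] at h1
  · have h1 := causalLe_of_isPathOn ht.2 (hU.isPathOn.mono (Icc_subset_Icc_left ht.1))
    rwa [hU.endpoint] at h1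

theorem exists_mem_pastLimit_norm_eq (hGH : M.GloballyHyperbolic)
    (hx : Tendsto (fun m => ‖x m‖) atTop atTop) {u : SpacetimePt n} (hu : u ∈ M.pastLimit x)
    {R : ℝ} (hR : ‖u‖ < R) : ∃ z ∈ M.pastLimit x, M.causalLe u z ∧ ‖z‖ = R := by
  have h1 : ∀ k : ℕ, ∃ v z : SpacetimePt n, ∃ m : ℕ, k ≤ m ∧ dist v u < 1 / ((k : ℝ) + 1) ∧
      M.causalLe v z ∧ M.causalLe z (x m) ∧ ‖z‖ = R := by
    intro k
    have hb : ∀ᶠ v in 𝓝 u, dist v u < 1 / ((k : ℝ) + 1) :=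
      Metric.ball_mem_nhds u (by positivity)
    have hn : ∀ᶠ v in 𝓝 u, ‖v‖ < R := continuous_norm.continuousAt.eventually_lt_const hR
    obtain ⟨v, h2, h3, h4⟩ := ((M.frequently_chron_left u).and_eventually (hb.and hn)).exists
    obtain ⟨m, h5, h6, h7⟩ := ((hu v h2).and_eventually
      ((hx.eventually_ge_atTop R).and (eventually_ge_atTop k))).exists
    obtain ⟨z, h8, h9, h10⟩ := h5.exists_norm_eq h4.le h6
    exact ⟨v, z, m, h7, h3, h8, h9, h10⟩
  choose v z m hkm hv hvz hzx hzR using h1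
  obtain ⟨a, ha, φ, hφ, hlim⟩ := (isCompact_sphere (0 : SpacetimePt n) R).tendsto_subseq
    (x := z) fun k => by simp [hzR]
  have hvu : Tendsto v atTop (𝓝 u) :=
    tendsto_iff_dist_tendsto_zero.2 (squeeze_zero (fun _ => dist_nonneg) (fun k => (hv k).le)
      tendsto_one_div_add_atTop_nhds_zero_nat)
  refine ⟨a, fun w hw => ?_, ?_, by simpa using ha⟩
  · have h2 : Tendsto (m ∘ φ) atTop atTop :=
      tendsto_atTop_mono (fun k => hkm (φ k)) hφ.tendsto_atTop
    refine h2.frequently (Eventually.frequently ?_)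
    filter_upwards [hlim.eventually hw.eventually] with k hk
    exact hk.causalLe.trans (hzx _)
  · exact hGH.causalLe_of_tendsto (hvu.comp hφ.tendsto_atTop) hlim
      (Eventually.of_forall fun k => hvz _)

theorem tendsto_norm_atTop_of_forall_not_mapClusterPt {x : ℕ → SpacetimePt n}
    (hx : ∀ z, ¬ MapClusterPt z atTop x) : Tendsto (fun m => ‖x m‖) atTop atTop := by
  refine tendsto_atTop.2 fun R => ?_
  by_contra hR
  obtain ⟨z, -, hz⟩ :=
    (isCompact_closedBall (0 : SpacetimePt n) R).exists_mapClusterPt_of_frequently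
    (f := x) (l := atTop) ((not_eventually.1 hR).mono fun m hm => by simpa using (not_le.1 hm).le)
  exact hx z hz

theorem FutureCauchyComplete.futureFinitelyCompact (hGH : M.GloballyHyperbolic)
    (h : M.FutureCauchyComplete) : M.FutureFinitelyCompact := by
  intro B hB p q x hx
  by_contra hcl
  push Not at hcl
  have hinf := tendsto_norm_atTop_of_forall_not_mapClusterPt hcl
  have hpq := (hx 0).1
  have hq : q ∈ M.pastLimit x := mem_pastLimit_of_le fun m => (hx m).2.1
  have hstep : ∀ (k : ℕ) (y : {y // ∃ u ∈ M.pastLimit x, M.chron y u}),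
      ∃ y' : {y // ∃ u ∈ M.pastLimit x, M.chron y u}, M.chron y.1 y'.1 ∧ (k : ℝ) ≤ ‖y'.1‖ := by
    rintro k ⟨y, u, hu, hyu⟩
    obtain ⟨u', hu', huu', hn⟩ := exists_mem_pastLimit_norm_eq hGH hinf hu
      (R := ‖u‖ + k + 1) (by have : (0 : ℝ) ≤ k := Nat.cast_nonneg k; linarith)
    have hk : ∀ᶠ v : SpacetimePt n in 𝓝 u', (k : ℝ) < ‖v‖ :=
      continuous_norm.continuousAt.eventually_const_lt (by linarith [norm_nonneg u])
    obtain ⟨y', h1, h2, h3⟩ := ((M.frequently_chron_left u').and_eventually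
      ((hyu.trans_causalLe huu').eventually.and hk)).exists
    exact ⟨⟨y', u', hu', h1⟩, h2, h3.le⟩
  choose f hf1 hf2 using hstep
  let y : ℕ → {y // ∃ u ∈ M.pastLimit x, M.chron y u} :=
    fun k => Nat.rec ⟨p, q, hq, hpq⟩ (fun k y => f k y) k
  have hy : ∀ k, M.chron (y k).1 (y (k + 1)).1 := fun k => hf1 k (y k)
  have hyn : ∀ k : ℕ, (k : ℝ) ≤ ‖(y (k + 1)).1‖ := fun k => hf2 k (y k)
  have hle : ∀ k m, k ≤ m → M.causalLe (y k).1 (y m).1 := by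
    intro k m hkm
    induction m, hkm using Nat.le_induction with
    | base => exact causalLe.refl _
    | succ m _ ih => exact ih.trans (hy m).causalLe
  have hp : ∀ k, M.causalLe p (y k).1 := fun k => hle 0 k (Nat.zero_le k)
  have hT : ∀ k, M.ldist p (y k).1 ≤ ENNReal.ofReal B := by
    intro k
    obtain ⟨u, hu, hyu⟩ := (y k).2
    exact ldist_le_of_mem_pastLimit hB.le (fun m => (hx m).2.2) (hyu.causalLe.mem_pastLimit hu)
  have hTtop : ∀ k, M.ldist p (y k).1 ≠ ⊤ := fun k =>
    ne_top_of_le_ne_top ENNReal.ofReal_ne_top (hT k)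
  let τ : ℕ → ℝ := fun k => (M.ldist p (y k).1).toReal
  have hmono : Monotone τ := fun k m hkm =>
    ENNReal.toReal_mono (hTtop m) (ldist_mono_right (hp k) (hle k m hkm))
  have hbdd : BddAbove (range τ) := ⟨B, by
    rintro _ ⟨k, rfl⟩
    exact ENNReal.toReal_le_of_le_ofReal hB.le (hT k)⟩
  have hlim := tendsto_atTop_ciSup hmono hbdd
  obtain ⟨l, hl⟩ := h (fun k => (y k).1) (fun k => (⨆ i, τ i) - τ k)
    (fun k => sub_nonneg.2 (le_ciSup hbdd k)) (by simpa using hlim.const_sub (⨆ i, τ i)) hy (by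
      intro k m _
      have h1 := ldist_add_le (hp k) (hle k (k + m) (Nat.le_add_right k m))
      have h2 : M.ldist (y k).1 (y (k + m)).1 ≠ ⊤ :=
        ne_top_of_le_ne_top (hTtop (k + m)) (le_add_self.trans h1)
      rw [ENNReal.le_ofReal_iff_toReal_le h2 (sub_nonneg.2 (le_ciSup hbdd k))]
      have h3 := ENNReal.toReal_mono (hTtop _) h1
      rw [ENNReal.toReal_add (hTtop k) h2] at h3
      have h4 := le_ciSup hbdd (k + m)
      simp only [τ] at h4 ⊢
      linarith)
  have h1 : Tendsto (fun k => ‖(y (k + 1)).1‖) atTop atTop :=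
    tendsto_atTop_mono hyn tendsto_natCast_atTop_atTop
  exact not_tendsto_nhds_of_tendsto_atTop h1 _ ((hl.comp (tendsto_add_atTop_nat 1)).norm)

end C1Spacetime

namespace LorentzData

variable {E : Type*} [NormedAddCommGroup E] [NormedSpace ℝ E] {M : LorentzData E}

theorem continuous_norm_chris (M : LorentzData E) : Continuous fun x => ‖M.chris x‖ :=
  (continuous_norm (E := E →L[ℝ] E →L[ℝ] E)).comp M.continuous_chris

/-- Near a point `z`, future causal vectors are uniformly controlled by the linear form
`-g_z(·, X₀ z)`. -/
theorem exists_cone_bound [FiniteDimensional ℝ E] (M : LorentzData E) (z : E) :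
    ∃ κ > 0, ∀ᶠ x in 𝓝 z, ∀ v, M.IsFutureCausal x v → κ * ‖v‖ ≤ -M.metric z v (M.X0 z) := by
  have : ProperSpace E := FiniteDimensional.proper_real E
  have hS : IsCompact (Metric.sphere (0 : E) 1) := isCompact_sphere 0 1
  have hc0 : Continuous fun v => M.metric z v v :=
    M.continuous_metric_apply continuous_const continuous_id continuous_id
  have hc1 : Continuous fun v => M.metric z v (M.X0 z) :=
    M.continuous_metric_apply continuous_const continuous_id continuous_const
  have hK : IsCompact (Metric.sphere (0 : E) 1 ∩
      {v | M.metric z v v ≤ 0 ∧ M.metric z v (M.X0 z) ≤ 0}) :=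
    hS.inter_right ((isClosed_le hc0 continuous_const).inter (isClosed_le hc1 continuous_const))
  obtain ⟨κ, hκ, hκK⟩ := hK.exists_forall_le' (a := 0) hc1.neg.continuousOn fun v hv => by
    have hne : v ≠ 0 := ne_zero_of_mem_unit_sphere ⟨v, hv.1⟩
    have := (M.isLorentzForm_metric z).ne_zero hv.2.1 hne
    exact neg_pos.2 (lt_of_le_of_ne hv.2.2 this)
  refine ⟨κ / 2, half_pos hκ, ?_⟩
  have hf : Continuous fun y : E × E => -max (M.metric y.1 y.2 y.2)
      (max (M.metric y.1 y.2 (M.X0 y.1)) (-M.metric z y.2 (M.X0 z) - κ / 2)) := by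
    refine (Continuous.max ?_ (Continuous.max ?_ ?_)).neg
    · exact M.continuous_metric_apply continuous_fst continuous_snd continuous_snd
    · exact M.continuous_metric_apply continuous_fst continuous_snd
        (M.X0_cont.comp continuous_fst)
    · exact (hc1.comp continuous_snd).neg.sub continuous_const
  have h := hS.eventually_forall_neg (f := fun x v => -max (M.metric x v v)
      (max (M.metric x v (M.X0 x)) (-M.metric z v (M.X0 z) - κ / 2))) hf (a := z) fun v hv => by
    rw [neg_lt_zero, lt_max_iff, lt_max_iff]
    by_contra! hcon
    have : κ ≤ -M.metric z v (M.X0 z) := hκK v ⟨hv, hcon.1, hcon.2.1⟩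
    linarith [hcon.2.2]
  filter_upwards [h] with x hx v hv
  have hpos : 0 < ‖v‖ := norm_pos_iff.2 hv.ne_zero
  have h1 := hv.smul (inv_pos.2 hpos)
  have h2 := hx (‖v‖⁻¹ • v) (by simp [norm_smul, hpos.ne'])
  rw [neg_lt_zero, lt_max_iff, lt_max_iff] at h2
  rcases h2 with h2 | h2 | h2
  · exact absurd h1.1 (not_le.2 h2)
  · exact absurd h1.2 (not_lt.2 h2.le)
  · rw [map_smul, smul_apply, smul_eq_mul, sub_pos] at h2
    have h3 := mul_lt_mul_of_pos_right h2 hpos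
    have h4 : -(‖v‖⁻¹ * M.metric z v (M.X0 z)) * ‖v‖ = -M.metric z v (M.X0 z) := by
      field_simp
    linarith

/-- A solution of the geodesic equation, reparametrized by `lam` to run for all positive times. -/
structure IsGeodesicFlow (M : LorentzData E) (lam : ℝ → ℝ) (x v : ℝ → E) : Prop where
  locBdd : LocBdd lam
  pos : ∀ᵐ t, t ∈ Ioi 0 → 0 < lam t
  continuous : Continuous x
  continuous_vel : Continuous v
  eq_add_integral : ∀ t, 0 ≤ t → x t = x 0 + ∫ s in (0 : ℝ)..t, lam s • v s
  vel_eq_add_integral : ∀ t, 0 ≤ t →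
    v t = v 0 + ∫ s in (0 : ℝ)..t, lam s • -M.chris (x s) (v s) (v s)
  isFutureCausal : ∀ t, 0 ≤ t → M.IsFutureCausal (x t) (v t)

theorem hasDerivAt_metric_self {x v : ℝ → E} {l : ℝ} {t : ℝ} (hx : HasDerivAt x (l • v t) t)
    (hv : HasDerivAt v (l • -M.chris (x t) (v t) (v t)) t) :
    HasDerivAt (fun t => M.metric (x t) (v t) (v t)) 0 t := by
  have h3 : HasDerivAt (fun t => M.metric (x t)) (fderiv ℝ M.metric (x t) (l • v t)) t :=
    (M.contDiff_metric.differentiable one_ne_zero (x t)).hasFDerivAt.comp_hasDerivAt t hx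
  refine ((h3.clm_apply hv).clm_apply hv).congr_deriv ?_
  rw [add_apply, M.fderiv_metric_eq]
  simp

theorem not_tendsto_of_timelike [FiniteDimensional ℝ E] {x v : ℝ → E} {c : ℝ} (hc : c < 0)
    (hcv : ∀ t, 0 ≤ t → M.metric (x t) (v t) (v t) = c)
    (hf : ∀ t, 0 ≤ t → M.IsFutureCausal (x t) (v t))
    (hx : ∀ t, 0 ≤ t →
      HasDerivAt x (((1 + ‖M.chris (x t)‖) * (1 + ‖v t‖ ^ 2))⁻¹ • v t) t)
    (hv : ∀ t, 0 ≤ t → HasDerivAt v (((1 + ‖M.chris (x t)‖) * (1 + ‖v t‖ ^ 2))⁻¹ •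
      -M.chris (x t) (v t) (v t)) t) :
    ¬ ∃ z, Tendsto x atTop (𝓝 z) := by
  rintro ⟨z, hz⟩
  obtain ⟨κ, hκ, hcone⟩ := M.exists_cone_bound z
  set τ : E →L[ℝ] ℝ := -(M.metric z).flip (M.X0 z) with hτ
  have hτa : ∀ v, τ v = -M.metric z v (M.X0 z) := fun v => by simp [hτ]
  obtain ⟨C, hC0, hC⟩ : ∃ C > 0, ∀ᶠ x in 𝓝 z, ‖M.chris x‖ ≤ C ∧ ‖M.metric x‖ ≤ C := by
    have h1 : Continuous fun x => max ‖M.chris x‖ ‖M.metric x‖ :=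
      M.continuous_norm_chris.max
        ((continuous_norm (E := E →L[ℝ] E →L[ℝ] ℝ)).comp M.continuous_metric)
    refine ⟨max ‖M.chris z‖ ‖M.metric z‖ + 1, by positivity, ?_⟩
    filter_upwards [h1.continuousAt.eventually_lt continuousAt_const
      (lt_add_one (max ‖M.chris z‖ ‖M.metric z‖))] with x hx
    exact max_le_iff.1 hx.le
  obtain ⟨T, hT⟩ := eventually_atTop.1 (hz.eventually (hcone.and hC))
  set T₀ := max T 0
  have hT0 : ∀ t, T₀ ≤ t → 0 ≤ t := fun t ht => (le_max_right _ _).trans ht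
  have hκv : ∀ t, T₀ ≤ t → κ * ‖v t‖ ≤ τ (v t) := fun t ht => by
    rw [hτa]
    exact (hT t ((le_max_left _ _).trans ht)).1 _ (hf t (hT0 t ht))
  have hCt : ∀ t, T₀ ≤ t → ‖M.chris (x t)‖ ≤ C ∧ ‖M.metric (x t)‖ ≤ C := fun t ht =>
    (hT t ((le_max_left _ _).trans ht)).2
  set lam : ℝ → ℝ := fun t => ((1 + ‖M.chris (x t)‖) * (1 + ‖v t‖ ^ 2))⁻¹
  have hlam : ∀ t, 0 < lam t := fun t => by positivity
  set K := ‖τ‖ * C / κ ^ 2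
  have hdτ : ∀ t, T₀ ≤ t → HasDerivAt (fun t => τ (x t)) (lam t * τ (v t)) t := fun t ht => by
    have := τ.hasFDerivAt.comp_hasDerivAt t (hx t (hT0 t ht))
    rwa [map_smul, smul_eq_mul] at this
  have hdv : ∀ t, T₀ ≤ t →
      HasDerivAt (fun t => τ (v t)) (lam t * -τ (M.chris (x t) (v t) (v t))) t := fun t ht => by
    have := τ.hasFDerivAt.comp_hasDerivAt t (hv t (hT0 t ht))
    rwa [map_smul, smul_eq_mul, map_neg] at this
  have hbd : ∀ t, T₀ ≤ t → -τ (M.chris (x t) (v t) (v t)) ≤ K * τ (v t) ^ 2 := fun t ht => by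
    have h1 : ‖M.chris (x t) (v t) (v t)‖ ≤ C * ‖v t‖ ^ 2 := by
      refine (ContinuousLinearMap.le_opNorm₂ _ _ _).trans ?_
      rw [mul_assoc, ← sq]
      gcongr
      exact (hCt t ht).1
    have h2 : -τ (M.chris (x t) (v t) (v t)) ≤ ‖τ‖ * (C * ‖v t‖ ^ 2) :=
      (neg_le_abs _).trans ((τ.le_opNorm _).trans (by gcongr))
    have h3 : (κ * ‖v t‖) ^ 2 ≤ τ (v t) ^ 2 := by
      gcongr
      exact hκv t ht
    calc _ ≤ ‖τ‖ * (C * ‖v t‖ ^ 2) := h2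
      _ = K * (κ * ‖v t‖) ^ 2 := by simp only [K]; field_simp
      _ ≤ _ := by gcongr
  have hanti : AntitoneOn (fun t => τ (v t) * Real.exp (-(K * τ (x t)))) (Ici T₀) := by
    have hd : ∀ t, T₀ ≤ t → HasDerivAt (fun t => τ (v t) * Real.exp (-(K * τ (x t))))
        (lam t * -τ (M.chris (x t) (v t) (v t)) * Real.exp (-(K * τ (x t))) +
          τ (v t) * (Real.exp (-(K * τ (x t))) * -(K * (lam t * τ (v t))))) t := fun t ht =>
      (hdv t ht).mul (((hdτ t ht).const_mul K).neg.exp)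
    refine antitoneOn_of_deriv_nonpos (convex_Ici _)
      (fun t ht => (hd t ht).continuousAt.continuousWithinAt)
      (fun t ht => (hd t (interior_subset ht)).differentiableAt.differentiableWithinAt)
      fun t ht => ?_
    rw [(hd t (interior_subset ht)).deriv]
    have h1 := mul_nonneg (mul_nonneg (hlam t).le (Real.exp_pos (-(K * τ (x t)))).le)
      (sub_nonneg.2 (hbd t (interior_subset ht)))
    linarith
  have hτz : Tendsto (fun t => τ (x t)) atTop (𝓝 (τ z)) :=
    (τ.continuous.tendsto z).comp hz
  have hR : ∃ R > 0, ∃ T₁ ≥ T₀, ∀ t, T₁ ≤ t → ‖v t‖ ≤ R := by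
    have hexp : Tendsto (fun t => Real.exp (-(K * τ (x t)))) atTop
        (𝓝 (Real.exp (-(K * τ z)))) :=
      (Real.continuous_exp.tendsto _).comp (hτz.const_mul K).neg
    obtain ⟨T₁, hT₁⟩ := eventually_atTop.1
      (hexp.eventually (lt_mem_nhds (half_lt_self (Real.exp_pos (-(K * τ z))))))
    set e := Real.exp (-(K * τ z)) / 2
    have he : 0 < e := by positivity
    set D := τ (v T₀) * Real.exp (-(K * τ (x T₀)))
    refine ⟨max 1 (D / e / κ), by positivity, max T₁ T₀, le_max_right _ _, fun t ht => ?_⟩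
    have htT : T₀ ≤ t := (le_max_right _ _).trans ht
    refine le_max_of_le_right ?_
    have h1 : τ (v t) * Real.exp (-(K * τ (x t))) ≤ D := hanti (mem_Ici.2 le_rfl) htT htT
    have h2 := hκv t htT
    have h3 : 0 ≤ τ (v t) := le_trans (by positivity) h2
    have h4 := mul_le_mul_of_nonneg_left (hT₁ t ((le_max_left _ _).trans ht)).le h3
    rw [le_div_iff₀ hκ, le_div_iff₀ he]
    nlinarith
  obtain ⟨R, hR0, T₁, hT₁, hvR⟩ := hR
  have hlow : ∀ t, T₀ ≤ t → -c / C ≤ ‖v t‖ ^ 2 := fun t ht => by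
    rw [div_le_iff₀ hC0, ← hcv t (hT0 t ht)]
    refine (neg_le_abs _).trans (((M.metric (x t)).le_opNorm₂ (v t) (v t)).trans ?_)
    rw [mul_assoc, ← sq, mul_comm]
    gcongr
    exact (hCt t ht).2
  set η := ((1 + C) * (1 + R ^ 2))⁻¹ * (κ * ((-c / C) / R))
  have hη : 0 < η := by
    have : 0 < -c := neg_pos.2 hc
    positivity
  have hge : ∀ t, T₁ ≤ t → η ≤ lam t * τ (v t) := fun t ht => by
    have h1 := hκv t (hT₁.le.trans ht)
    have h2 := hvR t ht
    have h3 := hlow t (hT₁.le.trans ht)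
    have h4 := (hCt t (hT₁.le.trans ht)).1
    have h5 : -c / C / R ≤ ‖v t‖ := by
      rw [div_le_iff₀ hR0]
      nlinarith [norm_nonneg (v t)]
    have h6 : 0 < -c := neg_pos.2 hc
    refine mul_le_mul ?_ ((mul_le_mul_of_nonneg_left h5 hκ.le).trans h1) (by positivity)
      (hlam t).le
    simp only [lam]
    gcongr
  have hmono : MonotoneOn (fun t => τ (x t) - η * t) (Ici T₁) := by
    have hd : ∀ t, T₁ ≤ t → HasDerivAt (fun t => τ (x t) - η * t)
        (lam t * τ (v t) - η * 1) t := fun t ht =>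
      (hdτ t (hT₁.le.trans ht)).sub ((hasDerivAt_id t).const_mul η)
    refine monotoneOn_of_deriv_nonneg (convex_Ici _)
      (fun t ht => (hd t ht).continuousAt.continuousWithinAt)
      (fun t ht => (hd t (interior_subset ht)).differentiableAt.differentiableWithinAt)
      fun t ht => ?_
    rw [(hd t (interior_subset ht)).deriv]
    linarith [hge t (interior_subset ht)]
  have htop : Tendsto (fun t => τ (x t)) atTop atTop := by
    refine tendsto_atTop_mono' _ ?_ (tendsto_atTop_add_const_left _ (τ (x T₁) - η * T₁)
      (tendsto_id.const_mul_atTop hη))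
    filter_upwards [eventually_ge_atTop T₁] with t ht
    have := hmono (mem_Ici.2 le_rfl) ht ht
    simp only [id] at this ⊢
    linarith
  exact not_tendsto_nhds_of_tendsto_atTop htop _ hτz

/-- From every point there starts a future inextendible timelike geodesic. -/
theorem exists_isGeodesicFlow [FiniteDimensional ℝ E] (M : LorentzData E) (q : E) :
    ∃ lam x v, M.IsGeodesicFlow lam x v ∧ x 0 = q ∧ ¬ ∃ z, Tendsto x atTop (𝓝 z) := by
  have : ProperSpace E := FiniteDimensional.proper_real E
  have : CompleteSpace E := FiniteDimensional.complete ℝ E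
  set l : E × E → ℝ := fun y => ((1 + ‖M.chris y.1‖) * (1 + ‖y.2‖ ^ 2))⁻¹ with hl
  have hlpos : ∀ y, 0 < l y := fun y => by positivity
  have hlc : Continuous l := by
    have h1 : Continuous fun y : E × E => ‖M.chris y.1‖ :=
      M.continuous_norm_chris.comp continuous_fst
    refine Continuous.inv₀ (by fun_prop) fun y => by positivity
  set F : E × E → E × E := fun y => (l y • y.2, l y • -M.chris y.1 y.2 y.2) with hF
  have hFc : Continuous F :=
    (hlc.smul continuous_snd).prodMk
      (hlc.smul (M.continuous_chris_apply continuous_fst continuous_snd continuous_snd).neg)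
  have hF1 : ∀ y, ‖F y‖ ≤ 1 := by
    intro y
    have h0 : 0 < (1 + ‖M.chris y.1‖) * (1 + ‖y.2‖ ^ 2) := by positivity
    refine norm_prod_le_iff.2 ⟨?_, ?_⟩
    · rw [norm_smul, Real.norm_of_nonneg (hlpos y).le, hl, inv_mul_le_one₀ h0]
      nlinarith [norm_nonneg (M.chris y.1), sq_nonneg (‖y.2‖ - 1), norm_nonneg y.2,
        mul_nonneg (norm_nonneg (M.chris y.1)) (sq_nonneg ‖y.2‖)]
    · rw [norm_smul, Real.norm_of_nonneg (hlpos y).le, norm_neg, hl, inv_mul_le_one₀ h0]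
      refine (ContinuousLinearMap.le_opNorm₂ _ _ _).trans ?_
      nlinarith [norm_nonneg (M.chris y.1), sq_nonneg ‖y.2‖]
  obtain ⟨Y, hYc, hY⟩ := exists_forall_eq_add_integral_of_norm_le_one hFc hF1 (q, M.X0 q)
  have hFY : Continuous fun s => F (Y s) := hFc.comp hYc
  set Z : ℝ → E × E := fun t => (q, M.X0 q) + ∫ s in (0 : ℝ)..t, F (Y s) with hZ
  have hZd' : ∀ t, HasDerivAt Z (F (Y t)) t := fun t =>
    (intervalIntegral.integral_hasDerivAt_right (hFY.intervalIntegrable _ _)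
      (hFY.stronglyMeasurableAtFilter _ _) hFY.continuousAt).const_add _
  have hZY : ∀ t, 0 ≤ t → Y t = Z t := hY
  have hZc : Continuous Z := continuous_iff_continuousAt.2 fun t => (hZd' t).continuousAt
  have hZd : ∀ t, 0 ≤ t → HasDerivAt Z (F (Z t)) t := fun t ht => by
    rw [← hZY t ht]; exact hZd' t
  have hZ0 : Z 0 = (q, M.X0 q) := by simp [hZ]
  have hFZ : Continuous fun s => F (Z s) := hFc.comp hZc
  have hZi : ∀ t, 0 ≤ t → Z t = Z 0 + ∫ s in (0 : ℝ)..t, F (Z s) := fun t ht => by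
    rw [intervalIntegral.integral_eq_sub_of_hasDerivAt
      (fun s hs => hZd s (by rw [uIcc_of_le ht] at hs; exact hs.1)) (hFZ.intervalIntegrable _ _)]
    abel
  have hx : ∀ t, 0 ≤ t → HasDerivAt (fun t => (Z t).1) (l (Z t) • (Z t).2) t := fun t ht =>
    (hasFDerivAt_fst (𝕜 := ℝ) (E := E) (F := E)).comp_hasDerivAt t (hZd t ht)
  have hv : ∀ t, 0 ≤ t → HasDerivAt (fun t => (Z t).2)
      (l (Z t) • -M.chris (Z t).1 (Z t).2 (Z t).2) t := fun t ht =>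
    (hasFDerivAt_snd (𝕜 := ℝ) (E := E) (F := E)).comp_hasDerivAt t (hZd t ht)
  have hgc : Continuous fun t => M.metric (Z t).1 (Z t).2 (Z t).2 :=
    M.continuous_metric_apply (continuous_fst.comp hZc) (continuous_snd.comp hZc)
      (continuous_snd.comp hZc)
  have hneg : M.metric q (M.X0 q) (M.X0 q) < 0 := (M.isLorentzForm_metric q).neg
  have hconst : ∀ t, 0 ≤ t →
      M.metric (Z t).1 (Z t).2 (Z t).2 = M.metric q (M.X0 q) (M.X0 q) := by
    intro t ht
    have := constant_of_has_deriv_right_zero (a := 0) (b := t) hgc.continuousOn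
      (fun s hs => (hasDerivAt_metric_self (x := fun t => (Z t).1)
        (v := fun t => (Z t).2) (hx s hs.1) (hv s hs.1)).hasDerivWithinAt) t
      ⟨ht, le_rfl⟩
    rw [this, hZ0]
  have hXc : Continuous fun t => M.metric (Z t).1 (Z t).2 (M.X0 (Z t).1) :=
    M.continuous_metric_apply (continuous_fst.comp hZc) (continuous_snd.comp hZc)
      (M.X0_cont.comp (continuous_fst.comp hZc))
  have hfut : ∀ t, 0 ≤ t → M.IsFutureCausal (Z t).1 (Z t).2 := by
    intro t ht
    refine ⟨(hconst t ht).trans_le hneg.le, ?_⟩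
    by_contra! hcon
    obtain ⟨s, hs, hs0⟩ := intermediate_value_Icc ht hXc.continuousOn
      ⟨(by rw [hZ0]; exact hneg.le : _ ≤ (0 : ℝ)), hcon⟩
    have h1 := (hconst s hs.1).trans_lt hneg
    refine (M.isLorentzForm_metric (Z s).1).ne_zero h1.le ?_ hs0
    rintro h2
    rw [h2, map_zero] at h1
    exact lt_irrefl _ h1
  refine ⟨fun t => l (Z t), fun t => (Z t).1, fun t => (Z t).2,
    ⟨(hlc.comp hZc).locBdd, .of_forall fun t _ => hlpos _, continuous_fst.comp hZc,
      continuous_snd.comp hZc, fun t ht => ?_, fun t ht => ?_, hfut⟩, congrArg Prod.fst hZ0,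
    not_tendsto_of_timelike hneg hconst hfut hx hv⟩
  · have h1 := ContinuousLinearMap.intervalIntegral_comp_comm (ContinuousLinearMap.fst ℝ E E)
      (hFZ.intervalIntegrable (μ := volume) 0 t)
    have h2 := congrArg Prod.fst (hZi t ht)
    rw [h2, Prod.fst_add]
    exact congrArg _ h1.symm
  · have h1 := ContinuousLinearMap.intervalIntegral_comp_comm (ContinuousLinearMap.snd ℝ E E)
      (hFZ.intervalIntegrable (μ := volume) 0 t)
    have h2 := congrArg Prod.snd (hZi t ht)
    rw [h2, Prod.snd_add]
    exact congrArg _ h1.symm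

end LorentzData

/-! ### Reparametrization of geodesics -/

/-- The reparametrization of the line with speed `lam` on the positive half line. -/
def timeChange (lam : ℝ → ℝ) (t : ℝ) : ℝ := min t 0 + ∫ s in (0 : ℝ)..max t 0, lam s

section TimeChange

variable {lam : ℝ → ℝ}

theorem timeChange_of_nonneg {t : ℝ} (ht : 0 ≤ t) :
    timeChange lam t = ∫ s in (0 : ℝ)..t, lam s := by
  rw [timeChange, min_eq_right ht, max_eq_left ht, zero_add]

theorem timeChange_zero : timeChange lam 0 = 0 := by
  rw [timeChange_of_nonneg le_rfl, intervalIntegral.integral_same]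

theorem LocBdd.continuous_timeChange (hl : LocBdd lam) : Continuous (timeChange lam) := by
  have h : Continuous fun t => ∫ s in (0 : ℝ)..t, lam s := by
    simpa using (hl.locallyLipschitz_primitive 0).continuous
  exact (continuous_id.min continuous_const).add (h.comp (continuous_id.max continuous_const))

theorem LocBdd.integral_pos (hl : LocBdd lam) (hpos : ∀ᵐ t, t ∈ Ioi 0 → 0 < lam t) {a b : ℝ}
    (ha : 0 ≤ a) (hab : a < b) : 0 < ∫ t in a..b, lam t := by
  have h0 : ∀ᵐ t ∂volume.restrict (Ioc a b), 0 < lam t := by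
    rw [ae_restrict_iff' measurableSet_Ioc]
    filter_upwards [hpos] with t ht h1
    exact ht (ha.trans_lt h1.1)
  rw [intervalIntegral.integral_pos_iff_support_of_nonneg_ae'
    (by rw [uIoc_of_le hab.le]; exact h0.mono fun t ht => ht.le) (hl.intervalIntegrable a b)]
  refine ⟨hab, ?_⟩
  have h1 : (Function.support lam ∩ Ioc a b : Set ℝ) =ᵐ[volume] Ioc a b := by
    filter_upwards [(ae_restrict_iff' measurableSet_Ioc).1 h0] with t ht
    exact propext ⟨fun h => h.2, fun h => ⟨(ht h).ne', h⟩⟩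
  rw [measure_congr h1, Real.volume_Ioc]
  simpa using hab

theorem LocBdd.strictMono_timeChange (hl : LocBdd lam) (hpos : ∀ᵐ t, t ∈ Ioi 0 → 0 < lam t) :
    StrictMono (timeChange lam) := by
  intro t u htu
  simp only [timeChange]
  rcases le_or_gt u 0 with hu | hu
  · rw [max_eq_right hu, max_eq_right (htu.le.trans hu), min_eq_left hu,
      min_eq_left (htu.le.trans hu)]
    linarith
  · have h1 : max t 0 < max u 0 := by
      rw [max_eq_left hu.le]; exact max_lt htu hu
    have h2 := hl.integral_pos hpos (le_max_right t 0) h1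
    rw [← intervalIntegral.integral_interval_sub_left (hl.intervalIntegrable 0 _)
      (hl.intervalIntegrable 0 _)] at h2
    have h3 : min t 0 ≤ min u 0 := min_le_min_right 0 htu.le
    linarith

theorem LocBdd.isEmbedding_timeChange (hl : LocBdd lam)
    (hpos : ∀ᵐ t, t ∈ Ioi 0 → 0 < lam t) : IsEmbedding (timeChange lam) :=
  (hl.strictMono_timeChange hpos).isEmbedding_of_ordConnected
    (isPreconnected_range hl.continuous_timeChange).ordConnected

variable {E : Type*} [NormedAddCommGroup E] [NormedSpace ℝ E]

theorem LocBdd.smul_continuous (hl : LocBdd lam) {f : ℝ → E} (hf : Continuous f) :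
    LocBdd fun t => lam t • f t := by
  have hc : Continuous fun t => ContinuousLinearMap.toSpanSingleton ℝ (f t) :=
    (ContinuousLinearMap.toSpanSingletonCLE (𝕜 := ℝ) (E := E)).continuous.comp hf
  exact LocBdd.clm_apply hc hl

/-- A primitive of `lam • f` has derivative `f` with respect to the new parameter. -/
theorem LocBdd.hasDerivWithinAt_comp_timeChange [CompleteSpace E] (hl : LocBdd lam)
    (hpos : ∀ᵐ t, t ∈ Ioi 0 → 0 < lam t) {F f : ℝ → E} (hf : Continuous f)
    (hF : ∀ t, 0 ≤ t → F t = F 0 + ∫ s in (0 : ℝ)..t, lam s • f s) {r : ℝ → ℝ}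
    (hr : ∀ t, r (timeChange lam t) = t) {t : ℝ} (ht : 0 ≤ t) :
    HasDerivWithinAt (F ∘ r) (f t) (timeChange lam '' Ici 0) (timeChange lam t) := by
  rw [hasDerivWithinAt_iff_isLittleO, Asymptotics.isLittleO_iff]
  intro ε hε
  obtain ⟨δ, hδ, hfδ⟩ := Metric.continuousAt_iff.1 (hf.continuousAt (x := t)) ε hε
  have hnear : ∀ᶠ y in 𝓝 (timeChange lam t), ∀ u, timeChange lam u = y → dist u t < δ := by
    rw [← eventually_comap, ← (hl.isEmbedding_timeChange hpos).nhds_eq_comap]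
    exact Metric.ball_mem_nhds t hδ
  filter_upwards [nhdsWithin_le_nhds hnear, self_mem_nhdsWithin] with y hy hyI
  obtain ⟨u, hu, rfl⟩ := hyI
  have hu0 : 0 ≤ u := hu
  have hut := hy u rfl
  simp only [Function.comp_apply, hr]
  have hi : ∀ a b, IntervalIntegrable (fun s => lam s • f s) volume a b :=
    (hl.smul_continuous hf).intervalIntegrable
  have hli : ∀ a b, IntervalIntegrable lam volume a b := hl.intervalIntegrable
  have h1 : F u - F t = ∫ s in t..u, lam s • f s := by
    rw [hF u hu0, hF t ht, add_sub_add_left_eq_sub,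
      intervalIntegral.integral_interval_sub_left (hi _ _) (hi _ _)]
  have h2 : timeChange lam u - timeChange lam t = ∫ s in t..u, lam s := by
    rw [timeChange_of_nonneg hu0, timeChange_of_nonneg ht,
      intervalIntegral.integral_interval_sub_left (hli _ _) (hli _ _)]
  have h3 : F u - F t - (timeChange lam u - timeChange lam t) • f t =
      ∫ s in t..u, lam s • (f s - f t) := by
    rw [h1, h2, ← intervalIntegral.integral_smul_const, ← intervalIntegral.integral_sub (hi _ _)
      (((hl.smul_continuous continuous_const)).intervalIntegrable _ _)]
    simp only [smul_sub]
  rw [h3, h2]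
  refine (intervalIntegral.norm_integral_le_abs_of_norm_le (g := fun s => ε * lam s) ?_
    ((hli _ _).const_mul ε)).trans ?_
  · rw [ae_restrict_iff' measurableSet_uIoc]
    filter_upwards [hpos] with s hs hsu
    have hs0 : 0 < lam s := by
      refine hs (lt_of_le_of_lt (le_min ht hu0) ?_)
      exact hsu.1
    have hst : dist s t < δ := by
      refine lt_of_le_of_lt ?_ hut
      rw [Real.dist_eq, Real.dist_eq]
      exact abs_sub_left_of_mem_uIcc (uIoc_subset_uIcc hsu)
    rw [norm_smul, Real.norm_of_nonneg hs0.le, mul_comm]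
    gcongr
    rw [← dist_eq_norm]
    exact (hfδ hst).le
  · rw [intervalIntegral.integral_const_mul, abs_mul, abs_of_pos hε, Real.norm_eq_abs]

theorem LocBdd.image_timeChange (hl : LocBdd lam) (hpos : ∀ᵐ t, t ∈ Ioi 0 → 0 < lam t) :
    (timeChange lam '' Ici 0 = Ici 0 ∧ Tendsto (timeChange lam) atTop atTop) ∨
      ∃ c > 0, timeChange lam '' Ici 0 = Ico 0 c ∧ Tendsto (timeChange lam) atTop (𝓝[<] c) := by
  have hmono := hl.strictMono_timeChange hpos
  have hsurj : ∀ y u, 0 ≤ u → 0 ≤ y → y ≤ timeChange lam u → y ∈ timeChange lam '' Ici 0 := by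
    intro y u hu hy hyu
    obtain ⟨s, hs, rfl⟩ := intermediate_value_Icc hu hl.continuous_timeChange.continuousOn
      ⟨timeChange_zero.le.trans hy, hyu⟩
    exact ⟨s, hs.1, rfl⟩
  have hnn : ∀ u, 0 ≤ u → 0 ≤ timeChange lam u := fun u hu =>
    timeChange_zero.symm.le.trans (hmono.monotone hu)
  rcases tendsto_atTop_of_monotone hmono.monotone with h | ⟨c, hc⟩
  · refine Or.inl ⟨Subset.antisymm ?_ fun y hy => ?_, h⟩
    · rintro _ ⟨u, hu, rfl⟩
      exact hnn u hu
    · obtain ⟨u, hu, hyu⟩ := ((eventually_ge_atTop 0).and (h.eventually_ge_atTop y)).exists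
      exact hsurj y u hu hy hyu
  · have hlt : ∀ u, timeChange lam u < c := fun u =>
      (hmono (lt_add_one u)).trans_le (hmono.monotone.ge_of_tendsto hc _)
    refine Or.inr ⟨c, (hnn 0 le_rfl).trans_lt (hlt 0), Subset.antisymm ?_ fun y hy => ?_,
      tendsto_nhdsWithin_iff.2 ⟨hc, .of_forall hlt⟩⟩
    · rintro _ ⟨u, hu, rfl⟩
      exact ⟨hnn u hu, hlt u⟩
    · obtain ⟨u, hu, hyu⟩ :=
        ((eventually_ge_atTop 0).and (hc.eventually (lt_mem_nhds hy.2))).exists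
      exact hsurj y u hu hy.1 hyu.le

end TimeChange

namespace C1Spacetime

variable {n : ℕ} {M : C1Spacetime n}

theorem isFdCausalGeodesicOn_of_hasDerivWithinAt {γ w : ℝ → SpacetimePt n} {I : Set ℝ}
    (hI : UniqueDiffOn ℝ I) (hγ : ∀ t ∈ I, HasDerivWithinAt γ (w t) I t)
    (hw : ∀ t ∈ I, HasDerivWithinAt w (-M.lor.chris (γ t) (w t) (w t)) I t)
    (hc : ∀ t ∈ I, M.lor.IsFutureCausal (γ t) (w t)) : M.IsFdCausalGeodesicOn γ I := by
  have hγd : ∀ t ∈ I, derivWithin γ I t = w t := fun t ht => (hγ t ht).derivWithin (hI t ht)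
  have hγc : ContinuousOn γ I := fun t ht => (hγ t ht).continuousWithinAt
  have hwc : ContinuousOn w I := fun t ht => (hw t ht).continuousWithinAt
  refine ⟨⟨?_, fun t ht k => ?_⟩, fun t ht => ?_⟩
  · rw [show (2 : WithTop ℕ∞) = 1 + 1 from one_add_one_eq_two.symm,
      contDiffOn_succ_iff_derivWithin hI]
    refine ⟨fun t ht => (hγ t ht).differentiableWithinAt, by simp, ?_⟩
    refine ContDiffOn.congr ?_ hγd
    rw [contDiffOn_one_iff_derivWithin hI]
    refine ⟨fun t ht => (hw t ht).differentiableWithinAt, ?_⟩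
    refine ContinuousOn.congr ?_ fun t ht => (hw t ht).derivWithin (hI t ht)
    exact (((M.lor.continuous_chris.comp_continuousOn hγc).clm_apply hwc).clm_apply hwc).neg
  · have h1 : derivWithin (fun s => derivWithin γ I s k) I t =
        derivWithin (fun s => w s k) I t :=
      derivWithin_congr (fun s hs => by rw [hγd s hs]) (by rw [hγd t ht])
    have h2 := (hasDerivWithinAt_pi.1 (hw t ht) k).derivWithin (hI t ht)
    have h3 : M.lor.chris (γ t) (w t) (w t) k = _ := M.chris_apply (γ t) (w t) (w t) k
    rw [h1, h2, hγd t ht, Pi.neg_apply, h3, neg_add_cancel]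
  · rw [hγd t ht, ← isFutureCausal_iff]
    exact hc t ht

/-- Condition A along reparametrized geodesics. -/
theorem FutureConditionA.tendsto_ldist (hA : M.FutureConditionA) {lam : ℝ → ℝ}
    {x v : ℝ → SpacetimePt n} (h : M.lor.IsGeodesicFlow lam x v)
    (hlim : ¬ ∃ z, Tendsto x atTop (𝓝 z)) {p : SpacetimePt n} (hp : M.chron p (x 0)) :
    Tendsto (fun t => M.ldist p (x t)) atTop (𝓝 ⊤) := by
  have hinj := (h.locBdd.strictMono_timeChange h.pos).injective
  set s := timeChange lam
  set r := Function.invFun s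
  have hr : ∀ t, r (s t) = t := Function.leftInverse_invFun hinj
  have hr' : ∀ t, r (timeChange lam t) = t := hr
  have hr0 : r 0 = 0 := by
    have := hr 0
    rwa [show s 0 = 0 from timeChange_zero] at this
  have hderiv : ∀ y ∈ s '' Ici 0, HasDerivWithinAt (x ∘ r) ((v ∘ r) y) (s '' Ici 0) y := by
    rintro _ ⟨t, ht, rfl⟩
    rw [Function.comp_apply, hr]
    exact h.locBdd.hasDerivWithinAt_comp_timeChange h.pos h.continuous_vel h.eq_add_integral hr ht
  have hderiv' : ∀ y ∈ s '' Ici 0, HasDerivWithinAt (v ∘ r)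
      (-M.lor.chris ((x ∘ r) y) ((v ∘ r) y) ((v ∘ r) y)) (s '' Ici 0) y := by
    rintro _ ⟨t, ht, rfl⟩
    have hc : Continuous fun t => -M.lor.chris (x t) (v t) (v t) :=
      (M.lor.continuous_chris_apply h.continuous h.continuous_vel h.continuous_vel).neg
    have := h.locBdd.hasDerivWithinAt_comp_timeChange h.pos hc h.vel_eq_add_integral hr ht
    simpa only [Function.comp_apply, hr] using this
  have hcausal : ∀ y ∈ s '' Ici 0, M.lor.IsFutureCausal ((x ∘ r) y) ((v ∘ r) y) := by
    rintro _ ⟨t, ht, rfl⟩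
    simpa only [Function.comp_apply, hr] using h.isFutureCausal t ht
  have hx0 : (x ∘ r) 0 = x 0 := by rw [Function.comp_apply, hr0]
  have hcomp : ∀ l : Filter ℝ, Tendsto s atTop l → ¬ ∃ z, Tendsto (x ∘ r) l (𝓝 z) := by
    rintro l hl ⟨z, hz⟩
    refine hlim ⟨z, ?_⟩
    simpa only [Function.comp_def, hr] using hz.comp hl
  rcases h.locBdd.image_timeChange h.pos with ⟨hI, hs⟩ | ⟨c, hc, hI, hs⟩
  · rw [hI] at hderiv hderiv' hcausal
    have := ((hA p _ hp).2 _ (isFdCausalGeodesicOn_of_hasDerivWithinAt (uniqueDiffOn_Ici 0)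
      hderiv hderiv' hcausal) hx0 (hcomp _ hs)).comp hs
    simpa only [Function.comp_def, s, hr'] using this
  · rw [hI] at hderiv hderiv' hcausal
    have := ((hA p _ hp).1 c hc _ (isFdCausalGeodesicOn_of_hasDerivWithinAt (uniqueDiffOn_Ico 0 c)
      hderiv hderiv' hcausal) hx0 (hcomp _ hs)).comp hs
    simpa only [Function.comp_def, s, hr'] using this

end C1Spacetime

namespace C1Spacetime

variable {n : ℕ} {M : C1Spacetime n}

/-- A causal curve none of whose points lies in the chronological future of its starting point is
a reparametrized null geodesic. -/
theorem exists_isGeodesicFlow_of_not_chron {x : SpacetimePt n} {U : ℝ → SpacetimePt n}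
    (hU : LocBdd U) (hU0 : ∀ t < 0, U t = 0)
    (hc : ∀ᵐ t, t ∈ Ioi 0 → M.lor.IsFutureCausal (curveOf x U t) (U t))
    (hn : ∀ T > 0, ¬ M.chron x (curveOf x U T)) :
    ∃ lam v, M.lor.IsGeodesicFlow lam (curveOf x U) v := by
  obtain ⟨P, Q, h⟩ := M.lor.exists_isTransport x hU hU0
  set lam : ℝ → ℝ := fun t => M.lor.metric x (Q t (U t)) (-M.lor.X0 x) with hlam
  have hpos : ∀ᵐ t, t ∈ Ioi 0 → 0 < lam t := by
    filter_upwards [hc] with t h1 ht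
    have h2 := (h.isFutureCausal_inv (h1 ht)).2
    simp only [hlam, map_neg]
    linarith
  have hdir : ∀ N : ℕ, ∃ m, M.lor.metric x m m = 0 ∧ M.lor.metric x m (M.lor.X0 x) = -1 ∧
      ∀ᵐ t, t ∈ Ioo 0 ((N : ℝ) + 1) → Q t (U t) = lam t • m := by
    intro N
    have hN : (0 : ℝ) < N + 1 := by positivity
    have hcN : ∀ᵐ t, t ∈ Ioc 0 ((N : ℝ) + 1) →
        M.lor.IsFutureCausal (curveOf x U t) (U t) := by
      filter_upwards [hc] with t h1 ht using h1 ht.1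
    have := h.exists_null_direction hN hcN fun hD =>
      hn _ hN (eventually_chron_of_isTransport h hN hcN hD).self_of_nhds
    simpa only [hlam, map_neg] using this
  choose m hm0 hm1 hm using hdir
  have hmN : ∀ N, m N = m 0 := by
    intro N
    by_contra hne
    refine false_of_ae_Ioo zero_lt_one ?_
    filter_upwards [hm N, hm 0, hpos] with t h1 h2 h3 ht
    have hN : (0 : ℝ) ≤ N := Nat.cast_nonneg N
    have h4 := h1 ⟨ht.1, by linarith [ht.2]⟩
    rw [h2 ⟨ht.1, by simpa using ht.2⟩] at h4
    exact hne (smul_right_injective _ (h3 ht.1).ne' h4).symm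
  have hUv : ∀ᵐ t, t ∈ Ioi 0 → U t = lam t • P t (m 0) := by
    filter_upwards [ae_all_iff.2 hm] with t h1 ht
    have h2 := h1 ⌈t⌉₊ ⟨ht, (Nat.le_ceil t).trans_lt (lt_add_one _)⟩
    rw [hmN] at h2
    rw [← map_smul, ← h2, h.apply_inv]
  have hvc : Continuous fun t => P t (m 0) := h.continuous.clm_apply continuous_const
  have hP0 : P 0 (m 0) = m 0 := by
    rw [h.eq_add_integral 0, intervalIntegral.integral_same, add_zero]; rfl
  have hfut : M.lor.IsFutureCausal x (m 0) := ⟨(hm0 0).le, by rw [hm1 0]; norm_num⟩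
  refine ⟨lam, fun t => P t (m 0), h.locBdd_inv_apply _, hpos, hU.continuous_curveOf, hvc,
    fun t ht => ?_, fun t ht => ?_, fun t _ => h.isFutureCausal_apply hfut t⟩
  · rw [curveOf_zero, curveOf]
    congr 1
    refine intervalIntegral.integral_congr_ae ?_
    filter_upwards [hUv] with s hs hst
    rw [uIoc_of_le ht] at hst
    exact hs hst.1
  · rw [hP0]
    conv_lhs => rw [h.eq_add_integral t]
    rw [add_apply, ContinuousLinearMap.intervalIntegral_apply
      (h.locBdd_coeff.intervalIntegrable _ _)]
    refine congrArg (m 0 + ·) (intervalIntegral.integral_congr_ae ?_)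
    filter_upwards [hUv] with s hs hst
    rw [uIoc_of_le ht] at hst
    conv_lhs => rw [hs hst.1]
    simp

theorem causalLe_of_isGeodesicFlow {lam : ℝ → ℝ} {x v : ℝ → SpacetimePt n}
    (h : M.lor.IsGeodesicFlow lam x v) {t : ℝ} (ht : 0 ≤ t) : M.causalLe (x 0) (x t) := by
  have hU : LocBdd fun s => lam s • v s := h.locBdd.smul_continuous h.continuous_vel
  have hx : ∀ s, 0 ≤ s → curveOf (x 0) (fun s => lam s • v s) s = x s := fun s hs =>
    (h.eq_add_integral s hs).symm
  have hpath := LocBdd.isPathOn_Ici (M := M) (x := x 0) hU (by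
    filter_upwards [h.pos] with s h1 hs
    rw [hx s (le_of_lt hs)]
    exact (h.isFutureCausal s (le_of_lt hs)).smul (h1 hs))
  have := isPathOn_causalLe ordConnected_Ici hpath (mem_Ici.2 le_rfl) (mem_Ici.2 ht) ht
  rwa [hx 0 le_rfl, hx t ht] at this

theorem pastLimit_mem_nhds_of_futureConditionA (hGH : M.GloballyHyperbolic)
    (hA : M.FutureConditionA) {x : ℕ → SpacetimePt n}
    (hinf : Tendsto (fun m => ‖x m‖) atTop atTop) {B : ℝ} {p : SpacetimePt n}
    (hB : ∀ u ∈ M.pastLimit x, M.ldist p u ≤ ENNReal.ofReal B) {u : SpacetimePt n}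
    (hu : u ∈ M.pastLimit x) (hpu : M.chron p u) : M.pastLimit x ∈ 𝓝 u := by
  by_contra hnhds
  have hstep : ∀ y : M.pastLimit x, ∃ y' : M.pastLimit x,
      M.causalLe y.1 y'.1 ∧ ‖y'.1‖ = ‖y.1‖ + 1 := by
    rintro ⟨y, hy⟩
    obtain ⟨z, hz, hyz, hn⟩ := exists_mem_pastLimit_norm_eq hGH hinf hy (lt_add_one ‖y‖)
    exact ⟨⟨z, hz⟩, hyz, hn⟩
  choose f hf hfn using hstep
  set w : ℕ → M.pastLimit x := fun k => f^[k] ⟨u, hu⟩ with hw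
  have hws : ∀ k, w (k + 1) = f (w k) := fun k => Function.iterate_succ_apply' f k _
  have hwn : ∀ k : ℕ, ‖(w k).1‖ = ‖u‖ + k := by
    intro k
    induction k with
    | zero => simp [hw]
    | succ k ih => rw [hws, hfn, ih]; push_cast; ring
  obtain ⟨U, hU, hU0, hUk, hUc⟩ := exists_causal_curve_of_chain (M := M)
    (x := fun k => (w k).1) fun k => by
      have h1 : M.causalLe (w k).1 (w (k + 1)).1 := by rw [hws]; exact hf _
      refine (causalLe_iff.1 h1).resolve_left fun h2 => ?_
      have h3 := congrArg norm h2
      rw [hwn, hwn] at h3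
      push_cast at h3
      linarith
  change ∀ k : ℕ, curveOf u U k = (w k).1 at hUk
  change ∀ᵐ t, t ∈ Ioi 0 → M.lor.IsFutureCausal (curveOf u U t) (U t) at hUc
  have hmem : ∀ t, 0 ≤ t → curveOf u U t ∈ M.pastLimit x := fun t ht => by
    have h1 := isPathOn_causalLe ordConnected_Ici (LocBdd.isPathOn_Ici hU hUc) (mem_Ici.2 ht)
      (mem_Ici.2 (Nat.cast_nonneg ⌈t⌉₊)) (Nat.le_ceil t)
    rw [hUk] at h1
    exact h1.mem_pastLimit (w _).2
  obtain ⟨lam, v, hflow⟩ := exists_isGeodesicFlow_of_not_chron hU hU0 hUc fun T hT hcon =>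
    hnhds (hcon.pastLimit_mem_nhds (hmem T hT.le))
  have hlim : ¬ ∃ z, Tendsto (curveOf u U) atTop (𝓝 z) := by
    rintro ⟨z, hz⟩
    have h1 := (hz.comp tendsto_natCast_atTop_atTop).norm
    simp only [Function.comp_apply, hUk, hwn] at h1
    exact not_tendsto_nhds_of_tendsto_atTop
      (tendsto_atTop_add_const_left _ _ tendsto_natCast_atTop_atTop) _ h1
  have htop := hA.tendsto_ldist hflow hlim (p := p) (by rwa [curveOf_zero])
  obtain ⟨t, ht, hlt⟩ := ((eventually_ge_atTop 0).and
    (htop.eventually (lt_mem_nhds (ENNReal.ofReal_lt_top (r := B))))).exists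
  exact absurd (hB _ (hmem t ht)) (not_le.2 hlt)

theorem FutureConditionA.futureFinitelyCompact (hGH : M.GloballyHyperbolic)
    (hA : M.FutureConditionA) : M.FutureFinitelyCompact := by
  intro B hB p q x hx
  by_contra hcl
  push Not at hcl
  have hinf := tendsto_norm_atTop_of_forall_not_mapClusterPt hcl
  have hpq := (hx 0).1
  have hq : q ∈ M.pastLimit x := mem_pastLimit_of_le fun m => (hx m).2.1
  have hAB : ∀ u ∈ M.pastLimit x, M.ldist p u ≤ ENNReal.ofReal B := fun u hu =>
    ldist_le_of_mem_pastLimit hB.le (fun m => (hx m).2.2) hu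
  have hsub : ∀ z, M.chron p z → z ∈ M.pastLimit x := by
    intro z hpz
    obtain ⟨U, hU⟩ := chron_iff.1 hpz
    have hcont : Continuous (curveOf p U) := hU.locBdd.continuous_curveOf
    have h1 : Icc 0 1 ⊆ curveOf p U ⁻¹' M.pastLimit x := by
      refine IsClosed.Icc_subset_of_forall_mem_nhdsWithin
        ((isClosed_pastLimit.preimage hcont).inter isClosed_Icc) ?_ fun t ht => ?_
      · rw [mem_preimage, curveOf_zero]
        exact mem_of_mem_nhds (hpq.pastLimit_mem_nhds hq)
      · refine nhdsWithin_le_nhds (hcont.continuousAt.preimage_mem_nhds ?_)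
        rcases ht.2.1.eq_or_lt with h0 | h0
        · rw [← h0, curveOf_zero]
          exact hpq.pastLimit_mem_nhds hq
        · refine pastLimit_mem_nhds_of_futureConditionA hGH hA hinf hAB ht.1 ?_
          have h2 := chron_of_isPathOn h0 (hU.isPathOn.mono (Icc_subset_Icc_right ht.2.2.le))
          rwa [curveOf_zero] at h2
    rw [← hU.endpoint]
    exact h1 ⟨zero_le_one, le_rfl⟩
  obtain ⟨lam, γ, v, hflow, h0, hlim⟩ := M.lor.exists_isGeodesicFlow q
  have htop := hA.tendsto_ldist hflow hlim (p := p) (by rwa [h0])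
  obtain ⟨t, ht, hlt⟩ := ((eventually_ge_atTop 0).and
    (htop.eventually (lt_mem_nhds (ENNReal.ofReal_lt_top (r := B))))).exists
  have hle := causalLe_of_isGeodesicFlow hflow ht
  rw [h0] at hle
  exact absurd (hAB _ (hsub _ (hpq.trans_causalLe hle))) (not_le.2 hlt)

end C1Spacetime

open C1Spacetime in
/-- Theorem 4.13 (main theorem): for a globally hyperbolic, causally non-branching,
non-intertwining C¹-spacetime, finite compactness, timelike Cauchy completeness and
Condition A are pairwise equivalent. -/
theorem finitelyCompact_iff_tcc_iff_conditionA
    {n : ℕ} (hn : 2 ≤ n) (M : C1Spacetime n) (hGH : M.GloballyHyperbolic)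
    (hnb : M.CausallyNonBranching) (hni : M.NonIntertwining) :
    (M.FinitelyCompact ↔ M.TimelikeCauchyComplete) ∧
      (M.TimelikeCauchyComplete ↔ M.ConditionA) := by
  rw [finitelyCompact_iff, timelikeCauchyComplete_iff, conditionA_iff]
  have hcompact {N : C1Spacetime n} (hN : N.GloballyHyperbolic) :
      N.FutureFinitelyCompact ↔ N.FutureCauchyComplete :=
    ⟨fun h => h.futureCauchyComplete hN, fun h => h.futureFinitelyCompact hN⟩
  have hcond {N : C1Spacetime n} (hN : N.GloballyHyperbolic) :
      N.FutureFinitelyCompact ↔ N.FutureConditionA :=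
    ⟨fun h => h.futureConditionA hN, fun h => h.futureFinitelyCompact hN⟩
  rw [← hcompact hGH, ← hcompact hGH.rev, ← hcond hGH, ← hcond hGH.rev]
  exact ⟨Iff.rfl, Iff.rfl⟩
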